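/- Asymptotic fixed point (state evolution) equations for the overlaps: In the perturbed bipartite model with s_n = n^{−1/4} and (a_u, a_v) uniform on [1,2]², with E_a denoting expectation over (a_u,a_v): E_a|E⟨u⁽¹⁾·u⁽²⁾⟩_n − F_{P_U}(λ·E⟨v⁽¹⁾·v⁽²⁾⟩_n + λ·q_u)| → 0 and E_a|E⟨v⁽¹⁾·v⁽²⁾⟩_n − F_{P_V}(λ·E⟨u⁽¹⁾·u⁽²⁾⟩_n + λ·q_v)| → 0 as n → ∞. -/

import Mathlib

open MeasureTheory ProbabilityTheory Filter Real
open scoped Topology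

noncomputable section

/-- Standard Gaussian measure on `ℝ`. -/
def stdG : Measure ℝ := gaussianReal 0 1

/-- The weight `exp(√γ·x·z + γ·x·x₀ − γ·x²/2)` appearing in the scalar Gaussian channel. -/
def scalarWeight (γ x₀ z x : ℝ) : ℝ :=
  Real.exp (Real.sqrt γ * x * z + γ * x * x₀ - γ * x ^ 2 / 2)

/-- Free energy `ψ_P(γ)` of the scalar Gaussian channel with prior `P`. -/
def psiF (P : Measure ℝ) [IsProbabilityMeasure P] (γ : ℝ) : ℝ :=
  ∫ p : ℝ × ℝ, Real.log (∫ x, scalarWeight γ p.1 p.2 x ∂P) ∂(P.prod stdG)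

/-- Posterior mean `⟨x⟩_γ` in the scalar Gaussian channel (`x₀` is the signal, `z` the noise). -/
def postMean (P : Measure ℝ) (γ x₀ z : ℝ) : ℝ :=
  (∫ x, x * scalarWeight γ x₀ z x ∂P) / (∫ x, scalarWeight γ x₀ z x ∂P)

/-- Overlap `F_P(γ) = E[X₀·⟨x⟩_γ]` of the scalar Gaussian channel. -/
def Fov (P : Measure ℝ) [IsProbabilityMeasure P] (γ : ℝ) : ℝ :=
  ∫ p : ℝ × ℝ, p.1 * postMean P γ p.1 p.2 ∂(P.prod stdG)

/-- The set `Γ(λ)` of fixed points of the state evolution equations. -/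
def Gam (PU PV : Measure ℝ) [IsProbabilityMeasure PU] [IsProbabilityMeasure PV]
    (lam : ℝ) : Set (ℝ × ℝ) :=
  {q | 0 ≤ q.1 ∧ 0 ≤ q.2 ∧ q.2 = Fov PU (lam * q.1) ∧ q.1 = Fov PV (lam * q.2)}

/-- The replica-symmetric potential `𝓕(λ,q₁,q₂)`. -/
def rsF (PU PV : Measure ℝ) [IsProbabilityMeasure PU] [IsProbabilityMeasure PV]
    (lam q₁ q₂ : ℝ) : ℝ :=
  psiF PU (lam * q₁) + psiF PV (lam * q₂) - lam / 2 * q₁ * q₂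

/-- Prior distribution of the pair of vectors `(u,v)`. -/
def prior (PU PV : Measure ℝ) [IsProbabilityMeasure PU] [IsProbabilityMeasure PV]
    (n : ℕ) : Measure ((Fin n → ℝ) × (Fin n → ℝ)) :=
  (Measure.pi fun _ => PU).prod (Measure.pi fun _ => PV)

/-- Law of the Gaussian noise matrix `Z`. -/
def noiseM (n : ℕ) : Measure (Fin n → Fin n → ℝ) :=
  Measure.pi fun _ => Measure.pi fun _ => stdG

/-- Joint law of `((U,V),Z)`. -/
def sampleM (PU PV : Measure ℝ) [IsProbabilityMeasure PU] [IsProbabilityMeasure PV]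
    (n : ℕ) : Measure (((Fin n → ℝ) × (Fin n → ℝ)) × (Fin n → Fin n → ℝ)) :=
  (prior PU PV n).prod (noiseM n)

/-- Hamiltonian `H_n(u,v)` of the planted bipartite model. -/
def Ham (lam : ℝ) (n : ℕ) (U V : Fin n → ℝ) (Z : Fin n → Fin n → ℝ)
    (u v : Fin n → ℝ) : ℝ :=
  ∑ i : Fin n, ∑ j : Fin n,
    (Real.sqrt (lam / n) * u i * v j * Z i j
      + lam / n * (u i * U i * v j * V j)
      - lam / (2 * n) * (u i ^ 2 * v j ^ 2))

/-- Partition function `Z_n = ∫ e^{H_n(u,v)} dP₀ⁿ(u,v)`. -/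
def partFun (PU PV : Measure ℝ) [IsProbabilityMeasure PU] [IsProbabilityMeasure PV]
    (lam : ℝ) (n : ℕ)
    (ω : ((Fin n → ℝ) × (Fin n → ℝ)) × (Fin n → Fin n → ℝ)) : ℝ :=
  ∫ uv, Real.exp (Ham lam n ω.1.1 ω.1.2 ω.2 uv.1 uv.2) ∂(prior PU PV n)

/-- Free energy `F_n(λ) = (1/n)·E[log Z_n]`. -/
def freeEnergy (PU PV : Measure ℝ) [IsProbabilityMeasure PU] [IsProbabilityMeasure PV]
    (n : ℕ) (lam : ℝ) : ℝ :=
  (1 / (n : ℝ)) * ∫ ω, Real.log (partFun PU PV lam n ω) ∂(sampleM PU PV n)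

/-- Gibbs (posterior) expectation `⟨f(u,v)⟩` given the realization `ω = ((U,V),Z)`. -/
def gibbs (PU PV : Measure ℝ) [IsProbabilityMeasure PU] [IsProbabilityMeasure PV]
    (lam : ℝ) (n : ℕ)
    (ω : ((Fin n → ℝ) × (Fin n → ℝ)) × (Fin n → Fin n → ℝ))
    (f : (Fin n → ℝ) × (Fin n → ℝ) → ℝ) : ℝ :=
  (∫ uv, f uv * Real.exp (Ham lam n ω.1.1 ω.1.2 ω.2 uv.1 uv.2) ∂(prior PU PV n))
    / partFun PU PV lam n ω

/-- Rescaled scalar product `x·y = (1/n)·Σᵢ xᵢyᵢ`. -/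
def ovDot (n : ℕ) (x y : Fin n → ℝ) : ℝ := (1 / (n : ℝ)) * ∑ i, x i * y i

/-- Law of a vector of `n` i.i.d. standard Gaussians. -/
def gvec (n : ℕ) : Measure (Fin n → ℝ) := Measure.pi fun _ => stdG

/-- Joint law of `((U,V), Z, ((Z^u,Z^v),(z^u,z^v)))`: signal, noise matrix and the four
extra Gaussian vectors of the side channels and of the perturbation. -/
def sampleP (PU PV : Measure ℝ) [IsProbabilityMeasure PU] [IsProbabilityMeasure PV]
    (n : ℕ) :
    Measure ((((Fin n → ℝ) × (Fin n → ℝ)) × (Fin n → Fin n → ℝ)) ×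
      (((Fin n → ℝ) × (Fin n → ℝ)) × ((Fin n → ℝ) × (Fin n → ℝ)))) :=
  (sampleM PU PV n).prod (((gvec n).prod (gvec n)).prod ((gvec n).prod (gvec n)))

/-- The perturbation strength `s_n = n^{-1/4}`. -/
def sSeq (n : ℕ) : ℝ := (n : ℝ) ^ (-(1 / 4 : ℝ))

/-- Total Hamiltonian `H_n^{(tot)} = H_n + H_n^{(s)} + H_n^{(pert)}`, where
`ω = (((U,V),Z), ((Z^u,Z^v),(z^u,z^v)))`. -/
def HamTot (lam qu qv : ℝ) (n : ℕ) (au av : ℝ)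
    (ω : (((Fin n → ℝ) × (Fin n → ℝ)) × (Fin n → Fin n → ℝ)) ×
      (((Fin n → ℝ) × (Fin n → ℝ)) × ((Fin n → ℝ) × (Fin n → ℝ))))
    (u v : Fin n → ℝ) : ℝ :=
  Ham lam n ω.1.1.1 ω.1.1.2 ω.1.2 u v
  + (∑ i : Fin n,
      (Real.sqrt (lam * qu) * u i * ω.2.1.1 i + lam * qu * u i * ω.1.1.1 i
          - lam * qu / 2 * u i ^ 2
        + Real.sqrt (lam * qv) * v i * ω.2.1.2 i + lam * qv * v i * ω.1.1.2 i
          - lam * qv / 2 * v i ^ 2))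
  + (∑ i : Fin n,
      (Real.sqrt (sSeq n) * au * ω.2.2.1 i * u i + sSeq n * au ^ 2 * u i * ω.1.1.1 i
        - sSeq n * au ^ 2 / 2 * u i ^ 2))
  + (∑ i : Fin n,
      (Real.sqrt (sSeq n) * av * ω.2.2.2 i * v i + sSeq n * av ^ 2 * v i * ω.1.1.2 i
        - sSeq n * av ^ 2 / 2 * v i ^ 2))

/-- Gibbs expectation `⟨f(u,v)⟩_n` for the total Hamiltonian. -/
def gibbsTot (PU PV : Measure ℝ) [IsProbabilityMeasure PU] [IsProbabilityMeasure PV]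
    (lam qu qv : ℝ) (n : ℕ) (au av : ℝ)
    (ω : (((Fin n → ℝ) × (Fin n → ℝ)) × (Fin n → Fin n → ℝ)) ×
      (((Fin n → ℝ) × (Fin n → ℝ)) × ((Fin n → ℝ) × (Fin n → ℝ))))
    (f : (Fin n → ℝ) × (Fin n → ℝ) → ℝ) : ℝ :=
  (∫ uv, f uv * Real.exp (HamTot lam qu qv n au av ω uv.1 uv.2) ∂(prior PU PV n))
    / ∫ uv, Real.exp (HamTot lam qu qv n au av ω uv.1 uv.2) ∂(prior PU PV n)

/-- `E⟨u⁽¹⁾·u⁽²⁾⟩_n`. -/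
def EovU (PU PV : Measure ℝ) [IsProbabilityMeasure PU] [IsProbabilityMeasure PV]
    (lam qu qv : ℝ) (n : ℕ) (au av : ℝ) : ℝ :=
  ∫ ω, gibbsTot PU PV lam qu qv n au av ω
      (fun uv1 => gibbsTot PU PV lam qu qv n au av ω
        (fun uv2 => ovDot n uv1.1 uv2.1)) ∂(sampleP PU PV n)

/-- `E⟨v⁽¹⁾·v⁽²⁾⟩_n`. -/
def EovV (PU PV : Measure ℝ) [IsProbabilityMeasure PU] [IsProbabilityMeasure PV]
    (lam qu qv : ℝ) (n : ℕ) (au av : ℝ) : ℝ :=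
  ∫ ω, gibbsTot PU PV lam qu qv n au av ω
      (fun uv1 => gibbsTot PU PV lam qu qv n au av ω
        (fun uv2 => ovDot n uv1.2 uv2.2)) ∂(sampleP PU PV n)


set_option linter.unusedSectionVars false
set_option linter.unusedVariables false


/-! ### Finite Gibbs averages -/

/-- Gibbs average of `f` for prior weights `p` and Hamiltonian `H` on a finite space. -/
def gav {X : Type*} [Fintype X] (p H f : X → ℝ) : ℝ :=
  (∑ x, p x * exp (H x) * f x) / ∑ x, p x * exp (H x)

/-- `p` is a probability vector. -/
structure IsW {X : Type*} [Fintype X] (p : X → ℝ) : Prop where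
  nonneg : ∀ x, 0 ≤ p x
  sum_eq : ∑ x, p x = 1

section gavlemmas
variable {X : Type*} [Fintype X] {p : X → ℝ}

lemma gav_Zpos (hp : IsW p) (H : X → ℝ) : 0 < ∑ x, p x * exp (H x) := by
  refine lt_of_le_of_ne (Finset.sum_nonneg fun x _ => mul_nonneg (hp.nonneg x) (exp_pos _).le) ?_
  intro h
  have h2 := (Finset.sum_eq_zero_iff_of_nonneg
    (fun x _ => mul_nonneg (hp.nonneg x) (exp_pos (H x)).le)).1 h.symm
  have h3 : ∑ x, p x = 0 := Finset.sum_eq_zero fun x hx => by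
    have := h2 x hx
    rcases mul_eq_zero.1 this with h | h
    · exact h
    · exact absurd h (exp_pos _).ne'
  rw [hp.sum_eq] at h3
  exact one_ne_zero h3

lemma gav_const (hp : IsW p) (H : X → ℝ) (c : ℝ) : gav p H (fun _ => c) = c := by
  unfold gav
  rw [← Finset.sum_mul, mul_div_assoc, mul_comm, div_mul_cancel₀]
  exact (gav_Zpos hp H).ne'

lemma gav_add (H f g : X → ℝ) : gav p H (fun x => f x + g x) = gav p H f + gav p H g := by
  unfold gav
  rw [← add_div, ← Finset.sum_add_distrib]
  simp only [mul_add]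

lemma gav_sub (H f g : X → ℝ) : gav p H (fun x => f x - g x) = gav p H f - gav p H g := by
  unfold gav
  rw [← sub_div, ← Finset.sum_sub_distrib]
  simp only [mul_sub]

lemma gav_mul_left (H f : X → ℝ) (c : ℝ) : gav p H (fun x => c * f x) = c * gav p H f := by
  unfold gav
  rw [← mul_div_assoc, Finset.mul_sum]
  congr 1
  exact Finset.sum_congr rfl fun x _ => by ring

lemma gav_mul_right (H f : X → ℝ) (c : ℝ) : gav p H (fun x => f x * c) = gav p H f * c := by
  rw [mul_comm, ← gav_mul_left]; simp only [mul_comm]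

lemma gav_sum {ι : Type*} (s : Finset ι) (H : X → ℝ) (f : ι → X → ℝ) :
    gav p H (fun x => ∑ k ∈ s, f k x) = ∑ k ∈ s, gav p H (f k) := by
  unfold gav
  rw [← Finset.sum_div, Finset.sum_comm]
  simp only [Finset.mul_sum]

lemma gav_mono (hp : IsW p) (H : X → ℝ) {f g : X → ℝ} (h : ∀ x, f x ≤ g x) :
    gav p H f ≤ gav p H g := by
  unfold gav
  have := gav_Zpos hp H
  gcongr with x
  · exact mul_nonneg (hp.nonneg x) (exp_pos _).le
  · exact h x

lemma gav_nonneg (hp : IsW p) (H : X → ℝ) {f : X → ℝ} (h : ∀ x, 0 ≤ f x) : 0 ≤ gav p H f := by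
  have := gav_mono hp H h
  rwa [gav_const hp] at this

lemma gav_neg (H f : X → ℝ) : gav p H (fun x => - f x) = - gav p H f := by
  have := gav_mul_left (p := p) H f (-1)
  simpa using this

lemma gav_abs (hp : IsW p) (H f : X → ℝ) : |gav p H f| ≤ gav p H (fun x => |f x|) := by
  rw [abs_le]
  constructor
  · rw [← gav_neg]
    exact gav_mono hp H fun x => neg_abs_le _
  · exact gav_mono hp H fun x => le_abs_self _

lemma gav_abs_le (hp : IsW p) (H : X → ℝ) {f : X → ℝ} {B : ℝ} (h : ∀ x, |f x| ≤ B) :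
    |gav p H f| ≤ B := by
  refine (gav_abs hp H f).trans ?_
  refine (gav_mono hp H h).trans ?_
  rw [gav_const hp]

lemma gav_shift (H f : X → ℝ) (c : ℝ) : gav p (fun x => H x + c) f = gav p H f := by
  unfold gav
  have h1 : ∑ x, p x * exp (H x + c) * f x = exp c * ∑ x, p x * exp (H x) * f x := by
    rw [Finset.mul_sum]
    exact Finset.sum_congr rfl fun x _ => by rw [exp_add]; ring
  have h2 : ∑ x, p x * exp (H x + c) = exp c * ∑ x, p x * exp (H x) := by
    rw [Finset.mul_sum]
    exact Finset.sum_congr rfl fun x _ => by rw [exp_add]; ring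
  rw [h1, h2, mul_div_mul_left _ _ (exp_pos c).ne']

lemma gav_swap (H : X → ℝ) (F : X → X → ℝ) :
    gav p H (fun x => gav p H (fun y => F x y)) = gav p H (fun y => gav p H (fun x => F x y)) := by
  unfold gav
  simp only [mul_div_assoc', ← Finset.sum_div]
  congr 2
  simp only [Finset.mul_sum]
  rw [Finset.sum_comm]
  exact Finset.sum_congr rfl fun x _ => Finset.sum_congr rfl fun y _ => by ring

lemma gav_sq_le (hp : IsW p) (H f : X → ℝ) : (gav p H f) ^ 2 ≤ gav p H (fun x => f x ^ 2) := by
  have h := gav_nonneg hp H (f := fun x => (f x - gav p H f) ^ 2) (fun x => sq_nonneg _)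
  have e : (fun x => (f x - gav p H f) ^ 2)
      = fun x => (f x ^ 2 - (2 * gav p H f) * f x) + gav p H f ^ 2 := by
    ext x; ring
  rw [e, gav_add, gav_sub, gav_mul_left, gav_const hp] at h
  nlinarith

lemma gav_hasDerivAt (hp : IsW p) {H : ℝ → X → ℝ} {H' : X → ℝ} {t : ℝ}
    (hH : ∀ x, HasDerivAt (fun s => H s x) (H' x) t) (f : X → ℝ) :
    HasDerivAt (fun s => gav p (H s) f)
      (gav p (H t) (fun x => f x * H' x) - gav p (H t) f * gav p (H t) H') t := by
  unfold gav
  have h1 : HasDerivAt (fun s => ∑ x, p x * exp (H s x) * f x)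
      (∑ x, p x * (exp (H t x) * H' x) * f x) t :=
    HasDerivAt.fun_sum fun x _ => (((hH x).exp).const_mul (p x)).mul_const (f x)
  have h2 : HasDerivAt (fun s => ∑ x, p x * exp (H s x))
      (∑ x, p x * (exp (H t x) * H' x)) t :=
    HasDerivAt.fun_sum fun x _ => (((hH x).exp).const_mul (p x))
  have h0 := (gav_Zpos hp (H t)).ne'
  refine (h1.div h2 h0).congr_deriv ?_
  have e1 : ∑ x, p x * (exp (H t x) * H' x) * f x = ∑ x, p x * exp (H t x) * (f x * H' x) :=
    Finset.sum_congr rfl fun x _ => by ring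
  have e2 : ∑ x, p x * (exp (H t x) * H' x) = ∑ x, p x * exp (H t x) * H' x :=
    Finset.sum_congr rfl fun x _ => by ring
  rw [e1, e2]
  field_simp

lemma logZ_hasDerivAt (hp : IsW p) {H : ℝ → X → ℝ} {H' : X → ℝ} {t : ℝ}
    (hH : ∀ x, HasDerivAt (fun s => H s x) (H' x) t) :
    HasDerivAt (fun s => log (∑ x, p x * exp (H s x))) (gav p (H t) H') t := by
  have h2 : HasDerivAt (fun s => ∑ x, p x * exp (H s x))
      (∑ x, p x * (exp (H t x) * H' x)) t :=
    HasDerivAt.fun_sum fun x _ => (((hH x).exp).const_mul (p x))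
  have h0 := (gav_Zpos hp (H t)).ne'
  refine (h2.log h0).congr_deriv ?_
  unfold gav
  congr 1
  exact Finset.sum_congr rfl fun x _ => by ring

lemma gav_continuous (hp : IsW p) {T : Type*} [TopologicalSpace T] {H f : T → X → ℝ}
    (hH : ∀ x, Continuous fun t => H t x) (hf : ∀ x, Continuous fun t => f t x) :
    Continuous fun t => gav p (H t) (f t) := by
  unfold gav
  refine Continuous.div ?_ ?_ (fun t => (gav_Zpos hp (H t)).ne')
  · exact continuous_finsetSum _ fun x _ => ((hH x).rexp.const_mul (p x)).mul (hf x)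
  · exact continuous_finsetSum _ fun x _ => ((hH x).rexp.const_mul (p x))

lemma logZ_continuous (hp : IsW p) {T : Type*} [TopologicalSpace T] {H : T → X → ℝ}
    (hH : ∀ x, Continuous fun t => H t x) :
    Continuous fun t => log (∑ x, p x * exp (H t x)) :=
  Continuous.log (continuous_finsetSum _ fun x _ => ((hH x).rexp.const_mul (p x)))
    (fun t => (gav_Zpos hp (H t)).ne')

lemma logZ_le (hp : IsW p) {H G : X → ℝ} {B : ℝ} (h : ∀ x, H x ≤ G x + B) :
    log (∑ x, p x * exp (H x)) ≤ log (∑ x, p x * exp (G x)) + B := by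
  have h1 : ∑ x, p x * exp (H x) ≤ (∑ x, p x * exp (G x)) * exp B := by
    rw [Finset.sum_mul]
    refine Finset.sum_le_sum fun x _ => ?_
    rw [mul_assoc, ← exp_add]
    exact mul_le_mul_of_nonneg_left (exp_le_exp.2 (h x)) (hp.nonneg x)
  calc _ ≤ log ((∑ x, p x * exp (G x)) * exp B) := log_le_log (gav_Zpos hp H) h1
    _ = _ := by rw [log_mul (gav_Zpos hp G).ne' (exp_pos B).ne', log_exp]

lemma logZ_lip (hp : IsW p) {H G : X → ℝ} {B : ℝ} (h : ∀ x, |H x - G x| ≤ B) :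
    |log (∑ x, p x * exp (H x)) - log (∑ x, p x * exp (G x))| ≤ B := by
  rw [abs_le]
  constructor
  · have := logZ_le hp (H := G) (G := H) (B := B) (fun x => by
      have := (abs_le.1 (h x)).1; linarith)
    linarith
  · have := logZ_le hp (H := H) (G := G) (B := B) (fun x => by
      have := (abs_le.1 (h x)).2; linarith)
    linarith

/-- log-sum-exp is convex. -/
lemma logZ_convex (hp : IsW p) {H : ℝ → X → ℝ} (hH : ∀ x, ConvexOn ℝ Set.univ fun t => H t x) :
    ConvexOn ℝ Set.univ fun t => log (∑ x, p x * exp (H t x)) := by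
  refine ⟨convex_univ, fun s _ t _ a b ha hb hab => ?_⟩
  set A := log (∑ x, p x * exp (H s x)) with hA
  set B := log (∑ x, p x * exp (H t x)) with hB
  simp only [smul_eq_mul]
  have hAe : exp A = ∑ x, p x * exp (H s x) := exp_log (gav_Zpos hp (H s))
  have hBe : exp B = ∑ x, p x * exp (H t x) := exp_log (gav_Zpos hp (H t))
  rw [log_le_iff_le_exp (gav_Zpos hp _)]
  have key : ∀ x, exp (H (a * s + b * t) x) ≤
      exp (a * A + b * B) * (a * (exp (H s x) * exp (-A)) + b * (exp (H t x) * exp (-B))) := by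
    intro x
    have h1 := (hH x).2 (Set.mem_univ s) (Set.mem_univ t) ha hb hab
    simp only [smul_eq_mul] at h1
    have h2 := convexOn_exp.2 (Set.mem_univ (H s x - A)) (Set.mem_univ (H t x - B)) ha hb hab
    simp only [smul_eq_mul] at h2
    rw [← exp_add, ← exp_add]
    calc exp (H (a * s + b * t) x)
        ≤ exp (a * A + b * B + (a * (H s x - A) + b * (H t x - B))) := by
          apply exp_le_exp.2; linarith
      _ = exp (a * A + b * B) * exp (a * (H s x - A) + b * (H t x - B)) := by rw [exp_add]
      _ ≤ _ := mul_le_mul_of_nonneg_left h2 (exp_pos _).le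
  calc ∑ x, p x * exp (H (a * s + b * t) x)
      ≤ ∑ x, p x * (exp (a * A + b * B)
        * (a * (exp (H s x) * exp (-A)) + b * (exp (H t x) * exp (-B)))) :=
        Finset.sum_le_sum fun x _ => mul_le_mul_of_nonneg_left (key x) (hp.nonneg x)
    _ = exp (a * A + b * B) * (a * ((∑ x, p x * exp (H s x)) * exp (-A))
        + b * ((∑ x, p x * exp (H t x)) * exp (-B))) := by
        rw [Finset.sum_mul, Finset.sum_mul, Finset.mul_sum, Finset.mul_sum,
          ← Finset.sum_add_distrib, Finset.mul_sum]
        exact Finset.sum_congr rfl fun x _ => by ring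
    _ = exp (a * A + b * B) := by
        rw [← hAe, ← hBe, ← exp_add, ← exp_add]
        simp [hab]

end gavlemmas

/-! ### Gaussian product measure -/

instance stdG_prob : IsProbabilityMeasure stdG := by unfold stdG; infer_instance

/-- Standard Gaussian measure on `ι → ℝ`. -/
def gpi (ι : Type*) [Fintype ι] : Measure (ι → ℝ) := Measure.pi fun _ => stdG

instance gpi_prob (ι : Type*) [Fintype ι] : IsProbabilityMeasure (gpi ι) := by
  unfold gpi; infer_instance

/-- Resampling one coordinate preserves a product measure. -/
lemma mp_update {ι α : Type*} [Fintype ι] [DecidableEq ι] [MeasurableSpace α]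
    (μ : ι → Measure α) [∀ i, IsProbabilityMeasure (μ i)] (k : ι) :
    MeasurePreserving (fun q : (ι → α) × α => Function.update q.1 k q.2)
      ((Measure.pi μ).prod (μ k)) (Measure.pi μ) := by
  have hm : Measurable (fun q : (ι → α) × α => Function.update q.1 k q.2) := by
    refine measurable_pi_lambda _ fun j => ?_
    by_cases h : j = k
    · subst h; simpa using measurable_snd
    · simp only [Function.update_of_ne h]; fun_prop
  refine ⟨hm, (Measure.pi_eq fun s hs => ?_).symm⟩
  rw [Measure.map_apply hm (MeasurableSet.univ_pi hs)]
  have : (fun q : (ι → α) × α => Function.update q.1 k q.2) ⁻¹' (Set.univ.pi s)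
      = (Set.univ.pi (Function.update s k Set.univ)) ×ˢ (s k) := by
    ext ⟨z, t⟩
    simp only [Set.mem_preimage, Set.mem_pi, Set.mem_univ, true_imp_iff, Set.mem_prod]
    constructor
    · intro h
      refine ⟨fun j => ?_, by simpa using h k⟩
      by_cases hj : j = k
      · subst hj; simp
      · simpa [Function.update_of_ne hj] using h j
    · rintro ⟨h1, h2⟩ j
      by_cases hj : j = k
      · subst hj; simpa using h2
      · simpa [Function.update_of_ne hj] using h1 j
  rw [this, Measure.prod_prod, Measure.pi_pi]
  have e1 : ∀ i, (μ i) (Function.update s k Set.univ i)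
      = Function.update (fun i => μ i (s i)) k 1 i := by
    intro i
    by_cases hj : i = k
    · subst hj; simp
    · simp [Function.update_of_ne hj]
  simp only [e1]
  rw [Finset.prod_update_of_mem (Finset.mem_univ k), one_mul, mul_comm,
    ← Finset.prod_erase_mul _ _ (Finset.mem_univ k), mul_comm, Finset.sdiff_singleton_eq_erase]

lemma integrable_pow_stdG (m : ℕ) : Integrable (fun x : ℝ => x ^ m) stdG := by
  have h := (memLp_id_gaussianReal (μ := 0) (v := 1) m).integrable_norm_pow'
  refine (integrable_norm_iff (by fun_prop)).1 ?_
  simpa [stdG] using h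

lemma integrable_id_stdG : Integrable (fun x : ℝ => x) stdG := by
  simpa using integrable_pow_stdG 1

lemma integral_sq_stdG : ∫ x : ℝ, x ^ 2 ∂stdG = 1 := by
  have h := variance_fun_id_gaussianReal (μ := 0) (v := 1)
  rw [variance_eq_integral (by fun_prop)] at h
  simpa [stdG] using h

/-- One-dimensional Gaussian integration by parts. -/
lemma stein1 {f f' : ℝ → ℝ} {C : ℝ} (hd : ∀ x, HasDerivAt f (f' x) x)
    (hf : ∀ x, |f x| ≤ C) (hf' : ∀ x, |f' x| ≤ C) (hm : Measurable f') :
    ∫ x, x * f x ∂stdG = ∫ x, f' x ∂stdG := by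
  have hfm : Measurable f := (continuous_iff_continuousAt.2 fun x => (hd x).continuousAt).measurable
  have i1 : Integrable (fun x => x * f x) stdG :=
    integrable_id_stdG.mul_bdd (c := C) hfm.aestronglyMeasurable (ae_of_all _ hf)
  have i2 : Integrable f' stdG :=
    Integrable.of_bound hm.aestronglyMeasurable C (ae_of_all _ hf')
  have i3 : Integrable f stdG :=
    Integrable.of_bound hfm.aestronglyMeasurable C (ae_of_all _ hf)
  have conv : ∀ g : ℝ → ℝ, Integrable g stdG →
      Integrable (fun x => gaussianPDFReal 0 1 x * g x) := by
    intro g hg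
    unfold stdG at hg
    rw [gaussianReal_of_var_ne_zero _ one_ne_zero, integrable_withDensity_iff_integrable_smul'
      (measurable_gaussianPDF 0 1) (ae_of_all _ fun x => gaussianPDF_lt_top)] at hg
    simpa [toReal_gaussianPDF] using hg
  have hpd : ∀ x, HasDerivAt (gaussianPDFReal 0 1) (-x * gaussianPDFReal 0 1 x) x := by
    intro x
    rw [gaussianPDFReal_def]
    have : HasDerivAt (fun x : ℝ => -(x - 0) ^ 2 / (2 * ((1 : NNReal) : ℝ))) (-x) x := by
      have := (((hasDerivAt_id x).sub_const 0).pow 2).neg.div_const (2 * ((1 : NNReal) : ℝ))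
      refine this.congr_deriv ?_
      simp
      ring
    refine (this.exp.const_mul _).congr_deriv ?_
    ring
  have key := integral_eq_zero_of_hasDerivAt_of_integrable
    (f := fun x => gaussianPDFReal 0 1 x * f x)
    (f' := fun x => gaussianPDFReal 0 1 x * f' x - gaussianPDFReal 0 1 x * (x * f x))
    (fun x => ((hpd x).mul (hd x)).congr_deriv (by ring))
    ((conv _ i2).sub (conv _ i1)) (conv _ i3)
  rw [integral_sub (conv _ i2) (conv _ i1)] at key
  unfold stdG
  rw [integral_gaussianReal_eq_integral_smul one_ne_zero,
    integral_gaussianReal_eq_integral_smul one_ne_zero]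
  simp only [smul_eq_mul]
  linarith

lemma integrable_coord {ι : Type*} [Fintype ι] (k : ι) :
    Integrable (fun Z : ι → ℝ => Z k) (gpi ι) :=
  integrable_comp_eval (μ := fun _ : ι => stdG) integrable_id_stdG

lemma integrable_bdd {Ω : Type*} [MeasurableSpace Ω] [TopologicalSpace Ω]
    [OpensMeasurableSpace Ω] {μ : Measure Ω} [IsFiniteMeasure μ]
    {f : Ω → ℝ} (hc : Continuous f) {C : ℝ} (hf : ∀ x, |f x| ≤ C) : Integrable f μ :=
  Integrable.of_bound hc.measurable.aestronglyMeasurable C (ae_of_all _ hf)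

/-- Gaussian integration by parts in `ι → ℝ`. -/
lemma steinPi {ι : Type*} [Fintype ι] [DecidableEq ι] (k : ι) {f f' : (ι → ℝ) → ℝ} {C : ℝ}
    (hd : ∀ Z t, HasDerivAt (fun s => f (Function.update Z k s)) (f' (Function.update Z k t)) t)
    (hc : Continuous f) (hc' : Continuous f')
    (hf : ∀ x, |f x| ≤ C) (hf' : ∀ x, |f' x| ≤ C) :
    ∫ Z, Z k * f Z ∂(gpi ι) = ∫ Z, f' Z ∂(gpi ι) := by
  have mp := mp_update (fun _ : ι => stdG) k
  have i1 : Integrable (fun Z : ι → ℝ => Z k * f Z) (gpi ι) :=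
    (integrable_coord k).mul_bdd (c := C) hc.measurable.aestronglyMeasurable (ae_of_all _ hf)
  have i2 : Integrable f' (gpi ι) := integrable_bdd hc' hf'
  have tr : ∀ g : (ι → ℝ) → ℝ, Integrable g (gpi ι) →
      ∫ Z, g Z ∂(gpi ι) = ∫ Z, ∫ t, g (Function.update Z k t) ∂stdG ∂(gpi ι) := by
    intro g hg
    unfold gpi at hg ⊢
    have h1 : ∫ q, g (Function.update q.1 k q.2) ∂((Measure.pi fun _ : ι => stdG).prod stdG)
        = ∫ Z, g Z ∂(Measure.pi fun _ : ι => stdG) := by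
      have := mp.map_eq
      conv_rhs => rw [← this]
      rw [integral_map mp.measurable.aemeasurable]
      rw [this]; exact hg.aestronglyMeasurable
    rw [← h1, integral_prod]
    exact mp.integrable_comp_of_integrable hg
  rw [tr _ i1, tr _ i2]
  refine integral_congr_ae (ae_of_all _ fun Z => ?_)
  simp only [Function.update_self]
  refine stein1 (f := fun t => f (Function.update Z k t)) (C := C) (hd Z) (fun t => hf _)
    (fun t => hf' _) ?_
  exact (hc'.comp (continuous_const.update k continuous_id)).measurable

lemma gauss_shift1 (a : ℝ) (s : Set ℝ) (hs : MeasurableSet s) :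
    (gaussianReal a 1) s = ∫⁻ y, s.indicator (fun y => ENNReal.ofReal (exp (a * y - a ^ 2 / 2))) y
      ∂stdG := by
  unfold stdG
  rw [gaussianReal_of_var_ne_zero _ one_ne_zero, gaussianReal_of_var_ne_zero _ one_ne_zero,
    withDensity_apply _ hs, lintegral_withDensity_eq_lintegral_mul _ (measurable_gaussianPDF 0 1)
      ((by fun_prop : Measurable fun y : ℝ => ENNReal.ofReal (exp (a * y - a ^ 2 / 2))).indicator hs),
    ← lintegral_indicator hs]
  refine lintegral_congr fun y => ?_
  simp only [Pi.mul_apply]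
  by_cases hy : y ∈ s
  · rw [Set.indicator_of_mem hy, Set.indicator_of_mem hy]
    unfold gaussianPDF
    rw [← ENNReal.ofReal_mul (gaussianPDFReal_nonneg _ _ _)]
    congr 1
    simp only [gaussianPDFReal_def]
    conv_rhs => rw [mul_assoc, ← exp_add]
    congr 2
    simp
    ring
  · simp [hy]

/-- Cameron–Martin formula. -/
lemma cameron {ι : Type*} [Fintype ι] (a : ι → ℝ) (F : (ι → ℝ) → ℝ) (hF : Measurable F) :
    ∫ Z, F (Z + a) ∂(gpi ι)
      = ∫ Y, exp (∑ k, (a k * Y k - a k ^ 2 / 2)) * F Y ∂(gpi ι) := by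
  set d : (ι → ℝ) → ENNReal := fun Y => ENNReal.ofReal (exp (∑ k, (a k * Y k - a k ^ 2 / 2)))
  have hdm : Measurable d := by fun_prop
  have e1 : (gpi ι).map (fun Z => Z + a) = Measure.pi fun k => gaussianReal (a k) 1 := by
    have : (fun Z : ι → ℝ => Z + a) = fun Z k => (fun t => t + a k) (Z k) := by
      ext Z k; simp
    rw [this, gpi]
    have hg : ∀ k, stdG.map (fun t => t + a k) = gaussianReal (a k) 1 := by
      intro k; unfold stdG
      rw [gaussianReal_map_add_const]; simp
    have : ∀ k, SigmaFinite (stdG.map (fun t => t + a k)) := fun k => by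
      rw [hg k]; infer_instance
    rw [Measure.pi_map_pi (f := fun k t => t + a k) (fun k => by fun_prop)]
    congr 1
    ext1 k
    exact hg k
  have e2 : (Measure.pi fun k => gaussianReal (a k) 1) = (gpi ι).withDensity d := by
    refine Measure.pi_eq fun s hs => ?_
    rw [withDensity_apply _ (MeasurableSet.univ_pi hs),
      ← lintegral_indicator (MeasurableSet.univ_pi hs)]
    set g : ι → ℝ → ENNReal := fun k => (s k).indicator
      (fun y => ENNReal.ofReal (exp (a k * y - a k ^ 2 / 2)))
    have hg : ∀ k, Measurable (g k) := fun k =>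
      (by fun_prop : Measurable fun y : ℝ => ENNReal.ofReal (exp (a k * y - a k ^ 2 / 2))).indicator
        (hs k)
    have e3 : ∀ Y, (Set.univ.pi s).indicator d Y = ∏ k, g k (Y k) := by
      intro Y
      by_cases h : ∀ k, Y k ∈ s k
      · rw [Set.indicator_of_mem (by simpa using h)]
        simp only [d, g]
        rw [exp_sum, ENNReal.ofReal_prod_of_nonneg (fun _ _ => (exp_pos _).le)]
        exact Finset.prod_congr rfl fun k _ => by rw [Set.indicator_of_mem (h k)]
      · rw [Set.indicator_of_notMem (by simpa using h)]
        push Not at h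
        obtain ⟨k, hk⟩ := h
        symm
        refine Finset.prod_eq_zero (Finset.mem_univ k) ?_
        simp [g, hk]
    simp only [e3]
    have hind : iIndepFun (fun (k : ι) (Y : ι → ℝ) => g k (Y k)) (gpi ι) :=
      iIndepFun_pi (fun k => (hg k).aemeasurable)
    rw [lintegral_prod_eq_prod_lintegral_of_indepFun _ _ hind (fun k => by have := hg k; fun_prop)]
    refine Finset.prod_congr rfl fun k _ => ?_
    rw [gauss_shift1 _ _ (hs k)]
    have := (measurePreserving_eval (fun _ : ι => stdG) k).lintegral_comp (hg k)
    exact this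
  have e4 : ∫ Z, F (Z + a) ∂(gpi ι) = ∫ Y, F Y ∂((gpi ι).map (fun Z => Z + a)) := by
    rw [integral_map (by fun_prop) hF.aestronglyMeasurable]
  rw [e4, e1, e2, integral_withDensity_eq_integral_toReal_smul hdm
    (ae_of_all _ fun _ => ENNReal.ofReal_lt_top)]
  refine integral_congr_ae (ae_of_all _ fun Y => ?_)
  simp only [d, smul_eq_mul]
  rw [ENNReal.toReal_ofReal (exp_pos _).le]

lemma integrable_exp_lin {ι : Type*} [Fintype ι] (a : ι → ℝ) :
    Integrable (fun Y : ι → ℝ => exp (∑ k, (a k * Y k - a k ^ 2 / 2))) (gpi ι) := by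
  simp only [exp_sum]
  refine Integrable.fintype_prod (f := fun k y => exp (a k * y - a k ^ 2 / 2)) fun k => ?_
  simp only [sub_eq_add_neg, exp_add]
  exact (integrable_exp_mul_gaussianReal (a k)).mul_const _

/-! ### The abstract additive Gaussian channel with a finite signal space -/

section channel
variable {X ι : Type*} [Fintype X] [Fintype ι]

/-- Log-likelihood of the signal `x` given the observation `Y`. -/
def Hy (h : X → ι → ℝ) (Y : ι → ℝ) (x : X) : ℝ := ∑ k, (h x k * Y k - h x k ^ 2 / 2)

/-- Posterior average given the observation `Y`. -/
def gb (p : X → ℝ) (h : X → ι → ℝ) (Y : ι → ℝ) (f : X → ℝ) : ℝ := gav p (Hy h Y) f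

/-- Expectation over the signal and the noise, in terms of signal and observation. -/
def Ex (p : X → ℝ) (h : X → ι → ℝ) (Φ : X → (ι → ℝ) → ℝ) : ℝ :=
  ∑ x0, p x0 * ∫ Z, Φ x0 (Z + h x0) ∂(gpi ι)

/-- Continuous bounded functions of signal and observation. -/
def Nice (Φ : X → (ι → ℝ) → ℝ) : Prop :=
  (∀ x, Continuous (Φ x)) ∧ ∃ C, ∀ x Y, |Φ x Y| ≤ C

variable {p : X → ℝ} {h : X → ι → ℝ}

lemma Hy_continuous (h : X → ι → ℝ) (x : X) : Continuous fun Y => Hy h Y x := by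
  unfold Hy; fun_prop

lemma gb_continuous (hp : IsW p) (h : X → ι → ℝ) {f : X → (ι → ℝ) → ℝ}
    (hf : ∀ x, Continuous (f x)) : Continuous fun Y => gb p h Y (fun x => f x Y) :=
  gav_continuous hp (fun x => Hy_continuous h x) hf

lemma fin_bdd (f : X → ℝ) : ∃ C, 0 ≤ C ∧ ∀ x, |f x| ≤ C :=
  ⟨∑ x, |f x|, Finset.sum_nonneg fun _ _ => abs_nonneg _, fun x =>
    Finset.single_le_sum (f := fun x => |f x|) (fun _ _ => abs_nonneg _) (Finset.mem_univ x)⟩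

lemma Nice.of_fun (f : X → ℝ) : Nice (ι := ι) (fun x _ => f x) := by
  obtain ⟨C, _, hC⟩ := fin_bdd f
  exact ⟨fun x => continuous_const, C, fun x _ => hC x⟩

lemma Nice.const (c : ℝ) : Nice (X := X) (ι := ι) (fun _ _ => c) := Nice.of_fun _

lemma Nice.add {F G : X → (ι → ℝ) → ℝ} (hF : Nice F) (hG : Nice G) :
    Nice (fun x Y => F x Y + G x Y) := by
  obtain ⟨c1, C1, h1⟩ := hF
  obtain ⟨c2, C2, h2⟩ := hG
  exact ⟨fun x => (c1 x).add (c2 x), C1 + C2, fun x Y =>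
    (abs_add_le _ _).trans (add_le_add (h1 x Y) (h2 x Y))⟩

lemma Nice.mul {F G : X → (ι → ℝ) → ℝ} (hF : Nice F) (hG : Nice G) :
    Nice (fun x Y => F x Y * G x Y) := by
  obtain ⟨c1, C1, h1⟩ := hF
  obtain ⟨c2, C2, h2⟩ := hG
  refine ⟨fun x => (c1 x).mul (c2 x), C1 * C2, fun x Y => ?_⟩
  rw [abs_mul]
  exact mul_le_mul (h1 x Y) (h2 x Y) (abs_nonneg _) ((abs_nonneg _).trans (h1 x Y))

lemma Nice.abs {F : X → (ι → ℝ) → ℝ} (hF : Nice F) : Nice (fun x Y => |F x Y|) := by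
  obtain ⟨c1, C1, h1⟩ := hF
  exact ⟨fun x => (c1 x).abs, C1, fun x Y => by rw [abs_abs]; exact h1 x Y⟩

lemma Nice.neg {F : X → (ι → ℝ) → ℝ} (hF : Nice F) : Nice (fun x Y => - F x Y) := by
  simpa using (Nice.const (-1)).mul hF

lemma Nice.sub {F G : X → (ι → ℝ) → ℝ} (hF : Nice F) (hG : Nice G) :
    Nice (fun x Y => F x Y - G x Y) := by
  simpa [sub_eq_add_neg] using hF.add hG.neg

lemma Nice.pow {F : X → (ι → ℝ) → ℝ} (hF : Nice F) : Nice (fun x Y => F x Y ^ 2) := by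
  simpa [pow_two] using hF.mul hF

lemma Nice.gb (hp : IsW p) (h : X → ι → ℝ) {F : X → X → (ι → ℝ) → ℝ}
    (hF : ∀ x, Nice (F x)) : Nice (fun x Y => gb p h Y (fun y => F x y Y)) := by
  choose hc C hC using hF
  obtain ⟨B, _, hB⟩ := fin_bdd C
  refine ⟨fun x => gb_continuous hp h (hc x), B, fun x Y => ?_⟩
  exact gav_abs_le hp _ fun y => (hC x y Y).trans ((le_abs_self _).trans (hB x))

lemma Nice.gb' (hp : IsW p) (h : X → ι → ℝ) {F : X → (ι → ℝ) → ℝ}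
    (hF : Nice F) : Nice (fun (_ : X) Y => _root_.gb p h Y (fun y => F y Y)) :=
  Nice.gb hp h (F := fun _ => F) fun _ => hF

lemma Nice.swap {F : X → X → (ι → ℝ) → ℝ} (hF : ∀ x, Nice (F x)) (y : X) :
    Nice (fun x Y => F x y Y) := by
  choose hc C hC using hF
  obtain ⟨B, _, hB⟩ := fin_bdd C
  exact ⟨fun x => hc x y, B, fun x Y => (hC x y Y).trans ((le_abs_self _).trans (hB x))⟩

lemma Nice.integrable {F : X → (ι → ℝ) → ℝ} (hF : Nice F) (x : X) (a : ι → ℝ) :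
    Integrable (fun Z => F x (Z + a)) (gpi ι) := by
  obtain ⟨c1, C1, h1⟩ := hF
  exact integrable_bdd ((c1 x).comp (by fun_prop)) fun Z => h1 x _

lemma Ex_add {F G : X → (ι → ℝ) → ℝ} (hF : Nice F) (hG : Nice G) :
    Ex p h (fun x Y => F x Y + G x Y) = Ex p h F + Ex p h G := by
  unfold Ex
  rw [← Finset.sum_add_distrib]
  refine Finset.sum_congr rfl fun x _ => ?_
  rw [integral_add (hF.integrable x _) (hG.integrable x _)]; ring

lemma Ex_sub {F G : X → (ι → ℝ) → ℝ} (hF : Nice F) (hG : Nice G) :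
    Ex p h (fun x Y => F x Y - G x Y) = Ex p h F - Ex p h G := by
  unfold Ex
  rw [← Finset.sum_sub_distrib]
  refine Finset.sum_congr rfl fun x _ => ?_
  rw [integral_sub (hF.integrable x _) (hG.integrable x _)]; ring

lemma Ex_mul_left (c : ℝ) (F : X → (ι → ℝ) → ℝ) :
    Ex p h (fun x Y => c * F x Y) = c * Ex p h F := by
  unfold Ex
  rw [Finset.mul_sum]
  refine Finset.sum_congr rfl fun x _ => ?_
  rw [integral_const_mul]; ring

lemma Ex_const (hp : IsW p) (c : ℝ) : Ex p h (fun _ _ => c) = c := by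
  unfold Ex
  simp [← Finset.sum_mul, hp.sum_eq]

lemma Ex_mono (hp : IsW p) {F G : X → (ι → ℝ) → ℝ} (hF : Nice F) (hG : Nice G)
    (hFG : ∀ x Y, F x Y ≤ G x Y) : Ex p h F ≤ Ex p h G := by
  unfold Ex
  refine Finset.sum_le_sum fun x _ => mul_le_mul_of_nonneg_left ?_ (hp.nonneg x)
  exact integral_mono (hF.integrable x _) (hG.integrable x _) fun Z => hFG x _

lemma Ex_nonneg (hp : IsW p) {F : X → (ι → ℝ) → ℝ} 
    (hF0 : ∀ x Y, 0 ≤ F x Y) : 0 ≤ Ex p h F := by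
  unfold Ex
  exact Finset.sum_nonneg fun x _ => mul_nonneg (hp.nonneg x) (integral_nonneg fun Z => hF0 x _)

lemma Ex_abs_le (hp : IsW p) {F : X → (ι → ℝ) → ℝ} (hF : Nice F) :
    |Ex p h F| ≤ Ex p h (fun x Y => |F x Y|) := by
  rw [abs_le]
  constructor
  · have := Ex_mono (h := h) hp hF.abs.neg hF fun x Y => neg_abs_le _
    have h2 := Ex_mul_left (p := p) (h := h) (-1) (fun x Y => |F x Y|)
    simp only [neg_mul, one_mul] at h2
    linarith
  · exact Ex_mono hp hF hF.abs fun x Y => le_abs_self _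

lemma Ex_sq_le (hp : IsW p) {F : X → (ι → ℝ) → ℝ} (hF : Nice F) :
    (Ex p h F) ^ 2 ≤ Ex p h (fun x Y => F x Y ^ 2) := by
  have h1 := Ex_nonneg (h := h) hp (F := fun x Y => (F x Y - Ex p h F) ^ 2) (fun x Y => sq_nonneg _)
  have e : (fun x Y => (F x Y - Ex p h F) ^ 2)
      = fun x Y => (F x Y ^ 2 - (2 * Ex p h F) * F x Y) + Ex p h F ^ 2 := by
    ext x Y; ring
  rw [e, Ex_add (hF.pow.sub ((Nice.const _).mul hF)) (Nice.const _),
    Ex_sub hF.pow ((Nice.const _).mul hF), Ex_mul_left, Ex_const hp] at h1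
  nlinarith

/-- Nishimori identity. -/
lemma nishimori (hp : IsW p) {Φ : X → (ι → ℝ) → ℝ} (hΦ : Nice Φ) :
    Ex p h Φ = Ex p h (fun _ Y => gb p h Y (fun x => Φ x Y)) := by
  have hN : Nice (fun (_ : X) Y => gb p h Y (fun x => Φ x Y)) := hΦ.gb' hp h
  have key : ∀ F : X → (ι → ℝ) → ℝ, Nice F →
      Ex p h F = ∫ Y, ∑ x, p x * exp (Hy h Y x) * F x Y ∂(gpi ι) := by
    intro F hF
    obtain ⟨c1, C1, h1⟩ := hF
    rw [integral_finset_sum]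
    · unfold Ex
      refine Finset.sum_congr rfl fun x _ => ?_
      rw [cameron (h x) (F x) (c1 x).measurable, ← integral_const_mul]
      simp only [Hy, mul_assoc]
    · intro x _
      simp only [mul_assoc]
      refine Integrable.const_mul ?_ _
      exact (integrable_exp_lin (h x)).mul_bdd (c := C1) (c1 x).measurable.aestronglyMeasurable
        (ae_of_all _ (h1 x))
  rw [key _ hΦ, key _ hN]
  congr 1
  ext Y
  rw [← Finset.sum_mul]
  unfold gb gav
  rw [mul_div_cancel₀]
  exact (gav_Zpos hp _).ne'

/-- Derivative of the posterior average with respect to one noise coordinate. -/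
lemma gb_hasDerivAt_coord [DecidableEq ι] (hp : IsW p) (h : X → ι → ℝ) (a : ι → ℝ) (k : ι)
    (f : X → ℝ) (Z : ι → ℝ) (t : ℝ) :
    HasDerivAt (fun s => gb p h (Function.update Z k s + a) f)
      (gb p h (Function.update Z k t + a) (fun x => f x * h x k)
        - gb p h (Function.update Z k t + a) f * gb p h (Function.update Z k t + a) (fun x => h x k))
      t := by
  refine gav_hasDerivAt hp (H := fun s => Hy h (Function.update Z k s + a))
    (H' := fun x => h x k) (fun x => ?_) f
  unfold Hy
  have : ∀ j, HasDerivAt (fun s => h x j * ((Function.update Z k s + a) j) - h x j ^ 2 / 2)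
      (if j = k then h x k else 0) t := by
    intro j
    by_cases hj : j = k
    · subst hj
      simp only [Pi.add_apply, Function.update_self, if_true]
      have := (((hasDerivAt_id t).add_const (a j)).const_mul (h x j)).sub_const (h x j ^ 2 / 2)
      simpa using this
    · simp only [Pi.add_apply, Function.update_of_ne hj, if_neg hj]
      exact hasDerivAt_const _ _
  refine (HasDerivAt.fun_sum fun j _ => this j).congr_deriv ?_
  simp

/-- Gaussian integration by parts for a product of two posterior averages. -/
lemma gibp2 (hp : IsW p) (h : X → ι → ℝ) (a : ι → ℝ) (k : ι) (f g : X → ℝ) :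
    ∫ Z, Z k * (gb p h (Z + a) f * gb p h (Z + a) g) ∂(gpi ι)
      = ∫ Z, ((gb p h (Z + a) (fun x => f x * h x k)
          - gb p h (Z + a) f * gb p h (Z + a) (fun x => h x k)) * gb p h (Z + a) g
        + gb p h (Z + a) f * (gb p h (Z + a) (fun x => g x * h x k)
          - gb p h (Z + a) g * gb p h (Z + a) (fun x => h x k))) ∂(gpi ι) := by
  classical
  have N : ∀ f : X → ℝ, Nice (fun (_ : X) Y => gb p h Y f) :=
    fun f => Nice.gb' hp h (Nice.of_fun f)
  obtain ⟨c1, C1, h1⟩ := (N f).mul (N g)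
  obtain ⟨c2, C2, h2⟩ := (((N (fun x => f x * h x k)).sub ((N f).mul (N fun x => h x k))).mul (N g)).add
    ((N f).mul ((N (fun x => g x * h x k)).sub ((N g).mul (N fun x => h x k))))
  have hX : Nonempty X := by
    by_contra hne
    rw [not_nonempty_iff] at hne
    have := hp.sum_eq
    simp at this
  obtain ⟨x0⟩ := hX
  have hs : Continuous fun Z : ι → ℝ => Z + a := by fun_prop
  refine steinPi k (C := max C1 C2) (fun Z t => ?_) ((c1 x0).comp hs) ((c2 x0).comp hs)
    (fun Z => (h1 x0 _).trans (le_max_left _ _)) (fun Z => (h2 x0 _).trans (le_max_right _ _))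
  exact (gb_hasDerivAt_coord hp h a k f Z t).mul (gb_hasDerivAt_coord hp h a k g Z t)

lemma gibp1 (hp : IsW p) (h : X → ι → ℝ) (a : ι → ℝ) (k : ι) (f : X → ℝ) :
    ∫ Z, Z k * gb p h (Z + a) f ∂(gpi ι)
      = ∫ Z, (gb p h (Z + a) (fun x => f x * h x k)
          - gb p h (Z + a) f * gb p h (Z + a) (fun x => h x k)) ∂(gpi ι) := by
  have := gibp2 hp h a k f (fun _ => 1)
  simpa [gb, gav_const hp] using this

end channel

/-! ### Derivative formulas along paths of channels -/

section deriv
variable {X ι : Type*} [Fintype X] [Fintype ι] {p : X → ℝ}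

/-- Mixed inner product of the path and its derivative. -/
def Qf (h d : X → ι → ℝ) (x y : X) : ℝ := ∑ k, h x k * d y k

/-- Derivative of the Hamiltonian along a path. -/
def Hder (h d : X → ι → ℝ) (x0 : X) (Z : ι → ℝ) (x : X) : ℝ :=
  ∑ k, (d x k * (Z k + h x0 k) + h x k * d x0 k - h x k * d x k)

lemma Hder_eq (h d : X → ι → ℝ) (x0 : X) (Z : ι → ℝ) (x : X) :
    Hder h d x0 Z x = (∑ k, Z k * d x k) + (Qf h d x0 x + Qf h d x x0 - Qf h d x x) := by
  unfold Hder Qf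
  rw [← Finset.sum_add_distrib, ← Finset.sum_sub_distrib, ← Finset.sum_add_distrib]
  exact Finset.sum_congr rfl fun k _ => by ring

lemma gb_add (h : X → ι → ℝ) (Y : ι → ℝ) (f g : X → ℝ) :
    gb p h Y (fun x => f x + g x) = gb p h Y f + gb p h Y g := gav_add _ _ _
lemma gb_sub (h : X → ι → ℝ) (Y : ι → ℝ) (f g : X → ℝ) :
    gb p h Y (fun x => f x - g x) = gb p h Y f - gb p h Y g := gav_sub _ _ _
lemma gb_mul_left (h : X → ι → ℝ) (Y : ι → ℝ) (f : X → ℝ) (c : ℝ) :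
    gb p h Y (fun x => c * f x) = c * gb p h Y f := gav_mul_left _ _ _
lemma gb_mul_right (h : X → ι → ℝ) (Y : ι → ℝ) (f : X → ℝ) (c : ℝ) :
    gb p h Y (fun x => f x * c) = gb p h Y f * c := gav_mul_right _ _ _
lemma gb_sum {κ : Type*} (s : Finset κ) (h : X → ι → ℝ) (Y : ι → ℝ) (f : κ → X → ℝ) :
    gb p h Y (fun x => ∑ k ∈ s, f k x) = ∑ k ∈ s, gb p h Y (f k) := gav_sum _ _ _
lemma gb_const (hp : IsW p) (h : X → ι → ℝ) (Y : ι → ℝ) (c : ℝ) :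
    gb p h Y (fun _ => c) = c := gav_const hp _ _
lemma gb_swap (h : X → ι → ℝ) (Y : ι → ℝ) (F : X → X → ℝ) :
    gb p h Y (fun x => gb p h Y (fun y => F x y)) = gb p h Y (fun y => gb p h Y (fun x => F x y)) :=
  gav_swap _ _

lemma Nice.gbf (hp : IsW p) (h : X → ι → ℝ) (f : X → ℝ) :
    Nice (fun (_ : X) Y => _root_.gb p h Y f) := Nice.gb' hp h (Nice.of_fun f)

lemma int_gb (hp : IsW p) (h : X → ι → ℝ) (x0 : X) (a : ι → ℝ) (f : X → ℝ) :
    Integrable (fun Z => gb p h (Z + a) f) (gpi ι) := (Nice.gbf hp h f).integrable x0 a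

lemma int_Zgb (hp : IsW p) (h : X → ι → ℝ) (a : ι → ℝ) (k : ι) {F : X → (ι → ℝ) → ℝ}
    (hF : Nice F) (x0 : X) : Integrable (fun Z => Z k * F x0 (Z + a)) (gpi ι) := by
  obtain ⟨c, C, hC⟩ := hF
  exact (integrable_coord k).mul_bdd (c := C)
    ((c x0).comp (by fun_prop : Continuous fun Z : ι → ℝ => Z + a)).measurable.aestronglyMeasurable
    (ae_of_all _ fun Z => hC x0 _)

lemma gb_Hder (h d : X → ι → ℝ) (x0 : X) (Z : ι → ℝ) (Y : ι → ℝ) (f : X → ℝ) :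
    gb p h Y (fun x => f x * Hder h d x0 Z x)
      = (∑ k, Z k * gb p h Y (fun x => f x * d x k))
        + gb p h Y (fun x => f x * (Qf h d x0 x + Qf h d x x0 - Qf h d x x)) := by
  simp only [Hder_eq, mul_add, gb_add, Finset.mul_sum, gb_sum]
  congr 1
  refine Finset.sum_congr rfl fun k _ => ?_
  rw [← gb_mul_left]
  congr 1; ext x; ring

lemma ibpC (hp : IsW p) (h d : X → ι → ℝ) (x0 : X) (f : X → ℝ) :
    ∫ Z, gb p h (Z + h x0) (fun x => f x * Hder h d x0 Z x) ∂(gpi ι)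
      = ∫ Z, (gb p h (Z + h x0) (fun x => f x * (Qf h d x x0 + Qf h d x0 x))
          - gb p h (Z + h x0) (fun x => gb p h (Z + h x0) (fun y => f x * Qf h d y x))) ∂(gpi ι) := by
  simp only [gb_Hder]
  have iZ : ∀ k, Integrable (fun Z : ι → ℝ => Z k * gb p h (Z + h x0) (fun x => f x * d x k))
      (gpi ι) := fun k => int_Zgb hp h _ k (Nice.gbf hp h _) x0
  have iD : ∀ k, Integrable (fun Z => gb p h (Z + h x0) (fun x => f x * d x k * h x k)
          - gb p h (Z + h x0) (fun x => f x * d x k) * gb p h (Z + h x0) (fun x => h x k)) (gpi ι) :=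
    fun k => ((Nice.gbf hp h _).sub ((Nice.gbf hp h _).mul (Nice.gbf hp h _))).integrable x0 _
  rw [integral_add (integrable_finsetSum _ fun k _ => iZ k) (int_gb hp h x0 _ _),
    integral_finsetSum _ fun k _ => iZ k]
  simp only [gibp1 hp]
  rw [← integral_finsetSum _ fun k _ => iD k,
    ← integral_add (integrable_finsetSum _ fun k _ => iD k) (int_gb hp h x0 _ _)]
  congr 1
  ext Z
  set Y := Z + h x0
  have e1 : gb p h Y (fun x => gb p h Y (fun y => f x * Qf h d y x))
      = ∑ k, gb p h Y (fun x => f x * d x k) * gb p h Y (fun x => h x k) := by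
    unfold Qf
    simp only [Finset.mul_sum, gb_sum]
    refine Finset.sum_congr rfl fun k _ => ?_
    rw [← gb_mul_right]
    congr 1; ext x
    rw [← gb_mul_left]
    congr 1; ext y; ring
  have e2 : ∑ k, gb p h Y (fun x => f x * d x k * h x k) = gb p h Y (fun x => f x * Qf h d x x) := by
    unfold Qf
    simp only [Finset.mul_sum, gb_sum]
    refine Finset.sum_congr rfl fun k _ => ?_
    congr 1; ext x; ring
  rw [e1, Finset.sum_sub_distrib, e2, sub_add_eq_add_sub, ← gb_add]
  congr 2; ext x; ring

lemma ibpB (hp : IsW p) (h d : X → ι → ℝ) (x0 : X) (f : X → ℝ) :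
    ∫ Z, gb p h (Z + h x0) f * gb p h (Z + h x0) (Hder h d x0 Z) ∂(gpi ι)
      = ∫ Z, (gb p h (Z + h x0) (fun x => gb p h (Z + h x0) (fun y => f x * Qf h d x y))
          - 2 * (gb p h (Z + h x0) f *
            gb p h (Z + h x0) (fun x => gb p h (Z + h x0) (fun y => Qf h d x y)))
          + gb p h (Z + h x0) f * gb p h (Z + h x0) (fun x => Qf h d x x0 + Qf h d x0 x)) ∂(gpi ι) := by
  have e0 : ∀ Z Y, gb p h Y f * gb p h Y (Hder h d x0 Z)
      = (∑ k, Z k * (gb p h Y f * gb p h Y (fun x => d x k)))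
        + gb p h Y f * gb p h Y (fun x => (Qf h d x0 x + Qf h d x x0 - Qf h d x x)) := by
    intro Z Y
    have := gb_Hder (p := p) h d x0 Z Y (fun _ => 1)
    simp only [one_mul] at this
    rw [this, mul_add, Finset.mul_sum]
    congr 1
    exact Finset.sum_congr rfl fun k _ => by ring
  simp only [e0]
  have N := fun f => Nice.gbf hp h f
  have iZ : ∀ k, Integrable (fun Z : ι → ℝ => Z k * (gb p h (Z + h x0) f *
      gb p h (Z + h x0) (fun x => d x k)))
      (gpi ι) := fun k => int_Zgb hp h _ k ((N _).mul (N _)) x0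
  have iD : ∀ k, Integrable (fun Z => ((gb p h (Z + h x0) (fun x => f x * h x k)
          - gb p h (Z + h x0) f * gb p h (Z + h x0) (fun x => h x k)) * 
            gb p h (Z + h x0) (fun x => d x k)
        + gb p h (Z + h x0) f * (gb p h (Z + h x0) (fun x => d x k * h x k)
          - gb p h (Z + h x0) (fun x => d x k) * gb p h (Z + h x0) (fun x => h x k)))) (gpi ι) :=
    fun k => ((((N _).sub ((N _).mul (N _))).mul (N _)).add
      ((N _).mul ((N _).sub ((N _).mul (N _))))).integrable x0 _
  have iE : Integrable (fun Z => gb p h (Z + h x0) f * 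
      gb p h (Z + h x0) (fun x => (Qf h d x0 x + Qf h d x x0 - Qf h d x x))) (gpi ι) :=
    ((N _).mul (N _)).integrable x0 _
  rw [integral_add (integrable_finsetSum _ fun k _ => iZ k) iE,
    integral_finsetSum _ fun k _ => iZ k]
  simp only [gibp2 hp]
  rw [← integral_finsetSum _ fun k _ => iD k,
    ← integral_add (integrable_finsetSum _ fun k _ => iD k) iE]
  congr 1
  ext Z
  set Y := Z + h x0
  have e1 : gb p h Y (fun x => gb p h Y (fun y => f x * Qf h d x y))
      = ∑ k, gb p h Y (fun x => f x * h x k) * gb p h Y (fun x => d x k) := by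
    unfold Qf
    simp only [Finset.mul_sum, gb_sum]
    refine Finset.sum_congr rfl fun k _ => ?_
    rw [← gb_mul_right]
    congr 1; ext x
    rw [← gb_mul_left]
    congr 1; ext y; ring
  have e3 : gb p h Y (fun x => gb p h Y (fun y => Qf h d x y))
      = ∑ k, gb p h Y (fun x => h x k) * gb p h Y (fun x => d x k) := by
    unfold Qf
    simp only [gb_sum]
    refine Finset.sum_congr rfl fun k _ => ?_
    rw [← gb_mul_right]
    congr 1; ext x
    rw [← gb_mul_left]
  have e2 : gb p h Y (fun x => Qf h d x x) = ∑ k, gb p h Y (fun x => d x k * h x k) := by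
    unfold Qf
    simp only [gb_sum]
    refine Finset.sum_congr rfl fun k _ => ?_
    congr 1; ext x; ring
  rw [gb_sub, gb_add, gb_add, e2, e1, e3]
  rw [mul_sub, Finset.mul_sum, Finset.mul_sum, Finset.mul_sum]
  have : ∀ A B C D F : ℝ, A = C - D + F → A + (B - F) = C - D + B := by intros; linarith
  rw [add_comm (gb p h Y fun x => Qf h d x0 x)]
  apply this
  rw [← Finset.sum_sub_distrib, ← Finset.sum_add_distrib]
  refine Finset.sum_congr rfl fun k _ => ?_
  ring

end deriv

section deriv2
variable {X ι : Type*} [Fintype X] [Fintype ι] {p : X → ℝ}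

/-- `d` is the derivative of the path `h` near `t0`. -/
structure ChPath (h d : ℝ → X → ι → ℝ) (t0 : ℝ) : Prop where
  der : ∀ᶠ t in 𝓝 t0, ∀ x k, HasDerivAt (fun t => h t x k) (d t x k) t
  cont : ∀ x k, ContinuousAt (fun t => d t x k) t0

lemma ChPath.bdd {h d : ℝ → X → ι → ℝ} {t0 : ℝ} (hP : ChPath h d t0) :
    ∃ B, 0 ≤ B ∧ ∀ᶠ t in 𝓝 t0, ∀ x k, |h t x k| ≤ B ∧ |d t x k| ≤ B := by
  have h1 : ∀ x k, ∃ B, 0 ≤ B ∧ ∀ᶠ t in 𝓝 t0, |h t x k| ≤ B ∧ |d t x k| ≤ B := by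
    intro x k
    have c1 : ContinuousAt (fun t => |h t x k|) t0 := (hP.der.self_of_nhds x k).continuousAt.abs
    have c2 : ContinuousAt (fun t => |d t x k|) t0 := (hP.cont x k).abs
    refine ⟨(|h t0 x k| + 1) + (|d t0 x k| + 1), by positivity, ?_⟩
    filter_upwards [c1.eventually (gt_mem_nhds (lt_add_one _)),
      c2.eventually (gt_mem_nhds (lt_add_one _))] with t ht1 ht2
    constructor
    · linarith [abs_nonneg (d t0 x k)]
    · linarith [abs_nonneg (h t0 x k)]
  choose B hB0 hB using h1
  refine ⟨∑ x, ∑ k, B x k, Finset.sum_nonneg fun x _ => Finset.sum_nonneg fun k _ => hB0 x k, ?_⟩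
  have : ∀ x k, B x k ≤ ∑ x, ∑ k, B x k := fun x k =>
    (Finset.single_le_sum (f := fun k => B x k) (fun k _ => hB0 x k) (Finset.mem_univ k)).trans
      (Finset.single_le_sum (f := fun x => ∑ k, B x k)
        (fun x _ => Finset.sum_nonneg fun k _ => hB0 x k) (Finset.mem_univ x))
  rw [eventually_all]
  intro x
  rw [eventually_all]
  intro k
  filter_upwards [hB x k] with t ht
  exact ⟨ht.1.trans (this x k), ht.2.trans (this x k)⟩

lemma Hder_abs_le {h d : X → ι → ℝ} {B : ℝ} (hB : ∀ x k, |h x k| ≤ B ∧ |d x k| ≤ B)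
    (x0 : X) (Z : ι → ℝ) (x : X) : |Hder h d x0 Z x| ≤ ∑ k, (B * |Z k| + 3 * B ^ 2) := by
  unfold Hder
  refine (Finset.abs_sum_le_sum_abs _ _).trans (Finset.sum_le_sum fun k _ => ?_)
  have a1 := (hB x k).1
  have a2 := (hB x k).2
  have a3 := (hB x0 k).1
  have a4 := (hB x0 k).2
  have B0 : 0 ≤ B := (abs_nonneg _).trans a1
  have m : ∀ {a b : ℝ}, |a| ≤ B → |b| ≤ B → |a * b| ≤ B ^ 2 := by
    intro a b ha hb
    rw [abs_mul, pow_two]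
    exact mul_le_mul ha hb (abs_nonneg _) B0
  have m1 := m a2 a3
  have m2 := m a1 a4
  have m3 := m a1 a2
  have m0 : |d x k * Z k| ≤ B * |Z k| := by
    rw [abs_mul]; exact mul_le_mul_of_nonneg_right a2 (abs_nonneg _)
  rw [abs_le] at *
  constructor <;> nlinarith

lemma Hy_hasDerivAt {h d : ℝ → X → ι → ℝ} {t : ℝ}
    (hd : ∀ x k, HasDerivAt (fun t => h t x k) (d t x k) t) (x0 : X) (Z : ι → ℝ) (x : X) :
    HasDerivAt (fun t => Hy (h t) (Z + h t x0) x) (Hder (h t) (d t) x0 Z x) t := by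
  unfold Hy Hder
  refine HasDerivAt.fun_sum fun k _ => ?_
  have h1 := ((hd x k).mul ((hd x0 k).const_add (Z k))).sub (((hd x k).pow 2).div_const 2)
  refine h1.congr_deriv ?_
  simp
  ring

lemma Hy_path_continuous {h : X → ι → ℝ} {a : ι → ℝ} (x : X) :
    Continuous fun Z : ι → ℝ => Hy h (Z + a) x :=
  (Hy_continuous h x).comp (by fun_prop)

lemma int_hasDerivAt (hp : IsW p) {h d : ℝ → X → ι → ℝ} {t0 : ℝ} (hP : ChPath h d t0) (x0 : X)
    (f : X → ℝ) :
    HasDerivAt (fun t => ∫ Z, gb p (h t) (Z + h t x0) f ∂(gpi ι))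
      (∫ Z, (gb p (h t0) (Z + h t0 x0) (fun x => f x * Hder (h t0) (d t0) x0 Z x)
        - gb p (h t0) (Z + h t0 x0) f * gb p (h t0) (Z + h t0 x0) (Hder (h t0) (d t0) x0 Z))
        ∂(gpi ι)) t0 := by
  obtain ⟨B, B0, hB⟩ := hP.bdd
  obtain ⟨C, C0, hC⟩ := fin_bdd f
  obtain ⟨ε, ε0, hε⟩ := Metric.eventually_nhds_iff_ball.1 (hP.der.and hB)
  have hdc : ∀ t x, Continuous fun Z : ι → ℝ => Hder (h t) (d t) x0 Z x := fun t x => by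
    unfold Hder; fun_prop
  have hcont : ∀ t (g : X → (ι → ℝ) → ℝ), (∀ x, Continuous (g x)) →
      Continuous fun Z : ι → ℝ => gb p (h t) (Z + h t x0) (fun x => g x Z) := fun t g hg =>
    gav_continuous hp (fun x => Hy_path_continuous x) hg
  refine (hasDerivAt_integral_of_dominated_loc_of_deriv_le
    (F := fun t Z => gb p (h t) (Z + h t x0) f)
    (F' := fun t Z => gb p (h t) (Z + h t x0) (fun x => f x * Hder (h t) (d t) x0 Z x)
        - gb p (h t) (Z + h t x0) f * gb p (h t) (Z + h t x0) (Hder (h t) (d t) x0 Z))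
    (bound := fun Z => 2 * C * ∑ k, (B * |Z k| + 3 * B ^ 2))
    (s := Metric.ball t0 ε) (Metric.ball_mem_nhds t0 ε0) ?_ ?_ ?_ ?_ ?_ ?_).2
  · exact Eventually.of_forall fun t =>
      (hcont t (fun x _ => f x) fun x => continuous_const).measurable.aestronglyMeasurable
  · exact int_gb hp _ x0 _ f
  · exact ((hcont t0 _ fun x => continuous_const.mul (hdc t0 x)).sub
      ((hcont t0 (fun x _ => f x) fun x => continuous_const).mul
        (hcont t0 _ fun x => hdc t0 x))).measurable.aestronglyMeasurable
  · refine ae_of_all _ fun Z t ht => ?_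
    have hb := Hder_abs_le (hε t ht).2 x0 Z
    set S := ∑ k, (B * |Z k| + 3 * B ^ 2)
    have S0 : 0 ≤ S := Finset.sum_nonneg fun k _ => by positivity
    have b1 : |gb p (h t) (Z + h t x0) (fun x => f x * Hder (h t) (d t) x0 Z x)| ≤ C * S :=
      gav_abs_le hp _ fun x => by
        rw [abs_mul]; exact mul_le_mul (hC x) (hb x) (abs_nonneg _) C0
    have b2 : |gb p (h t) (Z + h t x0) f * gb p (h t) (Z + h t x0) (Hder (h t) (d t) x0 Z)|
        ≤ C * S := by
      rw [abs_mul]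
      exact mul_le_mul (gav_abs_le hp _ hC) (gav_abs_le hp _ hb) (abs_nonneg _) C0
    rw [Real.norm_eq_abs]
    refine (abs_sub _ _).trans ?_
    linarith
  · refine Integrable.const_mul (integrable_finsetSum _ fun k _ => ?_) _
    exact ((integrable_coord k).abs.const_mul B).add (integrable_const _)
  · refine ae_of_all _ fun Z t ht => ?_
    exact gav_hasDerivAt hp (H := fun t => Hy (h t) (Z + h t x0))
      (H' := Hder (h t) (d t) x0 Z) (fun x => Hy_hasDerivAt (hε t ht).1 x0 Z x) f

/-- Symmetrised derivative of the overlap. -/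
def Rp (h d : X → ι → ℝ) (x y : X) : ℝ := Qf h d x y + Qf h d y x

/-- Integrand of the derivative formula. -/
def dInt (p : X → ℝ) (h : X → ι → ℝ) (Y : ι → ℝ) (R : X → X → ℝ) (x0 : X) (f : X → ℝ) : ℝ :=
  gb p h Y (fun x => f x * (R x x0 - gb p h Y (fun y => R x y) - gb p h Y (fun y => R y x0)
    + gb p h Y (fun y => gb p h Y (fun z => R y z))))

lemma dInt_nice (hp : IsW p) (h : X → ι → ℝ) (R : X → X → ℝ) (f : X → X → ℝ) :
    Nice (fun x0 Y => dInt p h Y R x0 (f x0)) := by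
  unfold dInt
  refine Nice.gb hp h (F := fun x0 x Y => f x0 x * (R x x0 - gb p h Y (fun y => R x y) -
    gb p h Y (fun y => R y x0) + gb p h Y (fun y => gb p h Y (fun z => R y z)))) fun x0 => ?_
  refine (Nice.of_fun _).mul ((((Nice.of_fun _).sub ?_).sub ?_).add ?_)
  · exact Nice.gb hp h (F := fun x y _ => R x y) fun x => Nice.of_fun _
  · exact Nice.gbf hp h _
  · exact Nice.gb' hp h (F := fun y Y => gb p h Y (fun z => R y z))
      (Nice.gb hp h (F := fun x y _ => R x y) fun x => Nice.of_fun _)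

lemma Ex_hasDerivAt (hp : IsW p) {h d : ℝ → X → ι → ℝ} {t0 : ℝ} (hP : ChPath h d t0)
    (f : X → X → ℝ) :
    HasDerivAt (fun t => Ex p (h t) (fun x0 Y => gb p (h t) Y (f x0)))
      (Ex p (h t0) (fun x0 Y => dInt p (h t0) Y (Rp (h t0) (d t0)) x0 (f x0))) t0 := by
  unfold Ex
  refine HasDerivAt.fun_sum fun x0 _ => ?_
  refine ((int_hasDerivAt hp hP x0 (f x0)).const_mul (p x0)).congr_deriv ?_
  congr 1
  set h0 := h t0
  set d0 := d t0
  have N := fun f => Nice.gbf hp h0 f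
  have N2 := fun (R : X → X → ℝ) => Nice.gb' hp h0 (F := fun y Y => gb p h0 Y (fun z => R y z))
      (Nice.gb hp h0 (F := fun x y _ => R x y) fun x => Nice.of_fun _)
  have iZ : ∀ k, Integrable (fun Z : ι → ℝ => Z k * gb p h0 (Z + h0 x0) (fun x => f x0 x * d0 x k))
      (gpi ι) := fun k => int_Zgb hp h0 _ k (Nice.gbf hp h0 _) x0
  have iZ2 : ∀ k, Integrable (fun Z : ι → ℝ => Z k * (gb p h0 (Z + h0 x0) (f x0) * 
      gb p h0 (Z + h0 x0) (fun x => 1 * d0 x k)))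
      (gpi ι) := fun k => int_Zgb hp h0 _ k ((N _).mul (N _)) x0
  rw [integral_sub]
  · rw [ibpC hp, ibpB hp, ← integral_sub]
    · congr 1
      ext Z
      set Y := Z + h0 x0
      unfold dInt
      have e1 : ∀ g : X → ℝ, gb p h0 Y (fun x => f x0 x * (g x - gb p h0 Y (fun y => Rp h0 d0 x y)
          - gb p h0 Y (fun y => Rp h0 d0 y x0)
          + gb p h0 Y (fun y => gb p h0 Y (fun z => Rp h0 d0 y z))))
          = gb p h0 Y (fun x => f x0 x * g x)
            - gb p h0 Y (fun x => gb p h0 Y (fun y => f x0 x * Rp h0 d0 x y))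
            - gb p h0 Y (f x0) * gb p h0 Y (fun y => Rp h0 d0 y x0)
            + gb p h0 Y (f x0) * gb p h0 Y (fun y => gb p h0 Y (fun z => Rp h0 d0 y z)) := by
        intro g
        simp only [mul_add, mul_sub, gb_add, gb_sub, gb_mul_right, gb_mul_left]
      refine Eq.trans ?_ (e1 (fun x => Rp h0 d0 x x0)).symm
      have e2 : gb p h0 Y (fun x => gb p h0 Y (fun y => Qf h0 d0 y x))
          = gb p h0 Y (fun x => gb p h0 Y (fun y => Qf h0 d0 x y)) := (gb_swap _ _ _).symm
      unfold Rp
      simp only [mul_add, gb_add, e2]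
      ring
    · exact ((N _).sub (N2 _)).integrable x0 _
    · exact (((N2 _).sub ((Nice.const 2).mul ((N _).mul (N2 _)))).add
        ((N _).mul (N _))).integrable x0 _
  · simp only [gb_Hder]
    exact (integrable_finsetSum _ fun k _ => iZ k).add (int_gb hp h0 x0 _ _)
  · have e : ∀ Z Y, gb p h0 Y (Hder h0 d0 x0 Z) = gb p h0 Y (fun x => 1 * Hder h0 d0 x0 Z x) := by
      intro Z Y; simp
    simp only [e, gb_Hder]
    simp only [mul_add, Finset.mul_sum]
    refine (integrable_finsetSum _ fun k _ => ?_).add (((N _).mul (N _)).integrable x0 _)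
    refine (iZ2 k).congr (ae_of_all _ fun Z => ?_)
    simp only; ring

/-- Jointly continuous and uniformly bounded families. -/
def NiceT {T : Type*} [TopologicalSpace T] (Φ : T → X → (ι → ℝ) → ℝ) : Prop :=
  (∀ x, Continuous fun q : T × (ι → ℝ) => Φ q.1 x q.2) ∧ ∃ C, ∀ t x Y, |Φ t x Y| ≤ C

section cont
variable {T : Type*} [TopologicalSpace T]

lemma NiceT.of_fun (f : X → ℝ) : NiceT (T := T) (ι := ι) (fun _ x _ => f x) := by
  obtain ⟨C, _, hC⟩ := fin_bdd f
  exact ⟨fun x => continuous_const, C, fun _ x _ => hC x⟩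

lemma NiceT.gb (hp : IsW p) {h : T → X → ι → ℝ} (hh : ∀ x k, Continuous fun t => h t x k)
    {F : T → X → X → (ι → ℝ) → ℝ}
    (hF : ∀ x, NiceT (fun t y Y => F t x y Y)) :
    NiceT (fun t x Y => _root_.gb p (h t) Y (fun y => F t x y Y)) := by
  choose hc C hC using hF
  obtain ⟨B, _, hB⟩ := fin_bdd C
  refine ⟨fun x => ?_, B, fun t x Y => ?_⟩
  · refine gav_continuous hp (H := fun q : T × (ι → ℝ) => Hy (h q.1) q.2) (fun y => ?_) (hc x)
    unfold Hy
    refine continuous_finsetSum _ fun k _ => ?_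
    have h1 : Continuous fun q : T × (ι → ℝ) => h q.1 y k := (hh y k).comp continuous_fst
    have h2 : Continuous fun q : T × (ι → ℝ) => q.2 k := by fun_prop
    exact (h1.mul h2).sub ((h1.pow 2).div_const 2)
  · exact gav_abs_le hp _ fun y => (hC x t y Y).trans ((le_abs_self _).trans (hB x))

lemma NiceT.mul {F G : T → X → (ι → ℝ) → ℝ} (hF : NiceT F) (hG : NiceT G) :
    NiceT (fun t x Y => F t x Y * G t x Y) := by
  obtain ⟨c1, C1, h1⟩ := hF
  obtain ⟨c2, C2, h2⟩ := hG
  refine ⟨fun x => (c1 x).mul (c2 x), C1 * C2, fun t x Y => ?_⟩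
  rw [abs_mul]
  exact mul_le_mul (h1 t x Y) (h2 t x Y) (abs_nonneg _) ((abs_nonneg _).trans (h1 t x Y))

lemma NiceT.add {F G : T → X → (ι → ℝ) → ℝ} (hF : NiceT F) (hG : NiceT G) :
    NiceT (fun t x Y => F t x Y + G t x Y) := by
  obtain ⟨c1, C1, h1⟩ := hF
  obtain ⟨c2, C2, h2⟩ := hG
  exact ⟨fun x => (c1 x).add (c2 x), C1 + C2, fun t x Y =>
    (abs_add_le _ _).trans (add_le_add (h1 t x Y) (h2 t x Y))⟩

lemma Ex_continuous (hp : IsW p) [FirstCountableTopology T] {h : T → X → ι → ℝ}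
    (hh : ∀ x k, Continuous fun t => h t x k) {Φ : T → X → (ι → ℝ) → ℝ} (hΦ : NiceT Φ) :
    Continuous fun t => Ex p (h t) (Φ t) := by
  obtain ⟨c, C, hC⟩ := hΦ
  unfold Ex
  refine continuous_finsetSum _ fun x0 _ => continuous_const.mul ?_
  have hk : Continuous fun t => h t x0 := continuous_pi fun k => hh x0 k
  refine continuous_of_dominated (bound := fun _ => C) (fun t => ?_)
    (fun t => ae_of_all _ fun Z => hC t x0 _) (integrable_const _) (ae_of_all _ fun Z => ?_)
  · have : Continuous fun Z : ι → ℝ => Φ t x0 (Z + h t x0) :=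
      (c x0).comp (by fun_prop : Continuous fun Z : ι → ℝ => ((t, Z + h t x0) : T × (ι → ℝ)))
    exact this.measurable.aestronglyMeasurable
  · exact (c x0).comp (by fun_prop : Continuous fun t : T => ((t, Z + h t x0) : T × (ι → ℝ)))

end cont

end deriv2

/-! ### An Efron-Stein type variance bound -/

lemma var_prod_le {A B : Type*} [MeasurableSpace A] [MeasurableSpace B] {μ : Measure A}
    {ν : Measure B} [IsProbabilityMeasure μ] [IsProbabilityMeasure ν] {F : A × B → ℝ}
    (hF : MemLp F 2 (μ.prod ν)) (hFx : ∀ x, MemLp (fun y => F (x, y)) 2 ν)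
    (hG : MemLp (fun x => ∫ y, F (x, y) ∂ν) 2 μ) {V1 V2 : ℝ}
    (h1 : ∀ x, variance (fun y => F (x, y)) ν ≤ V1)
    (h2 : variance (fun x => ∫ y, F (x, y) ∂ν) μ ≤ V2) :
    variance F (μ.prod ν) ≤ V1 + V2 := by
  rw [variance_eq_sub hF]
  rw [variance_eq_sub hG] at h2
  have i1 : Integrable F (μ.prod ν) := hF.integrable one_le_two
  have i2 : Integrable (F ^ 2) (μ.prod ν) := hF.integrable_sq
  rw [integral_prod _ i1, integral_prod _ i2]
  have h3 : ∫ x, ∫ y, (F ^ 2) (x, y) ∂ν ∂μ ≤ ∫ x, (V1 + (∫ y, F (x, y) ∂ν) ^ 2) ∂μ := by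
    refine integral_mono i2.integral_prod_left ((integrable_const _).add hG.integrable_sq) fun x => ?_
    have := h1 x
    rw [variance_eq_sub (hFx x)] at this
    simp only [Pi.pow_apply] at this ⊢
    linarith
  rw [integral_add (integrable_const _) hG.integrable_sq] at h3
  simp only [integral_const, probReal_univ, one_smul] at h3
  simp only [Pi.pow_apply] at h2 h3 ⊢
  linarith

lemma memLp_of_lip {A : Type*} [MeasurableSpace A] {μ : Measure A} [IsProbabilityMeasure μ]
    {F φ : A → ℝ} {c : ℝ} (hF : Measurable F) (hφ : MemLp φ 2 μ)
    (h : ∀ x, |F x| ≤ c + φ x) : MemLp F 2 μ := by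
  have : MemLp (fun x => c + φ x) 2 μ := (memLp_const c).add hφ
  refine this.mono hF.aestronglyMeasurable (ae_of_all _ fun x => ?_)
  rw [Real.norm_eq_abs, Real.norm_eq_abs]
  exact (h x).trans (le_abs_self _)

lemma var_one_le {A : Type*} [MeasurableSpace A] {μ : Measure A} [IsProbabilityMeasure μ]
    {F φ : A → ℝ} {b : ℝ} (hb : 0 ≤ b) (hF : MemLp F 2 μ) (hφ : MemLp φ 2 μ)
    (h : ∀ x y, |F x - F y| ≤ b * |φ x - φ y|) :
    variance F μ ≤ 4 * b ^ 2 * ∫ x, φ x ^ 2 ∂μ := by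
  have iF := hF.integrable one_le_two
  have iφ := hφ.integrable one_le_two
  have h1 : ∀ x, (F x - ∫ y, F y ∂μ) ^ 2 ≤ 2 * b ^ 2 * φ x ^ 2 + 2 * b ^ 2 * ∫ y, φ y ^ 2 ∂μ := by
    intro x
    have e : F x - ∫ y, F y ∂μ = ∫ y, (F x - F y) ∂μ := by
      rw [integral_sub (integrable_const _) iF]; simp
    have h2 : |F x - ∫ y, F y ∂μ| ≤ b * (|φ x| + ∫ y, |φ y| ∂μ) := by
      rw [e]
      refine (abs_integral_le_integral_abs).trans ?_
      have : b * (|φ x| + ∫ y, |φ y| ∂μ) = ∫ y, b * (|φ x| + |φ y|) ∂μ := by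
        rw [integral_const_mul, integral_add (integrable_const _) iφ.abs]; simp
      rw [this]
      refine integral_mono ((integrable_const _).sub iF).abs
        (((integrable_const _).add iφ.abs).const_mul b) fun y => ?_
      exact (h x y).trans (mul_le_mul_of_nonneg_left (abs_sub _ _) hb)
    have h3 : (∫ y, |φ y| ∂μ) ^ 2 ≤ ∫ y, φ y ^ 2 ∂μ := by
      have := variance_nonneg (fun y => |φ y|) μ
      rw [variance_eq_sub (by simpa using hφ.norm)] at this
      simp only [Pi.pow_apply, sq_abs] at this
      linarith
    have h4 : (F x - ∫ y, F y ∂μ) ^ 2 ≤ (b * (|φ x| + ∫ y, |φ y| ∂μ)) ^ 2 := by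
      rw [← sq_abs]
      exact pow_le_pow_left₀ (abs_nonneg _) h2 2
    refine h4.trans ?_
    rw [mul_pow]
    have h5 : (|φ x| + ∫ y, |φ y| ∂μ) ^ 2 ≤ 2 * φ x ^ 2 + 2 * ∫ y, φ y ^ 2 ∂μ := by
      have := sq_nonneg (|φ x| - ∫ y, |φ y| ∂μ)
      have := sq_abs (φ x)
      nlinarith
    calc _ ≤ b ^ 2 * (2 * φ x ^ 2 + 2 * ∫ y, φ y ^ 2 ∂μ) :=
          mul_le_mul_of_nonneg_left h5 (sq_nonneg _)
      _ = _ := by ring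
  rw [variance_eq_integral hF.aemeasurable]
  refine (integral_mono (hF.sub (memLp_const _)).integrable_sq ((hφ.integrable_sq.const_mul _).add
    (integrable_const _)) h1).trans (le_of_eq ?_)
  rw [integral_add' (hφ.integrable_sq.const_mul _) (integrable_const _), integral_const_mul]
  simp
  ring

section ES
variable {α : Type*} [MeasurableSpace α]

lemma memLp_pi_lip {J : Type*} [Fintype J] (μ : J → Measure α) [∀ k, IsProbabilityMeasure (μ k)]
    {φ : α → ℝ} (hφ : ∀ k, MemLp φ 2 (μ k))
    {b : J → ℝ} (hb : ∀ k, 0 ≤ b k) {F : (J → α) → ℝ} (hFm : Measurable F)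
    (hF : ∀ x y, |F x - F y| ≤ ∑ k, b k * |φ (x k) - φ (y k)|) : MemLp F 2 (Measure.pi μ) := by
  obtain ⟨y⟩ : Nonempty (J → α) := (Measure.pi μ).nonempty_of_neZero
  refine memLp_of_lip (c := |F y| + ∑ k, b k * |φ (y k)|) (φ := fun x => ∑ k, b k * |φ (x k)|)
    hFm (memLp_finsetSum _ fun k _ => ?_) fun x => ?_
  · refine MemLp.const_mul ?_ _
    have h1 : MemLp (fun x : J → α => φ (x k)) 2 (Measure.pi μ) :=
      (hφ k).comp_measurePreserving (measurePreserving_eval μ k)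
    simpa using h1.norm
  · have h1 : |F x| ≤ |F y| + |F x - F y| := by
      have := abs_add_le (F y) (F x - F y); simpa using this
    have h2 : ∑ k, b k * |φ (x k) - φ (y k)| ≤ ∑ k, b k * |φ (y k)| + ∑ k, b k * |φ (x k)| := by
      rw [← Finset.sum_add_distrib]
      refine Finset.sum_le_sum fun k _ => ?_
      rw [← mul_add]
      refine mul_le_mul_of_nonneg_left ?_ (hb k)
      rw [add_comm]; exact abs_sub _ _
    have := hF x y
    linarith

lemma ES_fin {φ : α → ℝ} (m : ℕ) : ∀ (μ : Fin m → Measure α) [∀ k, IsProbabilityMeasure (μ k)]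
    (hφ : ∀ k, MemLp φ 2 (μ k))
    {b : Fin m → ℝ} (hb : ∀ k, 0 ≤ b k) {F : (Fin m → α) → ℝ} (hFm : Measurable F)
    (hF : ∀ x y, |F x - F y| ≤ ∑ k, b k * |φ (x k) - φ (y k)|),
    variance F (Measure.pi μ) ≤ ∑ k, 4 * b k ^ 2 * ∫ x, φ x ^ 2 ∂(μ k) := by
  induction m with
  | zero =>
    intro μ _ hφ b hb F hFm hF
    have : F = fun _ => F (fun k => k.elim0) := by
      ext x; congr 1; ext k; exact k.elim0
    rw [this]
    have h0 : variance (fun _ : Fin 0 → α => F (fun k => k.elim0)) (Measure.pi μ) = 0 := by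
      rw [variance_eq_integral (by fun_prop)]; simp
    rw [h0]; simp
  | succ m ih =>
    intro μ _ hφ b hb F hFm hF
    have mp := (measurePreserving_piFinSuccAbove μ 0).symm
    set e := (MeasurableEquiv.piFinSuccAbove (fun _ : Fin (m+1) => α) 0).symm
    have he : ∀ x y, e (x, y) = Fin.cons x y := by
      intro x y; 
      simp [e, MeasurableEquiv.piFinSuccAbove, Fin.insertNthEquiv, Fin.insertNth_zero']
    have hmem := memLp_pi_lip μ hφ hb hFm hF
    have hvar : variance F (Measure.pi μ) = variance (F ∘ e)
        ((μ 0).prod (Measure.pi fun k => μ (Fin.succ k))) := by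
      have := mp.variance_fun_comp (f := F) hFm.aemeasurable
      exact this.symm
    have hmem' : MemLp (F ∘ e) 2 ((μ 0).prod (Measure.pi fun k => μ (Fin.succ k))) := by
      simpa using hmem.comp_measurePreserving mp
    have hlx : ∀ x y y', |F (e (x, y)) - F (e (x, y'))|
        ≤ ∑ k, b (Fin.succ k) * |φ (y k) - φ (y' k)| := by
      intro x y y'
      refine (hF _ _).trans (le_of_eq ?_)
      rw [he, he, Fin.sum_univ_succ]; simp
    have hly : ∀ x x' y, |F (e (x, y)) - F (e (x', y))| ≤ b 0 * |φ x - φ x'| := by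
      intro x x' y
      refine (hF _ _).trans (le_of_eq ?_)
      rw [he, he, Fin.sum_univ_succ]; simp
    have hmx : ∀ x, Measurable fun y => F (e (x, y)) := fun x =>
      hFm.comp (e.measurable.comp (by fun_prop))
    have hLx : ∀ x, MemLp (fun y => F (e (x, y))) 2 (Measure.pi fun k => μ (Fin.succ k)) := fun x =>
      memLp_pi_lip _ (fun k => hφ _) (fun k => hb _) (hmx x) (hlx x)
    have hGl : ∀ x x', |(∫ y, F (e (x, y)) ∂(Measure.pi fun k => μ (Fin.succ k)))
        - ∫ y, F (e (x', y)) ∂(Measure.pi fun k => μ (Fin.succ k))| ≤ b 0 * |φ x - φ x'| := by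
      intro x x'
      rw [← integral_sub ((hLx x).integrable one_le_two) ((hLx x').integrable one_le_two)]
      refine abs_integral_le_integral_abs.trans ?_
      refine (integral_mono (((hLx x).integrable one_le_two).sub 
        ((hLx x').integrable one_le_two)).abs (integrable_const _) (fun y => hly x x' y)).trans ?_
      simp
    have hGm : Measurable fun x => ∫ y, F (e (x, y)) ∂(Measure.pi fun k => μ (Fin.succ k)) := by
      have : StronglyMeasurable fun q : α × (Fin m → α) => F (e q) :=
        (hFm.comp e.measurable).stronglyMeasurable
      exact this.integral_prod_right.measurable
    have hGL : MemLp (fun x => ∫ y, F (e (x, y)) ∂(Measure.pi fun k => μ (Fin.succ k))) 2 (μ 0) := by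
      obtain ⟨x'⟩ : Nonempty α := (μ 0).nonempty_of_neZero
      set G := fun x => ∫ y, F (e (x, y)) ∂(Measure.pi fun k => μ (Fin.succ k))
      refine memLp_of_lip (c := |G x'| + b 0 * |φ x'|) (φ := fun x => b 0 * |φ x|) hGm
        (by simpa using (hφ 0).norm.const_mul (b 0)) fun x => ?_
      have h1 : |G x| ≤ |G x'| + |G x - G x'| := by
        have := abs_add_le (G x') (G x - G x'); simpa using this
      have h2 := hGl x x'
      have h3 := mul_le_mul_of_nonneg_left (abs_sub (φ x) (φ x')) (hb 0)
      simp only [G] at *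
      linarith
    rw [hvar, Fin.sum_univ_succ]
    refine le_trans ?_ (le_of_eq (add_comm _ _))
    exact var_prod_le (F := F ∘ e) hmem' hLx hGL
      (fun x => ih (fun k => μ (Fin.succ k)) (fun k => hφ _) (fun k => hb _) (hmx x) (hlx x))
      (var_one_le (hb 0) hGL (hφ 0) hGl)

lemma ES_pi {φ : α → ℝ} {J : Type*} [Fintype J] (μ : J → Measure α)
    [∀ k, IsProbabilityMeasure (μ k)] (hφ : ∀ k, MemLp φ 2 (μ k))
    {b : J → ℝ} (hb : ∀ k, 0 ≤ b k) {F : (J → α) → ℝ} (hFm : Measurable F)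
    (hF : ∀ x y, |F x - F y| ≤ ∑ k, b k * |φ (x k) - φ (y k)|) :
    variance F (Measure.pi μ) ≤ ∑ k, 4 * b k ^ 2 * ∫ x, φ x ^ 2 ∂(μ k) := by
  classical
  set e := (Fintype.equivFin J).symm
  have mp := measurePreserving_piCongrLeft (μ := μ) e
  have hc := mp.variance_fun_comp (f := F) hFm.aemeasurable
  rw [← hc]
  have key : ∀ (x : Fin (Fintype.card J) → α) k, 
      (MeasurableEquiv.piCongrLeft (fun _ : J => α) e) x (e k) = x k := by
    intro x k
    simp [MeasurableEquiv.piCongrLeft, Equiv.piCongrLeft_apply_apply]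
  have := ES_fin (φ := φ) (Fintype.card J) (fun k => μ (e k)) (fun k => hφ _) (b := fun k => b (e k))
    (fun k => hb _) (F := fun x => F ((MeasurableEquiv.piCongrLeft (fun _ : J => α) e) x))
    (hFm.comp (MeasurableEquiv.measurable _)) (fun x y => by
      refine (hF _ _).trans (le_of_eq ?_)
      rw [← Equiv.sum_comp e]
      simp only [key])
  refine this.trans (le_of_eq ?_)
  exact Equiv.sum_comp e (fun k => 4 * b k ^ 2 * ∫ x, φ x ^ 2 ∂(μ k))

end ES

section LZsec
variable {X ι : Type*} [Fintype X] [Fintype ι]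

/-- Log-partition function as a function of signal and noise. -/
def LZ (p : X → ℝ) (h : X → ι → ℝ) (x0 : X) (Z : ι → ℝ) : ℝ :=
  log (∑ x, p x * exp (Hy h (Z + h x0) x))

/-- Expectation over signal and noise. -/
def E2 (p : X → ℝ) (Ψ : X → (ι → ℝ) → ℝ) : ℝ := ∑ x0, p x0 * ∫ Z, Ψ x0 Z ∂(gpi ι)

lemma Ex_eq_E2 (p : X → ℝ) (h : X → ι → ℝ) (Φ : X → (ι → ℝ) → ℝ) :
    Ex p h Φ = E2 p (fun x0 Z => Φ x0 (Z + h x0)) := rfl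

variable {p : X → ℝ}

lemma E2_add {F G : X → (ι → ℝ) → ℝ} (hF : ∀ x, Integrable (F x) (gpi ι))
    (hG : ∀ x, Integrable (G x) (gpi ι)) :
    E2 p (fun x Y => F x Y + G x Y) = E2 p F + E2 p G := by
  unfold E2
  rw [← Finset.sum_add_distrib]
  refine Finset.sum_congr rfl fun x _ => ?_
  rw [integral_add (hF x) (hG x)]; ring

lemma E2_sub {F G : X → (ι → ℝ) → ℝ} (hF : ∀ x, Integrable (F x) (gpi ι))
    (hG : ∀ x, Integrable (G x) (gpi ι)) :
    E2 p (fun x Y => F x Y - G x Y) = E2 p F - E2 p G := by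
  unfold E2
  rw [← Finset.sum_sub_distrib]
  refine Finset.sum_congr rfl fun x _ => ?_
  rw [integral_sub (hF x) (hG x)]; ring

lemma E2_mul_left (c : ℝ) (F : X → (ι → ℝ) → ℝ) :
    E2 p (fun x Y => c * F x Y) = c * E2 p F := by
  unfold E2
  rw [Finset.mul_sum]
  refine Finset.sum_congr rfl fun x _ => ?_
  rw [integral_const_mul]; ring

lemma E2_const (hp : IsW p) (c : ℝ) : E2 (ι := ι) p (fun _ _ => c) = c := by
  unfold E2
  simp [← Finset.sum_mul, hp.sum_eq]

lemma E2_mono (hp : IsW p) {F G : X → (ι → ℝ) → ℝ} (hF : ∀ x, Integrable (F x) (gpi ι))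
    (hG : ∀ x, Integrable (G x) (gpi ι))
    (hFG : ∀ x Y, F x Y ≤ G x Y) : E2 p F ≤ E2 p G := by
  unfold E2
  refine Finset.sum_le_sum fun x _ => mul_le_mul_of_nonneg_left ?_ (hp.nonneg x)
  exact integral_mono (hF x) (hG x) fun Z => hFG x _

lemma LZ_continuous (hp : IsW p) (h : X → ι → ℝ) (x0 : X) : Continuous (LZ p h x0) :=
  logZ_continuous hp fun x => Hy_path_continuous x

lemma LZ_lipZ (hp : IsW p) (h : X → ι → ℝ) {b : ι → ℝ} (hb : ∀ x k, |h x k| ≤ b k) (x0 : X)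
    (Z W : ι → ℝ) : |LZ p h x0 Z - LZ p h x0 W| ≤ ∑ k, b k * |Z k - W k| := by
  refine logZ_lip hp fun x => ?_
  unfold Hy
  rw [← Finset.sum_sub_distrib]
  refine (Finset.abs_sum_le_sum_abs _ _).trans (Finset.sum_le_sum fun k _ => ?_)
  have : h x k * (Z + h x0) k - h x k ^ 2 / 2 - (h x k * (W + h x0) k - h x k ^ 2 / 2)
      = h x k * (Z k - W k) := by simp only [Pi.add_apply]; ring
  rw [this, abs_mul]
  exact mul_le_mul_of_nonneg_right (hb x k) (abs_nonneg _)

lemma memLp_id_stdG : MemLp (fun x : ℝ => x) 2 stdG := by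
  have := memLp_id_gaussianReal (μ := 0) (v := 1) 2
  exact this

lemma LZ_memLp (hp : IsW p) (h : X → ι → ℝ) (x0 : X) : MemLp (LZ p h x0) 2 (gpi ι) := by
  obtain ⟨b, b0, hb⟩ : ∃ b : ι → ℝ, (∀ k, 0 ≤ b k) ∧ ∀ x k, |h x k| ≤ b k := by
    have : ∀ k, ∃ b, 0 ≤ b ∧ ∀ x, |h x k| ≤ b := fun k => fin_bdd fun x => h x k
    choose b b0 hb using this
    exact ⟨b, b0, fun x k => hb k x⟩
  exact memLp_pi_lip (fun _ : ι => stdG) (φ := fun x => x) (fun _ => memLp_id_stdG) b0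
    (LZ_continuous hp h x0).measurable (LZ_lipZ hp h hb x0)

end LZsec

section LZvar
variable {α J ι : Type*} [Fintype J] [Fintype ι] [Fintype α] [MeasurableSpace α]
  [MeasurableSingletonClass α] [DecidableEq J]

lemma isW_pi (μ : J → Measure α) [∀ j, IsProbabilityMeasure (μ j)] :
    IsW (fun x : J → α => (Measure.pi μ).real {x}) := by
  refine ⟨fun x => measureReal_nonneg, ?_⟩
  have := integral_fintype (μ := Measure.pi μ) (f := fun _ : J → α => (1 : ℝ)) (integrable_const _)
  simpa using this.symm

lemma E2_eq_integral (μ : J → Measure α) [∀ j, IsProbabilityMeasure (μ j)]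
    {Ψ : (J → α) → (ι → ℝ) → ℝ}
    (hI : Integrable (fun q : (J → α) × (ι → ℝ) => Ψ q.1 q.2) ((Measure.pi μ).prod (gpi ι))) :
    E2 (fun x : J → α => (Measure.pi μ).real {x}) Ψ
      = ∫ q, Ψ q.1 q.2 ∂((Measure.pi μ).prod (gpi ι)) := by
  rw [integral_prod _ hI, integral_fintype (.of_finite)]
  rfl

lemma LZ_var (μ : J → Measure α) [∀ j, IsProbabilityMeasure (μ j)] {p : (J → α) → ℝ}
    (hpe : p = fun x : J → α => (Measure.pi μ).real {x})
    (h : (J → α) → ι → ℝ) {b : ι → ℝ} (b0 : ∀ k, 0 ≤ b k) (hb : ∀ x k, |h x k| ≤ b k)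
    {φ : α → ℝ} {K : ℝ} (hφ : ∀ s, |φ s| ≤ K) {c : J → ℝ} (c0 : ∀ j, 0 ≤ c j)
    (hc : ∀ x x0 y0 : J → α, |∑ k, h x k * (h x0 k - h y0 k)| ≤ ∑ j, c j * |φ (x0 j) - φ (y0 j)|)
    {V : ℝ} (hV : (∑ k, 4 * b k ^ 2) + ∑ j, 4 * c j ^ 2 * K ^ 2 ≤ V) :
    E2 p (fun x0 Z => |LZ p h x0 Z - E2 p (LZ p h)|) ≤ √V := by
  have hp : IsW p := by rw [hpe]; exact isW_pi μ
  set F : (J → α) × (ι → ℝ) → ℝ := fun q => LZ p h q.1 q.2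
  have hFm : Measurable F := measurable_from_prod_countable_right fun x =>
    (LZ_continuous hp h x).measurable
  have hφL : ∀ j, MemLp φ 2 (μ j) := fun j => MemLp.of_bound (by fun_prop) K (ae_of_all _ hφ)
  have hZ := LZ_memLp (ι := ι) hp h
  have hlx : ∀ x0 y0 Z, |LZ p h x0 Z - LZ p h y0 Z| ≤ ∑ j, c j * |φ (x0 j) - φ (y0 j)| := by
    intro x0 y0 Z
    refine logZ_lip hp fun x => ?_
    unfold Hy
    rw [← Finset.sum_sub_distrib]
    refine le_trans (le_of_eq ?_) (hc x x0 y0)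
    congr 1
    refine Finset.sum_congr rfl fun k _ => ?_
    simp only [Pi.add_apply]; ring
  have hGl : ∀ x0 y0, |(∫ Z, LZ p h x0 Z ∂(gpi ι)) - ∫ Z, LZ p h y0 Z ∂(gpi ι)|
      ≤ ∑ j, c j * |φ (x0 j) - φ (y0 j)| := by
    intro x0 y0
    rw [← integral_sub ((hZ x0).integrable one_le_two) ((hZ y0).integrable one_le_two)]
    refine abs_integral_le_integral_abs.trans ?_
    refine (integral_mono (((hZ x0).integrable one_le_two).sub
      ((hZ y0).integrable one_le_two)).abs (integrable_const _) (fun y => hlx x0 y0 y)).trans ?_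
    simp
  have hG : MemLp (fun x0 => ∫ Z, LZ p h x0 Z ∂(gpi ι)) 2 (Measure.pi μ) :=
    memLp_pi_lip μ hφL c0 (measurable_of_countable _) hGl
  have hF : MemLp F 2 ((Measure.pi μ).prod (gpi ι)) := by
    obtain ⟨C, C0, hC⟩ := fin_bdd fun x => LZ p h x 0
    refine memLp_of_lip (c := C) (φ := fun q => ∑ k, b k * |q.2 k|) hFm ?_ fun q => ?_
    · refine memLp_finsetSum _ fun k _ => ?_
      refine MemLp.const_mul ?_ _
      have h1 : MemLp (fun x : ι → ℝ => x k) 2 (gpi ι) :=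
        memLp_id_stdG.comp_measurePreserving (measurePreserving_eval (fun _ : ι => stdG) k)
      have h2 := h1.comp_measurePreserving 
        (measurePreserving_snd (μ := Measure.pi μ) (ν := gpi ι))
      simpa using h2.norm
    · have h1 := LZ_lipZ hp h hb q.1 q.2 0
      have h2 := hC q.1
      simp only [Pi.zero_apply, sub_zero] at h1
      have h3 := abs_add_le (LZ p h q.1 0) (LZ p h q.1 q.2 - LZ p h q.1 0)
      simp only [add_sub_cancel] at h3
      simp only [F]; linarith
  have hvar : variance F ((Measure.pi μ).prod (gpi ι)) ≤ V := by
    refine le_trans (var_prod_le hF (fun x => hZ x) hG (V1 := ∑ k, 4 * b k ^ 2)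
      (V2 := ∑ j, 4 * c j ^ 2 * K ^ 2) (fun x => ?_) ?_) hV
    · have := ES_pi (fun _ : ι => stdG) (φ := fun x => x) (fun _ => memLp_id_stdG) b0
        (LZ_continuous hp h x).measurable (LZ_lipZ hp h hb x)
      simp only [integral_sq_stdG, mul_one] at this
      exact this
    · refine (ES_pi μ hφL c0 (measurable_of_countable _) hGl).trans ?_
      refine Finset.sum_le_sum fun j _ => mul_le_mul_of_nonneg_left ?_ (by have := c0 j; positivity)
      refine (integral_mono (g := fun _ => K ^ 2) (hφL j).integrable_sq (integrable_const _) 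
        fun s => ?_).trans (by simp)
      exact sq_le_sq' (abs_le.1 (hφ s)).1 (abs_le.1 (hφ s)).2
  have e1 : E2 p (LZ p h) = ∫ q, F q ∂((Measure.pi μ).prod (gpi ι)) := by
    have := E2_eq_integral μ (Ψ := LZ p h) (hF.integrable one_le_two)
    rw [← this, ← hpe]
  set m := E2 p (LZ p h)
  have hA : MemLp (fun q => |F q - m|) 2 ((Measure.pi μ).prod (gpi ι)) := by
    simpa using (hF.sub (memLp_const m)).norm
  have e2 : E2 p (fun x0 Z => |LZ p h x0 Z - m|)
      = ∫ q, |F q - m| ∂((Measure.pi μ).prod (gpi ι)) := by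
    have := E2_eq_integral μ (Ψ := fun x0 Z => |LZ p h x0 Z - m|) (hA.integrable one_le_two)
    rw [← this, ← hpe]
  rw [e2]
  refine Real.le_sqrt_of_sq_le ?_
  refine le_trans ?_ hvar
  rw [variance_eq_integral hF.aemeasurable, ← e1]
  have := variance_nonneg (fun q => |F q - m|) ((Measure.pi μ).prod (gpi ι))
  rw [variance_eq_sub hA] at this
  simp only [Pi.pow_apply, sq_abs] at this
  linarith

end LZvar

/-! ### Concentration of the overlap of the perturbed coordinates -/

section conc
variable {X ι : Type*} [Fintype X] [Fintype ι] {p : X → ℝ}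

/-- Perturbed signal map. -/
def ha (g w : X → ι → ℝ) (a : ℝ) (x : X) (k : ι) : ℝ := g x k + a * w x k

/-- Unnormalised overlap. -/
def Wv (w : X → ι → ℝ) (x y : X) : ℝ := ∑ k, w x k * w y k

/-- Mean overlap. -/
def mW (p : X → ℝ) (g w : X → ι → ℝ) (a : ℝ) : ℝ :=
  Ex p (ha g w a) (fun x0 Y => gb p (ha g w a) Y (fun x => Wv w x x0))

/-- Second moment of the overlap. -/
def AW (p : X → ℝ) (g w : X → ι → ℝ) (a : ℝ) : ℝ :=
  Ex p (ha g w a) (fun x0 Y => gb p (ha g w a) Y (fun x => Wv w x x0 ^ 2))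

/-- Second moment of the conditional mean of the overlap. -/
def BW (p : X → ℝ) (g w : X → ι → ℝ) (a : ℝ) : ℝ :=
  Ex p (ha g w a) (fun x0 Y => gb p (ha g w a) Y (fun x => Wv w x x0) ^ 2)

/-- Second moment of the thermal mean of the overlap. -/
def CW (p : X → ℝ) (g w : X → ι → ℝ) (a : ℝ) : ℝ :=
  Ex p (ha g w a) (fun _ Y =>
    gb p (ha g w a) Y (fun y => gb p (ha g w a) Y (fun x => Wv w x y)) ^ 2)

lemma Wv_comm (w : X → ι → ℝ) (x y : X) : Wv w x y = Wv w y x := by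
  unfold Wv; exact Finset.sum_congr rfl fun k _ => mul_comm _ _

lemma ha_path (g w : X → ι → ℝ) (a : ℝ) : ChPath (ha g w) (fun _ => w) a := by
  refine ⟨Eventually.of_forall fun t x k => ?_, fun x k => continuousAt_const⟩
  unfold ha
  simpa using ((hasDerivAt_id t).mul_const (w x k)).const_add (g x k)

lemma ha_cont (g w : X → ι → ℝ) (x : X) (k : ι) : Continuous fun a => ha g w a x k := by
  unfold ha; fun_prop

lemma Qf_ha {g w : X → ι → ℝ} (hgw : ∀ x y k, g x k * w y k = 0) (a : ℝ) (x y : X) :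
    Qf (ha g w a) w x y = a * Wv w x y := by
  unfold Qf ha Wv
  rw [Finset.mul_sum]
  refine Finset.sum_congr rfl fun k _ => ?_
  rw [add_mul, hgw]; ring

lemma Rp_ha {g w : X → ι → ℝ} (hgw : ∀ x y k, g x k * w y k = 0) (a : ℝ) (x y : X) :
    Rp (ha g w a) w x y = 2 * a * Wv w x y := by
  unfold Rp
  rw [Qf_ha hgw, Qf_ha hgw, Wv_comm w y x]; ring

lemma AW_cont (hp : IsW p) (g w : X → ι → ℝ) : Continuous (AW p g w) :=
  Ex_continuous hp (ha_cont g w) (NiceT.gb hp (ha_cont g w)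
    (F := fun _ x0 x _ => Wv w x x0 ^ 2) fun x0 => NiceT.of_fun _)

lemma mW_cont (hp : IsW p) (g w : X → ι → ℝ) : Continuous (mW p g w) :=
  Ex_continuous hp (ha_cont g w) (NiceT.gb hp (ha_cont g w)
    (F := fun _ x0 x _ => Wv w x x0) fun x0 => NiceT.of_fun _)

lemma BW_cont (hp : IsW p) (g w : X → ι → ℝ) : Continuous (BW p g w) := by
  have h1 := (NiceT.gb hp (ha_cont g w)
    (F := fun _ x0 x _ => Wv w x x0) fun x0 => NiceT.of_fun _)
  have := Ex_continuous hp (ha_cont g w) (h1.mul h1)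
  unfold BW
  simpa [pow_two] using this

lemma CW_cont (hp : IsW p) (g w : X → ι → ℝ) : Continuous (CW p g w) := by
  have h1 := (NiceT.gb hp (ha_cont g w) (F := fun t (x0 : X) y Y => gb p (ha g w t) Y (fun x => Wv w x y))
    fun x0 => (NiceT.gb hp (ha_cont g w)
    (F := fun _ x0 x _ => Wv w x x0) fun x0 => NiceT.of_fun _))
  have := Ex_continuous hp (ha_cont g w) (h1.mul h1)
  unfold CW
  simpa [pow_two] using this

section fixed
variable (hp : IsW p) {g w : X → ι → ℝ} (hgw : ∀ x y k, g x k * w y k = 0) {M : ℝ}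
  (hM : ∀ x y, |Wv w x y| ≤ M)
include hp hgw

lemma N1 (h : X → ι → ℝ) (R : X → X → ℝ) : Nice (fun x0 Y => gb p h Y (fun x => R x x0)) :=
  Nice.gb hp h (F := fun x0 x _ => R x x0) fun x => Nice.of_fun _

lemma mW_deriv (a : ℝ) :
    HasDerivAt (mW p g w) (2 * a * (AW p g w a - 2 * BW p g w a + CW p g w a)) a := by
  refine (Ex_hasDerivAt hp (ha_path g w a) (fun x0 x => Wv w x x0)).congr_deriv ?_
  set h := ha g w a
  have e : ∀ x0 Y, dInt p h Y (Rp h w) x0 (fun x => Wv w x x0)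
      = 2 * a * (gb p h Y (fun x => Wv w x x0 ^ 2)
        - gb p h Y (fun x => Wv w x x0 * gb p h Y (fun y => Wv w y x))
        - gb p h Y (fun x => Wv w x x0) ^ 2
        + gb p h Y (fun x => Wv w x x0) * gb p h Y (fun y => gb p h Y (fun x => Wv w x y))) := by
    intro x0 Y
    unfold dInt
    have e1 : ∀ x y, Rp h w x y = 2 * a * Wv w x y := Rp_ha hgw a
    simp only [e1, gb_mul_left]
    have e2 : gb p h Y (fun y => gb p h Y (fun x => Wv w x y))
      = gb p h Y (fun y => gb p h Y (fun z => Wv w y z)) := gb_swap _ _ _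
    have e3 : (fun x => Wv w x x0 * (2 * a * Wv w x x0 - 2 * a * gb p h Y (fun y => Wv w x y)
      - 2 * a * gb p h Y (fun y => Wv w y x0) + 2 * a * gb p h Y (fun y => gb p h Y (fun z => Wv w y z))))
      = fun x => 2 * a * (Wv w x x0 ^ 2 - Wv w x x0 * gb p h Y (fun y => Wv w y x)
        - Wv w x x0 * gb p h Y (fun y => Wv w y x0)
        + Wv w x x0 * gb p h Y (fun y => gb p h Y (fun z => Wv w y z))) := by
      ext x
      simp only [Wv_comm w x]
      ring
    rw [e3, gb_mul_left, gb_add, gb_sub, gb_sub, gb_mul_right, gb_mul_right, e2]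
    ring
  simp only [e]
  rw [Ex_mul_left]
  congr 1
  have nT : Nice (fun x0 Y => gb p h Y (fun x => Wv w x x0)) := N1 hp hgw h (Wv w)
  have n1 : Nice (fun x0 Y => gb p h Y (fun x => Wv w x x0 ^ 2)) :=
    N1 hp hgw h (fun x y => Wv w x y ^ 2)
  have n2' : ∀ x0, Nice (fun x Y => Wv w x x0 * gb p h Y (fun y => Wv w y x)) := fun x0 =>
    (Nice.of_fun _).mul nT
  have n2 : Nice (fun x0 Y => gb p h Y (fun x => Wv w x x0 * gb p h Y (fun y => Wv w y x))) :=
    Nice.gb hp h (F := fun x0 x Y => Wv w x x0 * gb p h Y (fun y => Wv w y x)) n2'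
  have nτ : Nice (fun (_ : X) Y => gb p h Y (fun y => gb p h Y (fun x => Wv w x y))) :=
    Nice.gb' hp h (F := fun y Y => gb p h Y (fun x => Wv w x y)) nT
  rw [Ex_add ((n1.sub n2).sub nT.pow) (nT.mul nτ), Ex_sub (n1.sub n2) nT.pow, Ex_sub n1 n2]
  have eB : Ex p h (fun x0 Y => gb p h Y (fun x => Wv w x x0 * gb p h Y (fun y => Wv w y x)))
      = BW p g w a := by
    unfold BW
    rw [nishimori hp n2, nishimori hp nT.pow]
    congr 1; ext _ Y
    change gb p h Y _ = gb p h Y _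
    rw [gb_swap]
    congr 1; ext x
    rw [gb_mul_right, pow_two]
    congr 1
    exact congrArg (gb p h Y) (funext fun y => Wv_comm w x y)
  have eC : Ex p h (fun x0 Y => gb p h Y (fun x => Wv w x x0) *
      gb p h Y (fun y => gb p h Y (fun x => Wv w x y))) = CW p g w a := by
    unfold CW
    rw [nishimori hp (nT.mul nτ)]
    congr 1; ext _ Y
    rw [gb_mul_right, pow_two]
  rw [eB, eC]
  change AW p g w a - BW p g w a - BW p g w a + CW p g w a = _
  ring

lemma D_nonneg (a : ℝ) : 0 ≤ AW p g w a - 2 * BW p g w a + CW p g w a := by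
  set h := ha g w a
  have nT : Nice (fun x0 Y => gb p h Y (fun x => Wv w x x0)) := N1 hp hgw h (Wv w)
  have n1 : Nice (fun x0 Y => gb p h Y (fun x => Wv w x x0 ^ 2)) :=
    N1 hp hgw h (fun x y => Wv w x y ^ 2)
  have nτ : Nice (fun (_ : X) Y => gb p h Y (fun y => gb p h Y (fun x => Wv w x y))) :=
    Nice.gb' hp h (F := fun y Y => gb p h Y (fun x => Wv w x y)) nT
  have key : AW p g w a - 2 * BW p g w a + CW p g w a
      = Ex p h (fun _ Y => gb p h Y (fun z => gb p h Y (fun x => Wv w x z ^ 2))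
        - 2 * gb p h Y (fun x => gb p h Y (fun y => Wv w y x) ^ 2)
        + gb p h Y (fun y => gb p h Y (fun x => Wv w x y)) ^ 2) := by
    have m1 := Nice.gb' hp h n1
    have m2 := Nice.gb' hp h nT.pow
    rw [Ex_add (m1.sub ((Nice.const 2).mul m2)) nτ.pow, Ex_sub m1 ((Nice.const 2).mul m2),
      Ex_mul_left, ← nishimori hp n1, ← nishimori hp nT.pow]
    rfl
  rw [key]
  refine Ex_nonneg hp fun _ Y => ?_
  set T := fun x => gb p h Y (fun y => Wv w y x)
  set τ := gb p h Y T
  have pos : 0 ≤ gb p h Y (fun z => gb p h Y (fun x => (Wv w x z - T x - T z + τ) ^ 2)) :=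
    gav_nonneg hp _ fun z => gav_nonneg hp _ fun x => sq_nonneg _
  have e1 : ∀ z, gb p h Y (fun x => (Wv w x z - T x - T z + τ) ^ 2)
      = gb p h Y (fun x => Wv w x z ^ 2) + gb p h Y (fun x => T x ^ 2) + T z ^ 2 + τ ^ 2
        - 2 * gb p h Y (fun x => Wv w x z * T x) - 2 * T z ^ 2 + 2 * τ * T z 
        + 2 * (T z * τ) - 2 * τ * τ - 2 * τ * T z := by
    intro z
    have : (fun x => (Wv w x z - T x - T z + τ) ^ 2)
      = fun x => Wv w x z ^ 2 + T x ^ 2 + T z ^ 2 + τ ^ 2 - 2 * (Wv w x z * T x) 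
        - 2 * T z * Wv w x z + 2 * τ * Wv w x z + 2 * T z * T x - 2 * τ * T x - 2 * τ * T z := by
      ext x; ring
    rw [this]
    simp only [gb_add, gb_sub, gb_mul_left, gb_const hp]
    change _ + _ + _ + _ - _ - 2 * T z * T z + 2 * τ * T z + 2 * T z * τ - 2 * τ * τ - _ = _
    ring
  simp only [e1] at pos
  have e2 : gb p h Y (fun z => gb p h Y (fun x => Wv w x z * T x)) = gb p h Y (fun x => T x ^ 2) := by
    rw [gb_swap]
    congr 1; ext x
    rw [gb_mul_right, pow_two]
    congr 1
    exact congrArg (gb p h Y) (funext fun y => Wv_comm w x y)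
  simp only [gb_add, gb_sub, gb_mul_left, gb_mul_right, gb_const hp, e2] at pos
  change 0 ≤ _ + _ + _ + _ - _ - _ + 2 * τ * τ + 2 * (τ * τ) - 2 * τ * τ - 2 * τ * τ at pos
  nlinarith

lemma BC (a : ℝ) : CW p g w a ≤ BW p g w a := by
  set h := ha g w a
  have nT : Nice (fun x0 Y => gb p h Y (fun x => Wv w x x0)) := N1 hp hgw h (Wv w)
  have nτ : Nice (fun (_ : X) Y => gb p h Y (fun y => gb p h Y (fun x => Wv w x y))) :=
    Nice.gb' hp h (F := fun y Y => gb p h Y (fun x => Wv w x y)) nT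
  unfold BW CW
  rw [nishimori hp nT.pow]
  exact Ex_mono hp nτ.pow (Nice.gb' hp h nT.pow) fun _ Y => gav_sq_le hp _ _

include hM
lemma M_nonneg : 0 ≤ M := by
  have hX : Nonempty X := by
    by_contra hne
    rw [not_nonempty_iff] at hne
    have := hp.sum_eq
    simp at this
  obtain ⟨x⟩ := hX
  exact (abs_nonneg _).trans (hM x x)

lemma mW_abs (a : ℝ) : |mW p g w a| ≤ M := by
  set h := ha g w a
  have nT : Nice (fun x0 Y => gb p h Y (fun x => Wv w x x0)) := N1 hp hgw h (Wv w)
  refine (Ex_abs_le hp nT).trans ?_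
  refine (Ex_mono hp nT.abs (Nice.const M) fun x0 Y => gav_abs_le hp _ fun x => hM x x0).trans ?_
  rw [Ex_const hp]

lemma int_D : ∫ a in (1 : ℝ)..2, (AW p g w a - 2 * BW p g w a + CW p g w a) ≤ M := by
  have cD : Continuous fun a => AW p g w a - 2 * BW p g w a + CW p g w a :=
    ((AW_cont hp g w).sub ((BW_cont hp g w).const_mul 2)).add (CW_cont hp g w)
  have h1 : ∫ a in (1 : ℝ)..2, 2 * a * (AW p g w a - 2 * BW p g w a + CW p g w a)
      = mW p g w 2 - mW p g w 1 :=
    intervalIntegral.integral_eq_sub_of_hasDerivAt (fun a _ => mW_deriv hp hgw a)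
      ((by fun_prop : Continuous fun a : ℝ => 2 * a).mul cD |>.intervalIntegrable _ _)
  have h2 : ∫ a in (1 : ℝ)..2, 2 * (AW p g w a - 2 * BW p g w a + CW p g w a)
      ≤ ∫ a in (1 : ℝ)..2, 2 * a * (AW p g w a - 2 * BW p g w a + CW p g w a) := by
    refine intervalIntegral.integral_mono_on (by norm_num) ((cD.const_mul 2).intervalIntegrable _ _)
      ((by fun_prop : Continuous fun a : ℝ => 2 * a).mul cD |>.intervalIntegrable _ _) fun a ha => ?_
    have := D_nonneg hp hgw a
    have := ha.1
    nlinarith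
  rw [intervalIntegral.integral_const_mul, h1] at h2
  have h3 := (abs_le.1 (mW_abs hp hgw hM 2)).2
  have h4 := (abs_le.1 (mW_abs hp hgw hM 1)).1
  linarith

end fixed
end conc

section conc
variable {X ι : Type*} [Fintype X] [Fintype ι] {p : X → ℝ}

/-- Thermal mean of the derivative of the Hamiltonian. -/
def Dg (p : X → ℝ) (h d : X → ι → ℝ) (x0 : X) (Z : ι → ℝ) : ℝ :=
  gb p h (Z + h x0) (Hder h d x0 Z)

lemma Dg_eq (h d : X → ι → ℝ) (x0 : X) (Z : ι → ℝ) : Dg p h d x0 Z =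
    (∑ k, Z k * gb p h (Z + h x0) (fun x => d x k))
        + gb p h (Z + h x0) (fun x => (Qf h d x0 x + Qf h d x x0 - Qf h d x x)) := by
  have := gb_Hder (p := p) h d x0 Z (Z + h x0) (fun _ => 1)
  simp only [one_mul] at this
  exact this

lemma Dg_integrable (hp : IsW p) (h d : X → ι → ℝ) (x0 : X) : Integrable (Dg p h d x0) (gpi ι) := by
  have : Dg p h d x0 = fun Z => (∑ k, Z k * gb p h (Z + h x0) (fun x => d x k))
        + gb p h (Z + h x0) (fun x => (Qf h d x0 x + Qf h d x x0 - Qf h d x x)) :=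
    funext fun Z => Dg_eq h d x0 Z
  rw [this]
  exact (integrable_finsetSum _ fun k _ => int_Zgb hp h _ k (Nice.gbf hp h _) x0).add
    (int_gb hp h x0 _ _)

section fixed
variable (hp : IsW p) {g w : X → ι → ℝ} (hgw : ∀ x y k, g x k * w y k = 0) {M : ℝ}
  (hM : ∀ x y, |Wv w x y| ≤ M)
include hp hgw

lemma mean_Dg (a : ℝ) : E2 p (Dg p (ha g w a) w) = a * mW p g w a := by
  set h := ha g w a with hh
  have nT : Nice (fun x0 Y => gb p h Y (fun x => Wv w x x0)) := N1 hp hgw h (Wv w)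
  have nτ : Nice (fun (_ : X) Y => gb p h Y (fun y => gb p h Y (fun x => Wv w x y))) :=
    Nice.gb' hp h (F := fun y Y => gb p h Y (fun x => Wv w x y)) nT
  have e : E2 p (Dg p h w) = Ex p h (fun x0 Y => 2 * a * gb p h Y (fun x => Wv w x x0)
      - a * gb p h Y (fun y => gb p h Y (fun x => Wv w x y))) := by
    unfold E2 Ex
    refine Finset.sum_congr rfl fun x0 _ => ?_
    congr 1
    have := ibpC hp h w x0 (fun _ => 1)
    simp only [one_mul] at this
    refine this.trans (integral_congr_ae (ae_of_all _ fun Z => ?_))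
    have e1 : ∀ x y, Qf h w x y = a * Wv w x y := Qf_ha hgw a
    simp only [e1, gb_mul_left, gb_add]
    have : Wv w x0 = fun x => Wv w x x0 := funext fun x => Wv_comm w x0 x
    rw [this]
    ring
  rw [e, Ex_sub ((Nice.const (2 * a)).mul nT) ((Nice.const a).mul nτ), Ex_mul_left, Ex_mul_left,
    ← nishimori hp nT]
  change 2 * a * mW p g w a - a * mW p g w a = _
  ring

lemma cov_Dg (a : ℝ) : E2 p (fun x0 Z => gb p (ha g w a) (Z + ha g w a x0) (fun x => Wv w x x0)
      * Dg p (ha g w a) w x0 Z) = a * (3 * BW p g w a - 2 * CW p g w a) := by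
  set h := ha g w a with hh
  have nT : Nice (fun x0 Y => gb p h Y (fun x => Wv w x x0)) := N1 hp hgw h (Wv w)
  have nτ : Nice (fun (_ : X) Y => gb p h Y (fun y => gb p h Y (fun x => Wv w x y))) :=
    Nice.gb' hp h (F := fun y Y => gb p h Y (fun x => Wv w x y)) nT
  have n2' : ∀ x0, Nice (fun x Y => Wv w x x0 * gb p h Y (fun y => Wv w y x)) := fun x0 =>
    (Nice.of_fun _).mul nT
  have n2 : Nice (fun x0 Y => gb p h Y (fun x => Wv w x x0 * gb p h Y (fun y => Wv w y x))) :=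
    Nice.gb hp h (F := fun x0 x Y => Wv w x x0 * gb p h Y (fun y => Wv w y x)) n2'
  have eB : Ex p h (fun x0 Y => gb p h Y (fun x => Wv w x x0 * gb p h Y (fun y => Wv w y x)))
      = BW p g w a := by
    unfold BW
    rw [nishimori hp n2, nishimori hp nT.pow]
    congr 1; ext _ Y
    change gb p h Y _ = gb p h Y _
    rw [gb_swap]
    congr 1; ext x
    rw [gb_mul_right, pow_two]
    congr 1
    exact congrArg (gb p h Y) (funext fun y => Wv_comm w x y)
  have eC : Ex p h (fun x0 Y => gb p h Y (fun x => Wv w x x0) *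
      gb p h Y (fun y => gb p h Y (fun x => Wv w x y))) = CW p g w a := by
    unfold CW
    rw [nishimori hp (nT.mul nτ)]
    congr 1; ext _ Y
    rw [gb_mul_right, pow_two]
  have e : E2 p (fun x0 Z => gb p h (Z + h x0) (fun x => Wv w x x0) * Dg p h w x0 Z)
      = Ex p h (fun x0 Y => a * gb p h Y (fun x => Wv w x x0 * gb p h Y (fun y => Wv w y x))
        - 2 * a * (gb p h Y (fun x => Wv w x x0) *
          gb p h Y (fun y => gb p h Y (fun x => Wv w x y)))
        + 2 * a * gb p h Y (fun x => Wv w x x0) ^ 2) := by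
    unfold E2 Ex
    refine Finset.sum_congr rfl fun x0 _ => ?_
    congr 1
    refine (ibpB hp h w x0 (fun x => Wv w x x0)).trans (integral_congr_ae (ae_of_all _ fun Z => ?_))
    have e1 : ∀ x y, Qf h w x y = a * Wv w x y := Qf_ha hgw a
    simp only [e1, gb_mul_left, gb_add]
    have e2 : Wv w x0 = fun x => Wv w x x0 := funext fun x => Wv_comm w x0 x
    have e3 : gb p h (Z + h x0) (fun x => gb p h (Z + h x0) (fun y => Wv w x y))
      = gb p h (Z + h x0) (fun y => gb p h (Z + h x0) (fun x => Wv w x y)) := gb_swap _ _ _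
    have e4 : ∀ x, gb p h (Z + h x0) (fun y => a * Wv w x y)
      = a * gb p h (Z + h x0) (fun y => Wv w y x) := fun x => by
        rw [gb_mul_left]; congr 1
        exact congrArg (gb p h _) (funext fun y => Wv_comm w x y)
    have e5 : (fun x => Wv w x x0 * (a * gb p h (Z + h x0) (fun y => Wv w y x)))
      = fun x => a * (Wv w x x0 * gb p h (Z + h x0) (fun y => Wv w y x)) := by ext x; ring
    simp only [gb_mul_left] at e4
    simp only [e4]
    rw [e3, e5, gb_mul_left]
    ring
  rw [e, Ex_add (((Nice.const a).mul n2).sub ((Nice.const (2 * a)).mul (nT.mul nτ)))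
    ((Nice.const (2 * a)).mul nT.pow), Ex_sub ((Nice.const a).mul n2)
    ((Nice.const (2 * a)).mul (nT.mul nτ)), Ex_mul_left, Ex_mul_left, Ex_mul_left, eB, eC]
  change a * BW p g w a - 2 * a * CW p g w a + 2 * a * BW p g w a = _
  ring

include hM in
lemma var_le (a : ℝ) (ha1 : 1 ≤ a) : AW p g w a - mW p g w a ^ 2
    ≤ (AW p g w a - 2 * BW p g w a + CW p g w a)
      + M * E2 p (fun x0 Z => |Dg p (ha g w a) w x0 Z - a * mW p g w a|) := by
  set h := ha g w a with hh
  have M0 := M_nonneg hp hgw hM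
  have nT : Nice (fun x0 Y => gb p h Y (fun x => Wv w x x0)) := N1 hp hgw h (Wv w)
  have iD := Dg_integrable hp h w
  have iDm : ∀ x0, Integrable (fun Z => Dg p h w x0 Z - a * mW p g w a) (gpi ι) := fun x0 =>
    (iD x0).sub (integrable_const _)
  have iTD : ∀ x0, Integrable (fun Z => gb p h (Z + h x0) (fun x => Wv w x x0) * Dg p h w x0 Z)
      (gpi ι) := fun x0 => by
    obtain ⟨c, C, hC⟩ := nT
    exact (iD x0).bdd_mul (c := C)
      ((c x0).comp (by fun_prop : Continuous fun Z : ι → ℝ => Z + h x0)).measurable.aestronglyMeasurable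
      (ae_of_all _ fun Z => hC x0 _)
  have iT : ∀ x0, Integrable (fun Z => gb p h (Z + h x0) (fun x => Wv w x x0)) (gpi ι) :=
    fun x0 => nT.integrable x0 _
  have hc : E2 p (fun x0 Z => gb p h (Z + h x0) (fun x => Wv w x x0)
      * Dg p h w x0 Z - a * mW p g w a * gb p h (Z + h x0) (fun x => Wv w x x0))
      = a * (3 * BW p g w a - 2 * CW p g w a) - a * mW p g w a * mW p g w a := by
    rw [E2_sub iTD (fun x0 => (iT x0).const_mul _), cov_Dg hp hgw a, E2_mul_left]
    rfl
  have hle : E2 p (fun x0 Z => gb p h (Z + h x0) (fun x => Wv w x x0)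
      * Dg p h w x0 Z - a * mW p g w a * gb p h (Z + h x0) (fun x => Wv w x x0))
      ≤ E2 p (fun x0 Z => M * |Dg p h w x0 Z - a * mW p g w a|) := by
    refine E2_mono hp (fun x0 => (iTD x0).sub ((iT x0).const_mul _))
      (fun x0 => ((iDm x0).abs).const_mul _) fun x0 Z => ?_
    have h1 : |gb p h (Z + h x0) (fun x => Wv w x x0)| ≤ M := gav_abs_le hp _ fun x => hM x x0
    have h2 := le_abs_self (gb p h (Z + h x0) (fun x => Wv w x x0) * (Dg p h w x0 Z - a * mW p g w a))
    rw [abs_mul] at h2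
    have := mul_le_mul_of_nonneg_right h1 (abs_nonneg (Dg p h w x0 Z - a * mW p g w a))
    nlinarith
  rw [E2_mul_left, hc] at hle
  have hBC := BC hp hgw a
  set E := E2 p (fun x0 Z => |Dg p h w x0 Z - a * mW p g w a|)
  have hE : 0 ≤ M * E := mul_nonneg M0 (by
    have := E2_mono hp (F := fun _ _ => 0) (fun _ => integrable_const _) (fun x0 => (iDm x0).abs)
      (fun x0 Z => abs_nonneg _)
    rwa [E2_const hp] at this)
  have h3 : a * (3 * BW p g w a - 2 * CW p g w a - mW p g w a ^ 2 - M * E) ≤ 0 := by nlinarith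
  have h4 : 3 * BW p g w a - 2 * CW p g w a - mW p g w a ^ 2 - M * E ≤ 0 := by
    by_contra hne
    push Not at hne
    nlinarith
  linarith

/-- The convexified free energy. -/
lemma Hy_ha (a : ℝ) (x0 x : X) (Z : ι → ℝ) : Hy (ha g w a) (Z + ha g w a x0) x
    = (∑ k, (g x k * Z k + g x k * g x0 k - g x k ^ 2 / 2)) + (∑ k, w x k * Z k) * a
      + (Wv w x x0 - Wv w x x / 2) * a ^ 2 := by
  unfold Hy ha Wv
  rw [Finset.sum_mul, Finset.sum_div, ← Finset.sum_sub_distrib, Finset.sum_mul,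
    ← Finset.sum_add_distrib, ← Finset.sum_add_distrib]
  refine Finset.sum_congr rfl fun k _ => ?_
  have h1 := hgw x x0 k
  have h2 := hgw x0 x k
  have h3 := hgw x x k
  simp only [Pi.add_apply]
  linear_combination a * h1 + a * h2 - a * h3

omit hgw in
lemma log_shift (H : X → ℝ) (c : ℝ) :
    log (∑ x, p x * exp (H x)) + c = log (∑ x, p x * exp (H x + c)) := by
  have : ∑ x, p x * exp (H x + c) = (∑ x, p x * exp (H x)) * exp c := by
    rw [Finset.sum_mul]
    exact Finset.sum_congr rfl fun x _ => by rw [exp_add]; ring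
  rw [this, log_mul (gav_Zpos hp H).ne' (exp_pos c).ne', log_exp]

include hM in
lemma LZ_convex (x0 : X) (Z : ι → ℝ) :
    ConvexOn ℝ Set.univ (fun a => LZ p (ha g w a) x0 Z + 3 / 2 * M * a ^ 2) := by
  unfold LZ
  simp only [log_shift hp]
  refine logZ_convex hp fun x => ?_
  simp only [Hy_ha hp hgw]
  have h1 := (abs_le.1 (hM x x0)).1
  have h2 := (abs_le.1 (hM x x)).2
  refine ⟨convex_univ, fun s _ t _ α β hα hβ hab => ?_⟩
  simp only [smul_eq_mul]
  have hβe : β = 1 - α := by linarith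
  subst hβe
  have h3 : 0 ≤ (Wv w x x0 - Wv w x x / 2 + 3 / 2 * M) * (α * (1 - α) * (s - t) ^ 2) :=
    mul_nonneg (by linarith) (mul_nonneg (mul_nonneg hα hβ) (sq_nonneg _))
  nlinarith

include hM in
lemma LZ_tangent (x0 : X) (Z : ι → ℝ) (a b : ℝ) :
    LZ p (ha g w a) x0 Z + 3 / 2 * M * a ^ 2 + (b - a) * (Dg p (ha g w a) w x0 Z + 3 * M * a)
      ≤ LZ p (ha g w b) x0 Z + 3 / 2 * M * b ^ 2 := by
  have hc := LZ_convex hp hgw hM x0 Z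
  have hd : HasDerivAt (fun a => LZ p (ha g w a) x0 Z + 3 / 2 * M * a ^ 2)
      (Dg p (ha g w a) w x0 Z + 3 * M * a) a := by
    have h1 : HasDerivAt (fun a => LZ p (ha g w a) x0 Z) (Dg p (ha g w a) w x0 Z) a :=
      logZ_hasDerivAt hp fun x =>
        Hy_hasDerivAt (h := ha g w) (d := fun _ => w) (t := a) (fun x k => ((ha_path g w a).der.self_of_nhds x k)) x0 Z x
    refine (h1.add (((hasDerivAt_id a).pow 2).const_mul (3 / 2 * M))).congr_deriv ?_
    simp; ring
  rcases lt_trichotomy a b with hab | hab | hab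
  · have := hc.le_slope_of_hasDerivAt (Set.mem_univ a) (Set.mem_univ b) hab hd
    rw [slope_def_field, le_div_iff₀ (by linarith)] at this
    linarith
  · subst hab; simp
  · have := hc.slope_le_of_hasDerivAt (Set.mem_univ b) (Set.mem_univ a) hab hd
    rw [slope_def_field, div_le_iff₀ (by linarith)] at this
    linarith

omit hgw in
lemma LZ_integrable (h : X → ι → ℝ) (x0 : X) : Integrable (LZ p h x0) (gpi ι) :=
  (LZ_memLp hp h x0).integrable (by norm_num)

include hM in
lemma G_tangent (a b : ℝ) :
    E2 p (LZ p (ha g w a)) + 3 / 2 * M * a ^ 2 + (b - a) * (a * mW p g w a + 3 * M * a)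
      ≤ E2 p (LZ p (ha g w b)) + 3 / 2 * M * b ^ 2 := by
  have iL := fun a => LZ_integrable hp (ha g w a)
  have iD := fun a => Dg_integrable hp (ha g w a) w
  have := E2_mono hp (F := fun x0 Z => LZ p (ha g w a) x0 Z + ((b - a) * Dg p (ha g w a) w x0 Z +
      (3 / 2 * M * a ^ 2 + (b - a) * (3 * M * a))))
    (G := fun x0 Z => LZ p (ha g w b) x0 Z + 3 / 2 * M * b ^ 2)
    (fun x0 => (iL a x0).add (((iD a x0).const_mul _).add (integrable_const _)))
    (fun x0 => (iL b x0).add (integrable_const _)) (fun x0 Z => by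
      have := LZ_tangent hp hgw hM x0 Z a b
      linarith)
  rw [E2_add (G := fun x0 Z => (b - a) * Dg p (ha g w a) w x0 Z +
      (3 / 2 * M * a ^ 2 + (b - a) * (3 * M * a))) (iL a)
      (fun x0 => ((iD a x0).const_mul _).add (integrable_const _)),
    E2_add (fun x0 => ((iD a x0).const_mul _)) (fun x0 => integrable_const _),
    E2_add (iL b) (fun x0 => integrable_const _), E2_const hp, E2_const hp, E2_mul_left,
    mean_Dg hp hgw] at this
  linarith

include hM in
lemma dev_le {v δ : ℝ} (hδ : 0 < δ) (a : ℝ)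
    (hv : ∀ b, |b - a| ≤ δ → E2 p (fun x0 Z => |LZ p (ha g w b) x0 Z - E2 p (LZ p (ha g w b))|) ≤ v) :
    E2 p (fun x0 Z => |Dg p (ha g w a) w x0 Z - a * mW p g w a|)
      ≤ 3 * v / δ + (((a + δ) * mW p g w (a + δ) + 3 * M * (a + δ))
        - ((a - δ) * mW p g w (a - δ) + 3 * M * (a - δ))) := by
  set γ := fun a => a * mW p g w a + 3 * M * a with hγ
  set dev := fun b x0 Z => |LZ p (ha g w b) x0 Z - E2 p (LZ p (ha g w b))| with hdev
  have iL := fun a => LZ_integrable hp (ha g w a)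
  have iD := fun a => Dg_integrable hp (ha g w a) w
  have idev : ∀ b x0, Integrable (dev b x0) (gpi ι) := fun b x0 =>
    ((iL b x0).sub (integrable_const _)).abs
  have m1 := G_tangent hp hgw hM a (a + δ)
  have m2 := G_tangent hp hgw hM (a + δ) a
  have m3 := G_tangent hp hgw hM a (a - δ)
  have m4 := G_tangent hp hgw hM (a - δ) a
  have pt : ∀ x0 Z, |Dg p (ha g w a) w x0 Z - a * mW p g w a|
      ≤ (1 / δ) * (dev (a + δ) x0 Z + (dev a x0 Z + dev (a - δ) x0 Z)) + (γ (a + δ) - γ (a - δ)) := by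
    intro x0 Z
    have t1 := LZ_tangent hp hgw hM x0 Z a (a + δ)
    have t2 := LZ_tangent hp hgw hM x0 Z a (a - δ)
    have d1 := abs_le.1 (le_refl (dev (a + δ) x0 Z))
    have d2 := abs_le.1 (le_refl (dev a x0 Z))
    have d3 := abs_le.1 (le_refl (dev (a - δ) x0 Z))
    have n1 : 0 ≤ dev (a + δ) x0 Z := abs_nonneg _
    have n3 : 0 ≤ dev (a - δ) x0 Z := abs_nonneg _
    have key : δ * |Dg p (ha g w a) w x0 Z - a * mW p g w a|
      ≤ (dev (a + δ) x0 Z + (dev a x0 Z + dev (a - δ) x0 Z)) + δ * (γ (a + δ) - γ (a - δ)) := by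
      rw [← abs_of_pos hδ, ← abs_mul, abs_of_pos hδ, abs_le]
      simp only [hγ]
      constructor <;> linarith
    rw [← le_div_iff₀' hδ] at key
    refine key.trans (le_of_eq ?_)
    field_simp
  have := E2_mono hp (F := fun x0 Z => |Dg p (ha g w a) w x0 Z - a * mW p g w a|)
    (G := fun x0 Z => (1 / δ) * (dev (a + δ) x0 Z + (dev a x0 Z + dev (a - δ) x0 Z))
      + (γ (a + δ) - γ (a - δ))) (fun x0 => ((iD a x0).sub (integrable_const _)).abs)
    (fun x0 => (((idev (a + δ) x0).add ((idev a x0).add (idev (a - δ) x0))).const_mul (1 / δ)).add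
      (integrable_const _)) pt
  rw [E2_add (F := fun x0 Z => (1 / δ) * (dev (a + δ) x0 Z + (dev a x0 Z + dev (a - δ) x0 Z)))
    (fun x0 => (((idev (a + δ) x0).add ((idev a x0).add (idev (a - δ) x0))).const_mul (1 / δ)))
    (fun _ => integrable_const _), E2_const hp, E2_mul_left,
    E2_add (G := fun x0 Z => dev a x0 Z + dev (a - δ) x0 Z) (idev _) (fun x0 => (idev a x0).add (idev (a - δ) x0)), E2_add (idev _) (idev _)] at this
  refine this.trans ?_
  have v1 := hv (a + δ) (by simp [abs_of_pos hδ])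
  have v2 := hv a (by simp [hδ.le])
  have v3 := hv (a - δ) (by simp [abs_of_pos hδ])
  have : 1 / δ * (E2 p (dev (a + δ)) + (E2 p (dev a) + E2 p (dev (a - δ)))) ≤ 3 * v / δ := by
    rw [one_div, ← div_eq_inv_mul]
    exact div_le_div_of_nonneg_right (by linarith) hδ.le
  linarith

include hM in
/-- Concentration of the overlap, averaged over the perturbation. -/
theorem conc_main {v δ : ℝ} (hδ : 0 < δ) (hδ1 : δ ≤ 1)
    (hv : ∀ b, 0 ≤ b → b ≤ 3 →
      E2 p (fun x0 Z => |LZ p (ha g w b) x0 Z - E2 p (LZ p (ha g w b))|) ≤ v) :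
    ∫ a in (1 : ℝ)..2, (AW p g w a - mW p g w a ^ 2) ≤ M + M * (3 * v / δ + 48 * δ * M) := by
  have M0 := M_nonneg hp hgw hM
  have cm := mW_cont hp g w
  have cD : Continuous fun a => AW p g w a - 2 * BW p g w a + CW p g w a :=
    ((AW_cont hp g w).sub ((BW_cont hp g w).const_mul 2)).add (CW_cont hp g w)
  set γ := fun a => a * mW p g w a + 3 * M * a with hγ
  have cγ : Continuous γ := by fun_prop
  have c1 : Continuous fun a => γ (a + δ) := by fun_prop
  have c2 : Continuous fun a => γ (a - δ) := by fun_prop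
  have step : ∫ a in (1 : ℝ)..2, (AW p g w a - mW p g w a ^ 2)
      ≤ ∫ a in (1 : ℝ)..2, ((AW p g w a - 2 * BW p g w a + CW p g w a)
        + M * (3 * v / δ + (γ (a + δ) - γ (a - δ)))) := by
    refine intervalIntegral.integral_mono_on (by norm_num)
      (((AW_cont hp g w).sub (cm.pow 2)).intervalIntegrable _ _)
      ((by fun_prop : Continuous _).intervalIntegrable _ _) fun a h1 => ?_
    refine (var_le hp hgw hM a h1.1).trans ?_
    have := dev_le hp hgw hM hδ a (v := v) fun b hb => by
      rw [abs_le] at hb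
      exact hv b (by linarith [h1.1, hb.1]) (by linarith [h1.2, hb.2])
    have := mul_le_mul_of_nonneg_left this M0
    simp only [hγ]
    linarith
  refine step.trans ?_
  rw [intervalIntegral.integral_add (cD.intervalIntegrable _ _)
    ((by fun_prop : Continuous _).intervalIntegrable _ _), intervalIntegral.integral_const_mul,
    intervalIntegral.integral_add (g := fun a => γ (a + δ) - γ (a - δ)) (by simp) ((c1.sub c2).intervalIntegrable _ _),
    intervalIntegral.integral_sub (c1.intervalIntegrable _ _) (c2.intervalIntegrable _ _),
    intervalIntegral.integral_comp_add_right, intervalIntegral.integral_comp_sub_right]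
  have hI : ∀ x y, IntervalIntegrable γ volume x y := fun x y => cγ.intervalIntegrable x y
  have e1 : (∫ x in (1 + δ : ℝ)..(2 + δ), γ x) - ∫ x in (1 - δ : ℝ)..(2 - δ), γ x
      = (∫ x in (2 - δ : ℝ)..(2 + δ), γ x) - ∫ x in (1 - δ : ℝ)..(1 + δ), γ x := by
    rw [intervalIntegral.integral_interval_sub_interval_comm (hI _ _) (hI _ _) (hI _ _)]
    rw [intervalIntegral.integral_symm (2 - δ) (2 + δ), intervalIntegral.integral_symm (1 - δ) (1 + δ)]
    ring
  have bd : ∀ x, 0 ≤ x → x ≤ 3 → ‖γ x‖ ≤ 12 * M := by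
    intro x h0 h3
    have := abs_le.1 (mW_abs hp hgw hM x)
    rw [Real.norm_eq_abs, abs_le]
    simp only [hγ]
    constructor <;> nlinarith
  have b1 : |∫ x in (2 - δ : ℝ)..(2 + δ), γ x| ≤ 12 * M * |2 + δ - (2 - δ)| := by
    rw [← Real.norm_eq_abs]
    refine intervalIntegral.norm_integral_le_of_norm_le_const fun x hx => ?_
    rw [Set.uIoc_of_le (by linarith)] at hx
    exact bd x (by linarith [hx.1]) (by linarith [hx.2])
  have b2 : |∫ x in (1 - δ : ℝ)..(1 + δ), γ x| ≤ 12 * M * |1 + δ - (1 - δ)| := by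
    rw [← Real.norm_eq_abs]
    refine intervalIntegral.norm_integral_le_of_norm_le_const fun x hx => ?_
    rw [Set.uIoc_of_le (by linarith)] at hx
    exact bd x (by linarith [hx.1]) (by linarith [hx.2])
  rw [show |2 + δ - (2 - δ)| = 2 * δ by rw [abs_of_pos] <;> linarith] at b1
  rw [show |1 + δ - (1 - δ)| = 2 * δ by rw [abs_of_pos] <;> linarith] at b2
  rw [e1]
  have h5 := (abs_le.1 b1).2
  have h6 := (abs_le.1 b2).1
  have h7 := int_D hp hgw hM
  have h8 : (∫ x in (1 : ℝ)..2, 3 * v / δ) + ((∫ x in (2 - δ : ℝ)..(2 + δ), γ x)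
      - ∫ x in (1 - δ : ℝ)..(1 + δ), γ x) ≤ 3 * v / δ + 48 * δ * M := by
    rw [intervalIntegral.integral_const]
    simp only [smul_eq_mul]
    linarith
  linarith [mul_le_mul_of_nonneg_left h8 M0]

end fixed
end conc

/-! ### Cavity interpolation -/

section cav
variable {X ι : Type*} [Fintype X] [Fintype ι] {p : X → ℝ}

lemma dInt_bd1 (hp : IsW p) (h : X → ι → ℝ) (R : X → X → ℝ) (f : X → X → ℝ) {A : ℝ} (hA : 0 ≤ A)
    (hf : ∀ x0 x, |f x0 x| ≤ A) :
    |Ex p h (fun x0 Y => dInt p h Y R x0 (f x0))|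
      ≤ 4 * A * Ex p h (fun x0 Y => gb p h Y (fun x => |R x x0|)) := by
  have nT : Nice (fun x0 Y => gb p h Y (fun x => |R x x0|)) :=
    Nice.gb hp h (F := fun x0 x _ => |R x x0|) fun x => Nice.of_fun _
  have nτ : Nice (fun (_ : X) Y => gb p h Y (fun y => gb p h Y (fun x => |R x y|))) :=
    Nice.gb' hp h (F := fun y Y => gb p h Y (fun x => |R x y|)) nT
  refine (Ex_abs_le hp (dInt_nice hp h R f)).trans ?_
  have key : ∀ x0 Y, |dInt p h Y R x0 (f x0)| ≤ 2 * A * gb p h Y (fun x => |R x x0|)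
      + 2 * A * gb p h Y (fun y => gb p h Y (fun x => |R x y|)) := by
    intro x0 Y
    unfold dInt
    refine (gav_abs hp _ _).trans ?_
    have e : gb p h Y (fun y => gb p h Y (fun x => |R x y|))
      = gb p h Y (fun y => gb p h Y (fun z => |R y z|)) := gb_swap _ _ _
    set τ := gb p h Y (fun y => gb p h Y (fun z => |R y z|)) with hτ
    set T := gb p h Y (fun x => |R x x0|) with hT
    refine (gav_mono hp _ (g := fun x => A * |R x x0| + A * gb p h Y (fun y => |R x y|)
      + A * T + A * τ) fun x => ?_).trans ?_
    · rw [abs_mul]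
      have h1 : |gb p h Y (fun y => R x y)| ≤ gb p h Y (fun y => |R x y|) := gav_abs hp _ _
      have h2 : |gb p h Y (fun y => R y x0)| ≤ T := gav_abs hp _ _
      have h3 : |gb p h Y (fun y => gb p h Y (fun z => R y z))| ≤ τ :=
        (gav_abs hp _ _).trans (gav_mono hp _ fun y => gav_abs hp _ _)
      have h4 : |R x x0 - gb p h Y (fun y => R x y) - gb p h Y (fun y => R y x0)
        + gb p h Y (fun y => gb p h Y (fun z => R y z))|
        ≤ |R x x0| + gb p h Y (fun y => |R x y|) + T + τ := by
        refine (abs_add_le _ _).trans (add_le_add ((abs_sub _ _).trans (add_le_add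
          ((abs_sub _ _).trans (add_le_add le_rfl h1)) h2)) h3)
      refine (mul_le_mul (hf x0 x) h4 (abs_nonneg _) hA).trans (le_of_eq (by ring))
    · change gb p h Y _ ≤ _
      rw [gb_add, gb_add, gb_add, gb_mul_left, gb_mul_left, gb_const hp, gb_const hp, e, ← hτ, ← hT]
      linarith
  refine (Ex_mono hp (dInt_nice hp h R f).abs
    (((Nice.const (2 * A)).mul nT).add ((Nice.const (2 * A)).mul nτ)) key).trans ?_
  rw [Ex_add ((Nice.const (2 * A)).mul nT) ((Nice.const (2 * A)).mul nτ), Ex_mul_left, Ex_mul_left,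
    ← nishimori hp nT]
  linarith

lemma dInt_bd2 (hp : IsW p) (h : X → ι → ℝ) (R : X → X → ℝ) (f : X → X → ℝ) {B : ℝ}
    (hf : ∀ x0 x, 0 ≤ f x0 x) (hB : ∀ x y, |R x y| ≤ B) :
    |Ex p h (fun x0 Y => dInt p h Y R x0 (f x0))|
      ≤ 4 * B * Ex p h (fun x0 Y => gb p h Y (f x0)) := by
  have nF : Nice (fun x0 Y => gb p h Y (f x0)) :=
    Nice.gb hp h (F := fun x0 x _ => f x0 x) fun x => Nice.of_fun _
  refine (Ex_abs_le hp (dInt_nice hp h R f)).trans ?_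
  rw [← Ex_mul_left]
  refine Ex_mono hp (dInt_nice hp h R f).abs ((Nice.const _).mul nF) fun x0 Y => ?_
  unfold dInt
  refine (gav_abs hp _ _).trans ?_
  rw [← gb_mul_left]
  refine gav_mono hp _ fun x => ?_
  rw [abs_mul, abs_of_nonneg (hf x0 x), mul_comm]
  refine mul_le_mul_of_nonneg_right ?_ (hf x0 x)
  have h1 : |gb p h Y (fun y => R x y)| ≤ B := gav_abs_le hp _ fun y => hB _ _
  have h2 : |gb p h Y (fun y => R y x0)| ≤ B := gav_abs_le hp _ fun y => hB _ _
  have h3 : |gb p h Y (fun y => gb p h Y (fun z => R y z))| ≤ B :=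
    gav_abs_le hp _ fun y => gav_abs_le hp _ fun z => hB _ _
  have h4 : |R x x0 - gb p h Y (fun y => R x y) - gb p h Y (fun y => R y x0)
        + gb p h Y (fun y => gb p h Y (fun z => R y z))| ≤ B + B + B + B :=
    (abs_add_le _ _).trans (add_le_add ((abs_sub _ _).trans (add_le_add
          ((abs_sub _ _).trans (add_le_add (hB _ _) h1)) h2)) h3)
  linarith

theorem cavity (hp : IsW p) {h d : ℝ → X → ι → ℝ} (hc : ∀ x k, Continuous fun t => h t x k)
    (hP : ∀ t, 0 < t → t < 1 → ChPath h d t) {f : X → ℝ} {O : X → X → ℝ} {q ε lam K : ℝ}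
    (hK : 0 ≤ K) (hε : 0 ≤ ε) (hlam : 0 ≤ lam) (hf : ∀ x, |f x| ≤ K)
    (hO : ∀ x y, |O x y - q| ≤ 2 * K ^ 2)
    (hR : ∀ t, 0 < t → t < 1 → ∀ x y,
      Rp (h t) (d t) x y = 2 * t * (f x * f y) * (lam * (O x y - q) + ε)) :
    |Ex p (h 1) (fun x0 Y => gb p (h 1) Y (fun x => f x * f x0))
      - Ex p (h 0) (fun x0 Y => gb p (h 0) Y (fun x => f x * f x0))|
    ≤ 8 * K ^ 4 * (lam * √(exp (8 * K ^ 2 * (2 * lam * K ^ 2 + ε)) *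
        Ex p (h 1) (fun x0 Y => gb p (h 1) Y (fun x => (O x x0 - q) ^ 2))) + ε) := by
  set F := fun t => Ex p (h t) (fun x0 Y => gb p (h t) Y (fun x => f x * f x0)) with hF
  set G := fun t => Ex p (h t) (fun x0 Y => gb p (h t) Y (fun x => (O x x0 - q) ^ 2)) with hG
  set C := 8 * K ^ 2 * (2 * lam * K ^ 2 + ε) with hC
  have hFc : Continuous F := Ex_continuous hp hc (NiceT.gb hp hc
    (F := fun _ x0 x _ => f x * f x0) fun x0 => NiceT.of_fun _)
  have hGc : Continuous G := Ex_continuous hp hc (NiceT.gb hp hc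
    (F := fun _ x0 x _ => (O x x0 - q) ^ 2) fun x0 => NiceT.of_fun _)
  have hG0 : ∀ t, 0 ≤ G t := fun t => Ex_nonneg hp fun x0 Y => gav_nonneg hp _ fun x => sq_nonneg _
  have hff : ∀ x y, |f x * f y| ≤ K ^ 2 := fun x y => by
    rw [abs_mul, pow_two]; exact mul_le_mul (hf x) (hf y) (abs_nonneg _) hK
  have hRa : ∀ t, 0 < t → t < 1 → ∀ x y, |Rp (h t) (d t) x y|
      ≤ 2 * K ^ 2 * (lam * |O x y - q| + ε) := by
    intro t h0 h1 x y
    rw [hR t h0 h1, abs_mul, abs_mul, abs_of_pos (by linarith : 0 < 2 * t)]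
    have e1 : |lam * (O x y - q) + ε| ≤ lam * |O x y - q| + ε := by
      refine (abs_add_le _ _).trans ?_
      rw [abs_mul, abs_of_nonneg hlam, abs_of_nonneg hε]
    refine mul_le_mul (mul_le_mul (by linarith) (hff x y) (abs_nonneg _) (by norm_num)) e1
      (abs_nonneg _) (by positivity)
  have hGd : ∀ t, 0 < t → t < 1 → ∃ g', HasDerivAt G g' t ∧ |g'| ≤ C * G t := by
    intro t h0 h1
    refine ⟨_, Ex_hasDerivAt hp (hP t h0 h1) (fun x0 x => (O x x0 - q) ^ 2), ?_⟩
    refine (dInt_bd2 hp (h t) _ (fun x0 x => (O x x0 - q) ^ 2) (B := 2 * K ^ 2 * (2 * lam * K ^ 2 + ε))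
      (fun x0 x => sq_nonneg _) fun x y => ?_).trans (le_of_eq ?_)
    · refine (hRa t h0 h1 x y).trans (mul_le_mul_of_nonneg_left ?_ (by positivity))
      have := mul_le_mul_of_nonneg_left (hO x y) hlam
      linarith
    · change 4 * _ * G t = _
      rw [hC]; ring
  have hGm : MonotoneOn (fun t => exp (C * t) * G t) (Set.Icc 0 1) := by
    refine monotoneOn_of_deriv_nonneg (convex_Icc 0 1) (by fun_prop) ?_ ?_
    · intro t ht
      rw [interior_Icc] at ht
      obtain ⟨g', hg, _⟩ := hGd t ht.1 ht.2
      have : HasDerivAt (fun t => exp (C * t)) (exp (C * t) * C) t := by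
        simpa using ((hasDerivAt_id t).const_mul C).exp
      exact (this.mul hg).differentiableAt.differentiableWithinAt
    · intro t ht
      rw [interior_Icc] at ht
      obtain ⟨g', hg, hb⟩ := hGd t ht.1 ht.2
      have : HasDerivAt (fun t => exp (C * t)) (exp (C * t) * C) t := by
        simpa using ((hasDerivAt_id t).const_mul C).exp
      have h2 : HasDerivAt (fun t => exp (C * t) * G t) (exp (C * t) * C * G t + exp (C * t) * g') t :=
        this.mul hg
      rw [h2.deriv]
      have := (abs_le.1 hb).1
      have := exp_pos (C * t)
      nlinarith
  have hC0 : 0 ≤ C := by positivity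
  have hGle : ∀ t, 0 < t → t < 1 → G t ≤ exp C * G 1 := by
    intro t h0 h1
    have := hGm (a := t) ⟨h0.le, h1.le⟩ (b := 1) ⟨zero_le_one, le_rfl⟩ h1.le
    simp only [mul_one] at this
    have e1 : 1 ≤ exp (C * t) := one_le_exp (by positivity)
    nlinarith [hG0 t]
  obtain ⟨t, ht, hslope⟩ := exists_hasDerivAt_eq_slope F
    (fun t => Ex p (h t) (fun x0 Y => dInt p (h t) Y (Rp (h t) (d t)) x0 (fun x => f x * f x0)))
    (zero_lt_one) hFc.continuousOn
    (fun t ht => Ex_hasDerivAt hp (hP t ht.1 ht.2) (fun x0 x => f x * f x0))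
  have hs : F 1 - F 0 = Ex p (h t) (fun x0 Y => dInt p (h t) Y (Rp (h t) (d t)) x0
    (fun x => f x * f x0)) := by rw [hslope]; simp
  change |F 1 - F 0| ≤ _
  rw [hs]
  refine (dInt_bd1 hp (h t) _ (fun x0 x => f x * f x0) (by positivity) fun x0 x => hff x x0).trans ?_
  have nA : Nice (fun x0 Y => gb p (h t) Y (fun x => |O x x0 - q|)) :=
    Nice.gb hp (h t) (F := fun x0 x _ => |O x x0 - q|) fun x => Nice.of_fun _
  have nR : Nice (fun x0 Y => gb p (h t) Y (fun x => |Rp (h t) (d t) x x0|)) :=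
    Nice.gb hp (h t) (F := fun x0 x _ => |Rp (h t) (d t) x x0|) fun x => Nice.of_fun _
  have nS : Nice (fun x0 Y => gb p (h t) Y (fun x => (O x x0 - q) ^ 2)) :=
    Nice.gb hp (h t) (F := fun x0 x _ => (O x x0 - q) ^ 2) fun x => Nice.of_fun _
  have s1 : Ex p (h t) (fun x0 Y => gb p (h t) Y (fun x => |O x x0 - q|)) ≤ √(exp C * G 1) := by
    refine Real.le_sqrt_of_sq_le ((Ex_sq_le hp nA).trans ((Ex_mono hp nA.pow nS fun x0 Y => ?_).trans
      (hGle t ht.1 ht.2)))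
    refine (gav_sq_le hp _ _).trans (le_of_eq ?_)
    simp only [sq_abs]; rfl
  have s2 : Ex p (h t) (fun x0 Y => gb p (h t) Y (fun x => |Rp (h t) (d t) x x0|))
      ≤ 2 * K ^ 2 * (lam * √(exp C * G 1) + ε) := by
    refine (Ex_mono hp nR ((Nice.const (2 * K ^ 2)).mul
      (((Nice.const lam).mul nA).add (Nice.const ε))) fun x0 Y => ?_).trans ?_
    · rw [← gb_mul_left, ← gb_const hp (h t) Y ε, ← gb_add, ← gb_mul_left]
      exact gav_mono hp _ fun x => hRa t ht.1 ht.2 x x0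
    · rw [Ex_mul_left, Ex_add ((Nice.const lam).mul nA) (Nice.const ε), Ex_mul_left, Ex_const hp]
      refine mul_le_mul_of_nonneg_left ?_ (by positivity)
      linarith [mul_le_mul_of_nonneg_left s1 hlam]
  refine (mul_le_mul_of_nonneg_left s2 (by positivity)).trans (le_of_eq (by ring))

end cav

/-! ### Decoupled endpoint of the cavity interpolation -/

section endpoint
variable {α J ι : Type*} [Fintype J] [Fintype ι] [Fintype α] [MeasurableSpace α]
  [MeasurableSingletonClass α] [DecidableEq J] [DecidableEq ι]

lemma resample (μ : J → Measure α) [∀ j, IsProbabilityMeasure (μ j)] (j0 : J) (Ψ : (J → α) → ℝ) :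
    ∑ x, (Measure.pi μ).real {x} * Ψ x
      = ∑ x, (Measure.pi μ).real {x} * ∑ s, (μ j0).real {s} * Ψ (Function.update x j0 s) := by
  have e1 := integral_fintype (μ := Measure.pi μ) (f := Ψ) (.of_finite)
  have e2 := integral_fintype (μ := Measure.pi μ)
    (f := fun x => ∑ s, (μ j0).real {s} * Ψ (Function.update x j0 s)) (.of_finite)
  simp only [smul_eq_mul] at e1 e2
  rw [← e1, ← e2]
  conv_lhs => rw [← (mp_update μ j0).map_eq]
  rw [integral_map (mp_update μ j0).measurable.aemeasurable (by fun_prop),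
    integral_prod _ (.of_finite)]
  refine integral_congr_ae (ae_of_all _ fun x => ?_)
  simp only []
  rw [integral_fintype (.of_finite)]
  rfl

lemma isW_one (ν : Measure α) [IsProbabilityMeasure ν] : IsW (fun s : α => ν.real {s}) := by
  refine ⟨fun x => measureReal_nonneg, ?_⟩
  simp

lemma gav_factor (μ : J → Measure α) [∀ j, IsProbabilityMeasure (μ j)] (j0 : J) (H R : (J → α) → ℝ)
    (G F : α → ℝ) (hH : ∀ x s, H (Function.update x j0 s) = R x + G s) :
    gav (fun x => (Measure.pi μ).real {x}) H (fun x => F (x j0))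
      = gav (fun s => (μ j0).real {s}) G F := by
  have key : ∀ F : α → ℝ, ∑ x, (Measure.pi μ).real {x} * exp (H x) * F (x j0)
      = (∑ x, (Measure.pi μ).real {x} * exp (R x)) * ∑ s, (μ j0).real {s} * exp (G s) * F s := by
    intro F
    simp only [mul_assoc]
    rw [resample μ j0 (fun x => exp (H x) * F (x j0)), Finset.sum_mul]
    refine Finset.sum_congr rfl fun x _ => ?_
    rw [mul_assoc, Finset.mul_sum (a := exp (R x))]
    congr 1
    refine Finset.sum_congr rfl fun s _ => ?_
    rw [hH, exp_add, Function.update_self]; ring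
  have k1 := key (fun _ => 1)
  simp only [mul_one] at k1
  have hpos : 0 < ∑ x, (Measure.pi μ).real {x} * exp (R x) := gav_Zpos (isW_pi μ) R
  unfold gav
  rw [key F, k1, mul_div_mul_left _ _ hpos.ne']

/-- scalar channel overlap -/
def scalarOv (ν : Measure α) (c : ℝ) (φ : α → ℝ) : ℝ :=
  ∑ s, ν.real {s} * ∫ z, φ s * gav (fun s => ν.real {s})
    (fun t => c * φ t * (z + c * φ s) - (c * φ t) ^ 2 / 2) φ ∂stdG

lemma scalar_cont (ν : Measure α) [IsProbabilityMeasure ν] (c : ℝ) (φ : α → ℝ) (s : α) :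
    Continuous fun z => φ s * gav (fun s => ν.real {s})
      (fun t => c * φ t * (z + c * φ s) - (c * φ t) ^ 2 / 2) φ := by
  refine continuous_const.mul ?_
  exact gav_continuous (H := fun z t => c * φ t * (z + c * φ s) - (c * φ t) ^ 2 / 2)
    (f := fun _ t => φ t) (isW_one ν) (fun t => by fun_prop) (fun t => continuous_const)

lemma endpoint (μ : J → Measure α) [∀ j, IsProbabilityMeasure (μ j)] (j0 : J) (k0 : ι)
    (h : (J → α) → ι → ℝ) (c : ℝ) (φ : α → ℝ)
    (h1 : ∀ x s k, k ≠ k0 → h (Function.update x j0 s) k = h x k)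
    (h2 : ∀ x, h x k0 = c * φ (x j0)) :
    Ex (fun x => (Measure.pi μ).real {x}) h (fun (x0 : J → α) Y => gb (fun x => (Measure.pi μ).real {x}) h Y
      (fun x => φ (x j0) * φ (x0 j0))) = scalarOv (μ j0) c φ := by
  have e1 : ∀ (x0 : J → α) (Y : ι → ℝ), gb (fun x => (Measure.pi μ).real {x}) h Y (fun x => φ (x j0) * φ (x0 j0))
      = φ (x0 j0) * gav (fun s => (μ j0).real {s})
        (fun t => c * φ t * Y k0 - (c * φ t) ^ 2 / 2) φ := by
    intro x0 Y
    rw [gb_mul_right, mul_comm]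
    congr 1
    refine gav_factor μ j0 _ (fun x => ∑ k ∈ Finset.univ.erase k0, (h x k * Y k - h x k ^ 2 / 2)) _ _ ?_
    intro x s
    unfold Hy
    rw [← Finset.sum_erase_add _ _ (Finset.mem_univ k0), h2, Function.update_self]
    congr 1
    refine Finset.sum_congr rfl fun k hk => ?_
    rw [h1 x s k (Finset.ne_of_mem_erase hk)]
  unfold Ex scalarOv
  simp only [e1, Pi.add_apply, h2]
  have e2 : ∀ x0 : J → α, (∫ Z : ι → ℝ, φ (x0 j0) * gav (fun s => (μ j0).real {s})
        (fun t => c * φ t * (Z k0 + c * φ (x0 j0)) - (c * φ t) ^ 2 / 2) φ ∂gpi ι)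
      = (fun s => ∫ z, φ s * gav (fun s => (μ j0).real {s})
        (fun t => c * φ t * (z + c * φ s) - (c * φ t) ^ 2 / 2) φ ∂stdG) (x0 j0) := by
    intro x0
    have := (measurePreserving_eval (fun _ : ι => stdG) k0).map_eq
    simp only []
    rw [← this, integral_map (measurable_pi_apply k0).aemeasurable]
    · rfl
    · exact (scalar_cont (μ j0) c φ (x0 j0)).aestronglyMeasurable
  simp only [e2]
  rw [resample μ j0 (fun x => (fun s => ∫ z, φ s * gav (fun s => (μ j0).real {s})
        (fun t => c * φ t * (z + c * φ s) - (c * φ t) ^ 2 / 2) φ ∂stdG) (x j0))]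
  simp only [Function.update_self]
  rw [← Finset.sum_mul, (isW_pi μ).sum_eq, one_mul]
end endpoint

section restrict
variable {S : Finset ℝ}

/-- Restriction of a law supported on `S` to the finite type `S`. -/
def QS (S : Finset ℝ) (P : Measure ℝ) : Measure S := P.comap Subtype.val

lemma emb_S (S : Finset ℝ) : MeasurableEmbedding (Subtype.val : S → ℝ) :=
  MeasurableEmbedding.subtype_coe S.measurableSet

lemma QS_map {P : Measure ℝ} (hP : P ((↑S : Set ℝ)ᶜ) = 0) : (QS S P).map Subtype.val = P := by
  unfold QS
  rw [(emb_S S).map_comap]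
  refine Measure.restrict_eq_self_of_ae_mem ?_
  have : Set.range (Subtype.val : S → ℝ) = (↑S : Set ℝ) := by
    ext x; simp
  rw [this]
  exact hP

lemma QS_prob {P : Measure ℝ} [IsProbabilityMeasure P] (hP : P ((↑S : Set ℝ)ᶜ) = 0) :
    IsProbabilityMeasure (QS S P) := by
  have h := QS_map hP
  refine ⟨?_⟩
  have := congrArg (fun m => m Set.univ) h
  simp only [(emb_S S).map_apply] at this
  simpa using this

lemma int_P {P : Measure ℝ} [IsProbabilityMeasure P] (hP : P ((↑S : Set ℝ)ᶜ) = 0) (g : ℝ → ℝ) :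
    ∫ x, g x ∂P = ∑ s : S, (QS S P).real {s} * g s := by
  have := QS_prob hP
  conv_lhs => rw [← QS_map hP]
  rw [(emb_S S).integral_map, integral_fintype (.of_finite)]
  rfl

lemma Fov_eq {P : Measure ℝ} [IsProbabilityMeasure P] (hP : P ((↑S : Set ℝ)ᶜ) = 0) {γ : ℝ}
    (hγ : 0 ≤ γ) : Fov P γ = scalarOv (QS S P) (√γ) (Subtype.val : S → ℝ) := by
  have hQ := QS_prob hP
  have hG := stdG_prob
  have hpm : ∀ x0 z, postMean P γ x0 z = gav (fun s => (QS S P).real {s})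
      (fun t : S => √γ * t * (z + √γ * x0) - (√γ * t) ^ 2 / 2) Subtype.val := by
    intro x0 z
    unfold postMean gav
    rw [int_P hP, int_P hP]
    have : ∀ t : S, scalarWeight γ x0 z t = exp (√γ * t * (z + √γ * x0) - (√γ * t) ^ 2 / 2) := by
      intro t
      unfold scalarWeight
      congr 1
      have := Real.sq_sqrt hγ
      linear_combination (-(t : ℝ) * x0 + (t : ℝ) ^ 2 / 2) * this
    simp only [this]
    congr 1
    refine Finset.sum_congr rfl fun t _ => by ring
  have hprod : P.prod stdG = ((QS S P).prod stdG).map (Prod.map Subtype.val id) := by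
    conv_lhs => rw [← QS_map hP]
    rw [← Measure.map_prod_map _ _ (emb_S S).measurable measurable_id, Measure.map_id]
  unfold Fov
  rw [hprod, ((emb_S S).prodMap MeasurableEmbedding.id).integral_map]
  simp only [Prod.map_fst, Prod.map_snd, id, hpm]
  obtain ⟨C, hC0, hC⟩ := fin_bdd (Subtype.val : S → ℝ)
  rw [integral_prod, integral_fintype (.of_finite)]
  · rfl
  · refine Integrable.of_bound (C := C * C) ?_ (ae_of_all _ fun q => ?_)
    · exact (measurable_from_prod_countable_right fun s =>
        (scalar_cont (QS S P) (√γ) Subtype.val s).measurable).aestronglyMeasurable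
    · rw [Real.norm_eq_abs, abs_mul]
      exact mul_le_mul (hC _) (gav_abs_le (isW_one _) _ hC) (abs_nonneg _) hC0
end restrict

/-! ### The concrete bipartite model as a Gaussian channel -/

/-- Sites: `u`-sites and `v`-sites. -/
abbrev JJ (n : ℕ) := Fin n ⊕ Fin n
/-- Observations: matrix entries, side channels, perturbation channels. -/
abbrev II (n : ℕ) := (Fin n × Fin n) ⊕ (JJ n ⊕ JJ n)
/-- Signal space. -/
abbrev XX (S : Finset ℝ) (n : ℕ) := JJ n → S

section model
variable {S : Finset ℝ} {n : ℕ}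

/-- Channel map with general site dependent scales. -/
def hM (r b b' c c' : Fin n → ℝ) (x : XX S n) : II n → ℝ :=
  Sum.elim (fun ij => r ij.1 * (x (.inl ij.1) : ℝ) * (x (.inr ij.2) : ℝ))
    (Sum.elim (Sum.elim (fun i => b i * (x (.inl i) : ℝ)) (fun j => b' j * (x (.inr j) : ℝ)))
      (Sum.elim (fun i => c i * (x (.inl i) : ℝ)) (fun j => c' j * (x (.inr j) : ℝ))))

lemma Qf_hM (r b b' c c' r2 b2 b2' c2 c2' : Fin n → ℝ) (x y : XX S n) :
    Qf (hM r b b' c c') (hM r2 b2 b2' c2 c2') x y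
      = (∑ i, r i * r2 i * ((x (.inl i) : ℝ) * (y (.inl i) : ℝ)))
          * (∑ j, (x (.inr j) : ℝ) * (y (.inr j) : ℝ))
        + ((∑ i, b i * b2 i * ((x (.inl i) : ℝ) * (y (.inl i) : ℝ)))
          + ∑ j, b' j * b2' j * ((x (.inr j) : ℝ) * (y (.inr j) : ℝ)))
        + ((∑ i, c i * c2 i * ((x (.inl i) : ℝ) * (y (.inl i) : ℝ)))
          + ∑ j, c' j * c2' j * ((x (.inr j) : ℝ) * (y (.inr j) : ℝ))) := by
  unfold Qf hM
  simp only [Fintype.sum_sum_type, Sum.elim_inl, Sum.elim_inr, Fintype.sum_prod_type,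
    Finset.sum_mul_sum, ← add_assoc]
  congr 1; congr 1; congr 1; congr 1
  · exact Finset.sum_congr rfl fun i _ => Finset.sum_congr rfl fun j _ => by ring
  all_goals exact Finset.sum_congr rfl fun i _ => by ring

/-- Overlap of the `v` parts. -/
def OV (x y : XX S n) : ℝ := (1 / (n : ℝ)) * ∑ j, (x (.inr j) : ℝ) * (y (.inr j) : ℝ)

/-- Overlap of the `u` parts. -/
def OU (x y : XX S n) : ℝ := (1 / (n : ℝ)) * ∑ j, (x (.inl j) : ℝ) * (y (.inl j) : ℝ)

variable {K : ℝ} (hK0 : 0 ≤ K) (hK : ∀ s : S, |(s : ℝ)| ≤ K)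

include hK0 hK in
lemma OV_abs (x y : XX S n) : |OV x y| ≤ K ^ 2 := by
  unfold OV
  rcases Nat.eq_zero_or_pos n with rfl | hn
  · simp; positivity
  have hn' : (0 : ℝ) < n := by exact_mod_cast hn
  rw [abs_mul, abs_of_pos (by positivity : (0 : ℝ) < 1 / n), div_mul_eq_mul_div, one_mul,
    div_le_iff₀ hn']
  refine (Finset.abs_sum_le_sum_abs _ _).trans ?_
  have : ∀ j ∈ (Finset.univ : Finset (Fin n)), |(x (.inr j) : ℝ) * (y (.inr j) : ℝ)| ≤ K ^ 2 := by
    intro j _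
    rw [abs_mul, pow_two]
    exact mul_le_mul (hK _) (hK _) (abs_nonneg _) hK0
  refine (Finset.sum_le_sum this).trans (le_of_eq ?_)
  simp [mul_comm]

/-- Cavity path for the `u`-site `i0`. -/
def hP (R bu bv e cv G : ℝ) (i0 : Fin n) (t : ℝ) : XX S n → II n → ℝ :=
  hM (fun i => if i = i0 then R * t else R) (fun i => if i = i0 then bu * t else bu) (fun _ => bv)
    (fun i => if i = i0 then √(e ^ 2 * t ^ 2 + G * (1 - t ^ 2)) else e) (fun _ => cv)

/-- Derivative of the cavity path. -/
def dP (R bu e G : ℝ) (i0 : Fin n) (t : ℝ) : XX S n → II n → ℝ :=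
  hM (fun i => if i = i0 then R else 0) (fun i => if i = i0 then bu else 0) (fun _ => 0)
    (fun i => if i = i0 then (e ^ 2 * t - G * t) / √(e ^ 2 * t ^ 2 + G * (1 - t ^ 2)) else 0)
    (fun _ => 0)

lemma hP_cont (R bu bv e cv G : ℝ) (i0 : Fin n) (x : XX S n) (k : II n) :
    Continuous fun t => hP R bu bv e cv G i0 t x k := by
  unfold hP hM
  rcases k with ⟨i, j⟩ | (i | j) | (i | j) <;> simp only [Sum.elim_inl, Sum.elim_inr]
  · split_ifs <;> fun_prop
  · split_ifs <;> fun_prop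
  · fun_prop
  · split_ifs <;> fun_prop
  · fun_prop

lemma arg_pos {e G t : ℝ} (he : 0 < e) (hG : 0 ≤ G) (h0 : 0 < t) (h1 : t < 1) :
    0 < e ^ 2 * t ^ 2 + G * (1 - t ^ 2) := by
  have : 0 ≤ 1 - t ^ 2 := by nlinarith
  positivity

lemma hP_path (R bu bv cv : ℝ) {e G : ℝ} (he : 0 < e) (hG : 0 ≤ G) (i0 : Fin n) (t : ℝ) (h0 : 0 < t)
    (h1 : t < 1) : ChPath (hP (S := S) R bu bv e cv G i0) (dP R bu e G i0) t := by
  refine ⟨?_, ?_⟩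
  · filter_upwards [Ioo_mem_nhds h0 h1] with t ht x k
    have hs : HasDerivAt (fun t => √(e ^ 2 * t ^ 2 + G * (1 - t ^ 2)))
        ((e ^ 2 * t - G * t) / √(e ^ 2 * t ^ 2 + G * (1 - t ^ 2))) t := by
      have hd : HasDerivAt (fun t => e ^ 2 * t ^ 2 + G * (1 - t ^ 2))
          (e ^ 2 * (2 * t) + G * (0 - 2 * t)) t := by
        have h2 : HasDerivAt (fun t : ℝ => t ^ 2) (2 * t) t := by simpa using hasDerivAt_pow 2 t
        exact (h2.const_mul _).add (((hasDerivAt_const t 1).sub h2).const_mul G)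
      convert hd.sqrt (arg_pos he hG ht.1 ht.2).ne' using 1
      field_simp
      ring
    have hl : ∀ a : ℝ, HasDerivAt (fun t => a * t) a t := fun a => by
      simpa using (hasDerivAt_id t).const_mul a
    unfold hP dP hM
    rcases k with ⟨i, j⟩ | (i | j) | (i | j) <;> simp only [Sum.elim_inl, Sum.elim_inr]
    · split_ifs
      · exact ((hl R).mul_const _).mul_const _
      · simpa using hasDerivAt_const t _
    · split_ifs
      · exact (hl bu).mul_const _
      · simpa using hasDerivAt_const t _
    · simpa using hasDerivAt_const t _
    · split_ifs
      · exact hs.mul_const _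
      · simpa using hasDerivAt_const t _
    · simpa using hasDerivAt_const t _
  · intro x k
    unfold dP hM
    rcases k with ⟨i, j⟩ | (i | j) | (i | j) <;> simp only [Sum.elim_inl, Sum.elim_inr]
    · fun_prop
    · fun_prop
    · fun_prop
    · split_ifs
      · refine ContinuousAt.mul (ContinuousAt.div (by fun_prop) (by fun_prop) ?_) continuousAt_const
        exact (Real.sqrt_pos.2 (arg_pos he hG h0 h1)).ne'
      · fun_prop
    · fun_prop

lemma hP_Rp (hn : 0 < n) {R bu lam qu e q : ℝ} (bv cv : ℝ) (he : 0 < e) (hlam : 0 ≤ lam)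
    (hq : 0 ≤ q) (hqu : 0 ≤ qu)
    (hR : R ^ 2 = lam / n) (hb : bu ^ 2 = lam * qu) (i0 : Fin n) (t : ℝ) (h0 : 0 < t)
    (h1 : t < 1) (x y : XX S n) :
    Rp (hP (S := S) R bu bv e cv (lam * q + lam * qu) i0 t) (dP R bu e (lam * q + lam * qu) i0 t) x y
      = 2 * t * ((x (.inl i0) : ℝ) * (y (.inl i0) : ℝ)) * (lam * (OV x y - q) + e ^ 2) := by
  have hG : 0 ≤ lam * q + lam * qu := by positivity
  have hn' : (n : ℝ) ≠ 0 := by positivity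
  have hs := (Real.sqrt_pos.2 (arg_pos he hG h0 h1)).ne'
  unfold Rp hP dP
  rw [Qf_hM, Qf_hM]
  simp only [mul_zero, zero_mul, Finset.sum_const_zero, add_zero, mul_ite, ite_mul, 
    Finset.sum_ite_eq', Finset.sum_ite_eq, Finset.mem_univ, if_true]
  unfold OV
  set A := ∑ j, (x (.inr j) : ℝ) * (y (.inr j) : ℝ) with hA
  have hA2 : ∑ j, (y (.inr j) : ℝ) * (x (.inr j) : ℝ) = A :=
    Finset.sum_congr rfl fun j _ => mul_comm _ _
  rw [hA2, mul_div_cancel₀ _ hs]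
  have e1 : R * t * R = t * (lam / n) := by rw [← hR]; ring
  have e2 : bu * t * bu = t * (lam * qu) := by rw [← hb]; ring
  rw [e1, e2]
  field_simp
  ring
end model

section model2
variable {S : Finset ℝ} {n : ℕ}

/-- Site laws. -/
def muJ (P Q : Measure S) (n : ℕ) : JJ n → Measure S := Sum.elim (fun _ => P) (fun _ => Q)

instance muJ_prob (P Q : Measure S) [IsProbabilityMeasure P] [IsProbabilityMeasure Q] (j : JJ n) :
    IsProbabilityMeasure (muJ P Q n j) := by
  rcases j with i | j
  · exact ‹IsProbabilityMeasure P›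
  · exact ‹IsProbabilityMeasure Q›

/-- Prior weights. -/
def pJ (P Q : Measure S) (n : ℕ) : XX S n → ℝ := fun x => (Measure.pi (muJ P Q n)).real {x}

lemma pJ_isW (P Q : Measure S) [IsProbabilityMeasure P] [IsProbabilityMeasure Q] :
    IsW (pJ P Q n) := isW_pi _

/-- The channel of the model. -/
def hB (R bu bv e cv : ℝ) : XX S n → II n → ℝ :=
  hM (fun _ => R) (fun _ => bu) (fun _ => bv) (fun _ => e) (fun _ => cv)

lemma hP_one (R bu bv cv G : ℝ) {e : ℝ} (he : 0 ≤ e) (i0 : Fin n) :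
    hP (S := S) R bu bv e cv G i0 1 = hB R bu bv e cv := by
  unfold hP hB
  simp [Real.sqrt_sq he]

variable {P Q : Measure S} [IsProbabilityMeasure P] [IsProbabilityMeasure Q]

lemma hP_zero (R bu bv e cv : ℝ) {G : ℝ} (i0 : Fin n) :
    Ex (pJ P Q n) (hP R bu bv e cv G i0 0) (fun x0 Y => gb (pJ P Q n) (hP R bu bv e cv G i0 0) Y
      (fun x => (x (.inl i0) : ℝ) * (x0 (.inl i0) : ℝ))) = scalarOv P (√G) Subtype.val := by
  refine endpoint (muJ P Q n) (.inl i0) (.inr (.inr (.inl i0))) (hP R bu bv e cv G i0 0) (√G)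
    Subtype.val ?_ ?_
  · intro x s k hk
    unfold hP hM
    rcases k with ⟨i, j⟩ | (i | j) | (i | j) <;> simp only [Sum.elim_inl, Sum.elim_inr]
    · by_cases h : i = i0 <;> simp [h, Function.update_of_ne]
    · by_cases h : i = i0 <;> simp [h, Function.update_of_ne]
    · simp
    · by_cases h : i = i0
      · subst h; simp at hk
      · simp [h, Function.update_of_ne]
    · simp
  · intro x
    unfold hP hM
    simp

lemma N2f (h : XX S n → II n → ℝ) (R : XX S n → XX S n → ℝ) :
    Nice (fun x0 Y => gb (pJ P Q n) h Y (fun x => R x x0)) :=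
  Nice.gb (pJ_isW P Q) h (F := fun x0 x _ => R x x0) fun x0 => Nice.of_fun _

/-- Mean overlap of the `v` parts. -/
def mV (P Q : Measure S) (n : ℕ) (h : XX S n → II n → ℝ) : ℝ :=
  Ex (pJ P Q n) h (fun x0 Y => gb (pJ P Q n) h Y (fun x => OV x x0))

/-- Mean overlap of the `u` parts. -/
def mU (P Q : Measure S) (n : ℕ) (h : XX S n → II n → ℝ) : ℝ :=
  Ex (pJ P Q n) h (fun x0 Y => gb (pJ P Q n) h Y (fun x => OU x x0))

/-- Variance of the `v` overlap. -/
def vV (P Q : Measure S) (n : ℕ) (h : XX S n → II n → ℝ) : ℝ :=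
  Ex (pJ P Q n) h (fun x0 Y => gb (pJ P Q n) h Y (fun x => (OV x x0 - mV P Q n h) ^ 2))

lemma vV_nonneg (h : XX S n → II n → ℝ) : 0 ≤ vV P Q n h :=
  Ex_nonneg (pJ_isW P Q) fun _ _ => gav_nonneg (pJ_isW P Q) _ fun _ => sq_nonneg _

lemma vV_eq (h : XX S n → II n → ℝ) : vV P Q n h =
    Ex (pJ P Q n) h (fun x0 Y => gb (pJ P Q n) h Y (fun x => OV x x0 ^ 2)) - mV P Q n h ^ 2 := by
  have hp : IsW (pJ P Q n) := pJ_isW P Q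
  have e : ∀ (x0 : XX S n) (Y : II n → ℝ),
      gb (pJ P Q n) h Y (fun x => (OV x x0 - mV P Q n h) ^ 2)
      = gb (pJ P Q n) h Y (fun x => OV x x0 ^ 2)
        - (2 * mV P Q n h) * gb (pJ P Q n) h Y (fun x => OV x x0) + mV P Q n h ^ 2 := by
    intro x0 Y
    rw [← gb_mul_left, ← gb_sub]
    conv_rhs => rw [← gb_const hp h Y (mV P Q n h ^ 2)]
    rw [← gb_add]
    congr 1
    funext x
    ring
  unfold vV
  simp only [e]
  have N1 := N2f (P := P) (Q := Q) h (fun x x0 => OV x x0 ^ 2)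
  have N2 := (Nice.const (2 * mV P Q n h)).mul (N2f (P := P) (Q := Q) h (fun x x0 => OV x x0))
  rw [Ex_add (N1.sub N2) (Nice.const _), Ex_sub N1 N2, Ex_const hp, Ex_mul_left]
  change _ - 2 * mV P Q n h * mV P Q n h + _ = _
  ring

lemma mV_nonneg (h : XX S n → II n → ℝ) : 0 ≤ mV P Q n h := by
  have hp : IsW (pJ P Q n) := pJ_isW P Q
  unfold mV
  rw [nishimori hp (N2f (P := P) (Q := Q) h (fun x x0 => OV x x0))]
  refine Ex_nonneg hp fun _ Y => ?_
  have : gb (pJ P Q n) h Y (fun y => gb (pJ P Q n) h Y (fun x => OV x y))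
      = (1 / (n : ℝ)) * ∑ j, gb (pJ P Q n) h Y (fun x => (x (.inr j) : ℝ)) ^ 2 := by
    unfold OV
    simp only [gb_mul_left, gb_sum, gb_mul_right]
    congr 1
    refine Finset.sum_congr rfl fun j _ => ?_
    rw [pow_two]
  rw [this]
  positivity

variable {K : ℝ} (hK0 : 0 ≤ K) (hK : ∀ s : S, |(s : ℝ)| ≤ K)

include hK0 hK in
lemma mV_abs (h : XX S n → II n → ℝ) : |mV P Q n h| ≤ K ^ 2 := by
  have hp : IsW (pJ P Q n) := pJ_isW P Q
  have N := N2f (P := P) (Q := Q) h (fun x x0 => OV x x0)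
  refine (Ex_abs_le hp N).trans ?_
  refine (Ex_mono hp N.abs (Nice.const (K ^ 2)) fun x0 Y => ?_).trans (Ex_const hp _).le
  exact gav_abs_le hp _ fun x => OV_abs hK0 hK x x0

include hK0 hK in
theorem cav_site (hn : 0 < n) {R bu lam qu e : ℝ} (bv cv : ℝ) (he : 0 < e) (hlam : 0 ≤ lam)
    (hqu : 0 ≤ qu) (hR : R ^ 2 = lam / n) (hb : bu ^ 2 = lam * qu) (i0 : Fin n) :
    |Ex (pJ P Q n) (hB R bu bv e cv) (fun x0 Y => gb (pJ P Q n) (hB R bu bv e cv) Y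
        (fun x => (x (.inl i0) : ℝ) * (x0 (.inl i0) : ℝ)))
      - scalarOv P (√(lam * mV P Q n (hB R bu bv e cv) + lam * qu)) Subtype.val|
    ≤ 8 * K ^ 4 * (lam * √(exp (8 * K ^ 2 * (2 * lam * K ^ 2 + e ^ 2)) *
        vV P Q n (hB R bu bv e cv)) + e ^ 2) := by
  have hp : IsW (pJ P Q n) := pJ_isW P Q
  set q := mV P Q n (hB R bu bv e cv) with hq
  have hq0 : 0 ≤ q := mV_nonneg _
  have hqK : |q| ≤ K ^ 2 := mV_abs hK0 hK _
  have hG : 0 ≤ lam * q + lam * qu := by positivity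
  have := cavity hp (h := hP R bu bv e cv (lam * q + lam * qu) i0)
    (d := dP R bu e (lam * q + lam * qu) i0) (hP_cont _ _ _ _ _ _ _)
    (hP_path _ _ _ _ he hG i0) (f := fun x => (x (.inl i0) : ℝ)) (O := OV) (q := q)
    (ε := e ^ 2) (lam := lam) hK0 (by positivity) hlam (fun x => hK _)
    (fun x y => by
      have h1 := OV_abs hK0 hK x y
      have := abs_sub (OV x y) q
      linarith)
    (fun t h0 h1 x y => hP_Rp hn bv cv he hlam hq0 hqu hR hb i0 t h0 h1 x y)
  rw [hP_one _ _ _ _ _ he.le, hP_zero] at this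
  exact this

include hK0 hK in
theorem cav_avg (hn : 0 < n) {R bu lam qu e : ℝ} (bv cv : ℝ) (he : 0 < e) (hlam : 0 ≤ lam)
    (hqu : 0 ≤ qu) (hR : R ^ 2 = lam / n) (hb : bu ^ 2 = lam * qu) :
    |mU P Q n (hB R bu bv e cv)
      - scalarOv P (√(lam * mV P Q n (hB R bu bv e cv) + lam * qu)) Subtype.val|
    ≤ 8 * K ^ 4 * (lam * √(exp (8 * K ^ 2 * (2 * lam * K ^ 2 + e ^ 2)) *
        vV P Q n (hB R bu bv e cv)) + e ^ 2) := by
  have hp : IsW (pJ P Q n) := pJ_isW P Q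
  have hn' : (0 : ℝ) < n := by exact_mod_cast hn
  have h1 := cav_site (P := P) (Q := Q) hK0 hK hn bv cv he hlam hqu hR hb
  set h : XX S n → II n → ℝ := hB R bu bv e cv
  set F := scalarOv P (√(lam * mV P Q n h + lam * qu)) Subtype.val
  set B := 8 * K ^ 4 * (lam * √(exp (8 * K ^ 2 * (2 * lam * K ^ 2 + e ^ 2)) *
        vV P Q n h) + e ^ 2)
  set a : Fin n → ℝ := fun i => Ex (pJ P Q n) h (fun x0 Y => gb (pJ P Q n) h Y
        (fun x => (x (.inl i) : ℝ) * (x0 (.inl i) : ℝ)))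
  have e1 : mU P Q n h = (1 / (n : ℝ)) * ∑ i, a i := by
    unfold mU OU
    simp only [gb_mul_left, gb_sum]
    rw [Ex_mul_left]
    congr 1
    unfold a Ex
    rw [Finset.sum_comm]
    refine Finset.sum_congr rfl fun x0 _ => ?_
    rw [← Finset.mul_sum, integral_finsetSum]
    intro i _
    exact Nice.integrable (N2f (P := P) (Q := Q) h fun x x0 => (x (.inl i) : ℝ) * (x0 (.inl i) : ℝ)) _ _
  have e2 : mU P Q n h - F = (1 / (n : ℝ)) * ∑ i, (a i - F) := by
    rw [e1, Finset.sum_sub_distrib]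
    simp
    field_simp
  rw [e2, abs_mul, abs_of_pos (by positivity : (0 : ℝ) < 1 / n), div_mul_eq_mul_div, one_mul,
    div_le_iff₀ hn']
  refine (Finset.abs_sum_le_sum_abs _ _).trans ((Finset.sum_le_sum fun i _ => h1 i).trans ?_)
  simp [mul_comm]
end model2

section model3
variable {S : Finset ℝ} {n : ℕ}
variable {P Q : Measure S} [IsProbabilityMeasure P] [IsProbabilityMeasure Q]
variable {K : ℝ} (hK0 : 0 ≤ K) (hK : ∀ s : S, |(s : ℝ)| ≤ K)

/-- Lipschitz constant of the log-likelihood with respect to a site. -/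
def ccK (K lam qu qv : ℝ) : ℝ := lam * K ^ 3 + (lam * qu + lam * qv + 13) * K

/-- Variance constant of the free energy. -/
def CV (K lam qu qv : ℝ) : ℝ :=
  4 * (lam * K ^ 4 + (lam * qu + lam * qv + 13) * K ^ 2) + 8 * ccK K lam qu qv ^ 2 * K ^ 2

lemma Qf_hB (R bu bv e c : ℝ) (x y : XX S n) :
    Qf (hB R bu bv e c) (hB R bu bv e c) x y
      = R ^ 2 * ((∑ i, (x (.inl i) : ℝ) * (y (.inl i) : ℝ))
          * (∑ j, (x (.inr j) : ℝ) * (y (.inr j) : ℝ)))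
        + (bu ^ 2 + e ^ 2) * (∑ i, (x (.inl i) : ℝ) * (y (.inl i) : ℝ))
        + (bv ^ 2 + c ^ 2) * (∑ j, (x (.inr j) : ℝ) * (y (.inr j) : ℝ)) := by
  unfold hB
  rw [Qf_hM]
  simp only [← Finset.mul_sum]
  ring

include hK0 hK in
lemma site_bd (x y0 : XX S n) (τ : Fin n → JJ n) :
    |∑ i, (x (τ i) : ℝ) * (y0 (τ i) : ℝ)| ≤ n * K ^ 2 := by
  refine (Finset.abs_sum_le_sum_abs _ _).trans ?_
  have : ∀ j ∈ (Finset.univ : Finset (Fin n)), |(x (τ j) : ℝ) * (y0 (τ j) : ℝ)| ≤ K ^ 2 := by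
    intro j _
    rw [abs_mul, pow_two]
    exact mul_le_mul (hK _) (hK _) (abs_nonneg _) hK0
  refine (Finset.sum_le_sum this).trans (le_of_eq ?_)
  simp

include hK0 hK in
lemma site_diff (x x0 y0 : XX S n) (τ : Fin n → JJ n) :
    |(∑ i, (x (τ i) : ℝ) * (x0 (τ i) : ℝ)) - ∑ i, (x (τ i) : ℝ) * (y0 (τ i) : ℝ)|
      ≤ K * ∑ i, |(x0 (τ i) : ℝ) - (y0 (τ i) : ℝ)| := by
  rw [← Finset.sum_sub_distrib, Finset.mul_sum]
  refine (Finset.abs_sum_le_sum_abs _ _).trans (Finset.sum_le_sum fun i _ => ?_)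
  rw [← mul_sub, abs_mul]
  exact mul_le_mul_of_nonneg_right (hK _) (abs_nonneg _)

include hK0 hK in
lemma free_var (hn : 0 < n) {R bu bv e c lam qu qv : ℝ} (hlam : 0 ≤ lam)
    (hqu : 0 ≤ qu) (hqv : 0 ≤ qv) (hR : R ^ 2 = lam / n) (hbu : bu ^ 2 = lam * qu)
    (hbv : bv ^ 2 = lam * qv) (he : e ^ 2 ≤ 4) (hc : c ^ 2 ≤ 9) :
    E2 (pJ P Q n) (fun x0 Z => |LZ (pJ P Q n) (hB R bu bv e c) x0 Z
      - E2 (pJ P Q n) (LZ (pJ P Q n) (hB R bu bv e c))|) ≤ √(CV K lam qu qv * n) := by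
  have hn' : (0 : ℝ) < n := by exact_mod_cast hn
  have hcc : 0 ≤ ccK K lam qu qv := by unfold ccK; positivity
  refine LZ_var (muJ P Q n) rfl (hB R bu bv e c)
    (b := Sum.elim (fun _ => |R| * K ^ 2) (Sum.elim (Sum.elim (fun _ => |bu| * K) (fun _ => |bv| * K))
      (Sum.elim (fun _ => |e| * K) (fun _ => |c| * K)))) ?_ ?_ (φ := Subtype.val) (K := K) hK
    (c := fun _ => ccK K lam qu qv) (fun _ => hcc) ?_ ?_
  · rintro (⟨i, j⟩ | (i | j) | (i | j)) <;> simp only [Sum.elim_inl, Sum.elim_inr] <;> positivity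
  · intro x k
    unfold hB hM
    rcases k with ⟨i, j⟩ | (i | j) | (i | j) <;> simp only [Sum.elim_inl, Sum.elim_inr, abs_mul]
    · rw [pow_two, ← mul_assoc]
      exact mul_le_mul (mul_le_mul_of_nonneg_left (hK _) (abs_nonneg _)) (hK _) (abs_nonneg _)
        (by positivity)
    all_goals exact mul_le_mul_of_nonneg_left (hK _) (abs_nonneg _)
  · intro x x0 y0
    have e1 : ∑ k, hB R bu bv e c x k * (hB R bu bv e c x0 k - hB R bu bv e c y0 k)
        = Qf (hB R bu bv e c) (hB R bu bv e c) x x0 - Qf (hB R bu bv e c) (hB R bu bv e c) x y0 := by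
      unfold Qf
      rw [← Finset.sum_sub_distrib]
      exact Finset.sum_congr rfl fun k _ => by ring
    rw [e1, Qf_hB, Qf_hB, Fintype.sum_sum_type, ← Finset.mul_sum, ← Finset.mul_sum, hR, hbu, hbv]
    have dU := site_diff hK0 hK x x0 y0 .inl
    have dV := site_diff hK0 hK x x0 y0 .inr
    have bB := site_bd hK0 hK x x0 .inr
    have bA := site_bd hK0 hK x y0 .inl
    set A0 := ∑ i, (x (.inl i) : ℝ) * (x0 (.inl i) : ℝ)
    set A1 := ∑ i, (x (.inl i) : ℝ) * (y0 (.inl i) : ℝ)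
    set B0 := ∑ i, (x (.inr i) : ℝ) * (x0 (.inr i) : ℝ)
    set B1 := ∑ i, (x (.inr i) : ℝ) * (y0 (.inr i) : ℝ)
    set DU := ∑ i, |(x0 (.inl i) : ℝ) - (y0 (.inl i) : ℝ)|
    set DV := ∑ i, |(x0 (.inr i) : ℝ) - (y0 (.inr i) : ℝ)|
    have hDU : 0 ≤ DU := Finset.sum_nonneg fun _ _ => abs_nonneg _
    have hDV : 0 ≤ DV := Finset.sum_nonneg fun _ _ => abs_nonneg _
    have e2 : lam / n * (A0 * B0) + (lam * qu + e ^ 2) * A0 + (lam * qv + c ^ 2) * B0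
        - (lam / n * (A1 * B1) + (lam * qu + e ^ 2) * A1 + (lam * qv + c ^ 2) * B1)
        = (lam / n) * ((A0 - A1) * B0 + A1 * (B0 - B1)) + (lam * qu + e ^ 2) * (A0 - A1)
          + (lam * qv + c ^ 2) * (B0 - B1) := by ring
    rw [e2]
    have h1 : |(A0 - A1) * B0 + A1 * (B0 - B1)| ≤ K * DU * (n * K ^ 2) + n * K ^ 2 * (K * DV) := by
      refine (abs_add_le _ _).trans (add_le_add ?_ ?_) <;> rw [abs_mul]
      · exact mul_le_mul dU bB (abs_nonneg _) (by positivity)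
      · exact mul_le_mul bA dV (abs_nonneg _) (by positivity)
    have h2 : |(lam / n) * ((A0 - A1) * B0 + A1 * (B0 - B1))| ≤ lam * K ^ 3 * (DU + DV) := by
      rw [abs_mul, abs_of_nonneg (by positivity : 0 ≤ lam / n)]
      refine (mul_le_mul_of_nonneg_left h1 (by positivity)).trans (le_of_eq ?_)
      field_simp
    have h3 : |(lam * qu + e ^ 2) * (A0 - A1)| ≤ (lam * qu + 4) * (K * DU) := by
      rw [abs_mul, abs_of_nonneg (by positivity : 0 ≤ lam * qu + e ^ 2)]
      exact mul_le_mul (by linarith) dU (abs_nonneg _) (by positivity)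
    have h4 : |(lam * qv + c ^ 2) * (B0 - B1)| ≤ (lam * qv + 9) * (K * DV) := by
      rw [abs_mul, abs_of_nonneg (by positivity : 0 ≤ lam * qv + c ^ 2)]
      exact mul_le_mul (by linarith) dV (abs_nonneg _) (by positivity)
    have h5 := (abs_add_le ((lam / n) * ((A0 - A1) * B0 + A1 * (B0 - B1))
      + (lam * qu + e ^ 2) * (A0 - A1)) ((lam * qv + c ^ 2) * (B0 - B1)))
    have h6 := (abs_add_le ((lam / n) * ((A0 - A1) * B0 + A1 * (B0 - B1)))
      ((lam * qu + e ^ 2) * (A0 - A1)))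
    have h7 : 0 ≤ (lam * qv + 9) * (K * DU) := by positivity
    have h8 : 0 ≤ (lam * qu + 4) * (K * DV) := by positivity
    unfold ccK
    nlinarith
  · simp only [Fintype.sum_sum_type, Sum.elim_inl, Sum.elim_inr, Finset.sum_const, Finset.card_univ,
      Fintype.card_prod, Fintype.card_fin, nsmul_eq_mul, mul_pow, sq_abs, hR, hbu, hbv]
    unfold CV
    have h1 : ((n * n : ℕ) : ℝ) * (4 * (lam / n * (K ^ 2) ^ 2)) = n * (4 * lam * K ^ 4) := by
      push_cast
      field_simp
    rw [h1]
    have h2 : n * (e ^ 2 * K ^ 2) ≤ n * (4 * K ^ 2) := by gcongr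
    have h3 : n * (c ^ 2 * K ^ 2) ≤ n * (9 * K ^ 2) := by gcongr
    have h4 : ((Fintype.card (JJ n) : ℕ) : ℝ) = 2 * n := by
      simp [JJ, two_mul]
    rw [h4]
    nlinarith

lemma ha_hB (R bu bv e σ a : ℝ) :
    ha (hB (S := S) (n := n) R bu bv e 0) (hB 0 0 0 0 σ) a = hB R bu bv e (σ * a) := by
  funext x k
  unfold ha hB hM
  rcases k with ⟨i, j⟩ | (i | j) | (i | j) <;> simp only [Sum.elim_inl, Sum.elim_inr] <;> ring

lemma Wv_hB (hn : 0 < n) (σ : ℝ) (x y : XX S n) :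
    Wv (hB (S := S) (n := n) 0 0 0 0 σ) x y = σ ^ 2 * n * OV x y := by
  have := Qf_hB 0 0 0 0 σ x y
  have hn' : (n : ℝ) ≠ 0 := by positivity
  change Qf _ _ x y = _
  rw [this]
  unfold OV
  field_simp
  ring

include hK0 hK in
theorem conc_model (hn : 0 < n) {R bu bv e s lam qu qv δ : ℝ} (hlam : 0 ≤ lam)
    (hqu : 0 ≤ qu) (hqv : 0 ≤ qv) (hR : R ^ 2 = lam / n) (hbu : bu ^ 2 = lam * qu)
    (hbv : bv ^ 2 = lam * qv) (he : e ^ 2 ≤ 4) (hs0 : 0 < s) (hs1 : s ≤ 1) (hδ : 0 < δ) (hδ1 : δ ≤ 1) :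
    ∫ a in (1 : ℝ)..2, vV P Q n (hB R bu bv e (√s * a))
      ≤ K ^ 2 / (s * n) + K ^ 2 * (3 * √(CV K lam qu qv * n) / (δ * (s * n)) + 48 * δ * K ^ 2) := by
  have hn' : (0 : ℝ) < n := by exact_mod_cast hn
  have hp : IsW (pJ P Q n) := pJ_isW P Q
  have hN : 0 < s * n := by positivity
  have hW := Wv_hB (S := S) hn (√s)
  rw [Real.sq_sqrt hs0.le] at hW
  have hc := conc_main hp (g := hB R bu bv e 0) (w := hB 0 0 0 0 (√s)) (M := s * n * K ^ 2)
    (fun x y k => by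
      unfold hB hM
      rcases k with ⟨i, j⟩ | (i | j) | (i | j) <;> simp only [Sum.elim_inl, Sum.elim_inr] <;> ring)
    (fun x y => by
      rw [hW, abs_mul, abs_of_pos hN]
      exact mul_le_mul_of_nonneg_left (OV_abs hK0 hK x y) hN.le)
    hδ hδ1 (v := √(CV K lam qu qv * n))
    (fun b hb0 hb3 => by
      rw [ha_hB]
      refine free_var hK0 hK hn hlam hqu hqv hR hbu hbv he ?_
      rw [mul_pow, Real.sq_sqrt hs0.le]
      nlinarith)
  have e1 : ∀ a, AW (pJ P Q n) (hB R bu bv e 0) (hB 0 0 0 0 (√s)) a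
      - mW (pJ P Q n) (hB R bu bv e 0) (hB 0 0 0 0 (√s)) a ^ 2
      = (s * n) ^ 2 * vV P Q n (hB R bu bv e (√s * a)) := by
    intro a
    rw [vV_eq]
    unfold AW mW mV
    simp only [ha_hB, hW, mul_pow, gb_mul_left, Ex_mul_left]
    ring
  simp only [e1] at hc
  rw [intervalIntegral.integral_const_mul] at hc
  have h2 : 0 < (s * n) ^ 2 := by positivity
  have h3 := (le_div_iff₀' h2).2 hc
  refine h3.trans (le_of_eq ?_)
  field_simp
end model3

/-! ### Identification of the model with the abstract channel -/

/-- Sample space. -/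
abbrev Om (n : ℕ) := (((Fin n → ℝ) × (Fin n → ℝ)) × (Fin n → Fin n → ℝ)) ×
      (((Fin n → ℝ) × (Fin n → ℝ)) × ((Fin n → ℝ) × (Fin n → ℝ)))

instance : IsProbabilityMeasure stdG := stdG_prob

lemma mp_uncurry (n : ℕ) : MeasurePreserving (fun Z : Fin n → Fin n → ℝ => fun p : Fin n × Fin n =>
    Z p.1 p.2) (noiseM n) (gpi (Fin n × Fin n)) := by
  have hm : Measurable (fun Z : Fin n → Fin n → ℝ => fun p : Fin n × Fin n => Z p.1 p.2) := by
    fun_prop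
  refine ⟨hm, ?_⟩
  unfold gpi
  refine (Measure.pi_eq fun s hs => ?_).symm
  rw [Measure.map_apply hm (MeasurableSet.univ_pi hs)]
  have : (fun Z : Fin n → Fin n → ℝ => fun p : Fin n × Fin n => Z p.1 p.2) ⁻¹' (Set.univ.pi s)
      = Set.univ.pi fun i => Set.univ.pi fun j => s (i, j) := by
    ext Z; simp [Set.mem_pi]
  rw [this]
  unfold noiseM
  rw [Measure.pi_pi]
  simp only [Measure.pi_pi]
  rw [Fintype.prod_prod_type]

lemma mp_curry (n : ℕ) : MeasurePreserving (fun Z : Fin n × Fin n → ℝ => fun i j => Z (i, j))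
    (gpi (Fin n × Fin n)) (noiseM n) := by
  have hm : Measurable (fun Z : Fin n × Fin n → ℝ => fun i j => Z (i, j)) := by fun_prop
  refine ⟨hm, ?_⟩
  rw [← (mp_uncurry n).map_eq, Measure.map_map hm (mp_uncurry n).measurable]
  exact Measure.map_id

section ident
variable {S : Finset ℝ} {n : ℕ}

/-- The pair of vectors of a configuration. -/
def uvx (x : XX S n) : (Fin n → ℝ) × (Fin n → ℝ) :=
  (fun i => (x (.inl i) : ℝ), fun j => (x (.inr j) : ℝ))

/-- The sample point built from signal and noise. -/
def Tht (q : XX S n × (II n → ℝ)) : Om n :=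
  ((uvx q.1, fun i j => q.2 (.inl (i, j))),
    ((fun i => q.2 (.inr (.inl (.inl i))), fun i => q.2 (.inr (.inl (.inr i)))),
     (fun i => q.2 (.inr (.inr (.inl i))), fun i => q.2 (.inr (.inr (.inr i))))))

variable {PU PV : Measure ℝ} [IsProbabilityMeasure PU] [IsProbabilityMeasure PV]
  (hU : PU ((↑S : Set ℝ)ᶜ) = 0) (hV : PV ((↑S : Set ℝ)ᶜ) = 0)

include hU hV in
lemma mp_uvx : MeasurePreserving (uvx (S := S) (n := n))
    (Measure.pi (muJ (QS S PU) (QS S PV) n)) (prior PU PV n) := by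
  have := QS_prob hU
  have := QS_prob hV
  have h1 := measurePreserving_sumPiEquivProdPi (muJ (QS S PU) (QS S PV) n)
  have h2 : MeasurePreserving (Subtype.val : S → ℝ) (QS S PU) PU := ⟨(emb_S S).measurable, QS_map hU⟩
  have h3 : MeasurePreserving (Subtype.val : S → ℝ) (QS S PV) PV := ⟨(emb_S S).measurable, QS_map hV⟩
  have h4 := (measurePreserving_pi (ι := Fin n) (fun _ => QS S PU) (fun _ => PU) fun _ => h2).prod
    (measurePreserving_pi (ι := Fin n) (fun _ => QS S PV) (fun _ => PV) fun _ => h3)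
  exact h4.comp h1

lemma mp_noise (n : ℕ) : MeasurePreserving (fun Z : II n → ℝ =>
    ((fun i j => Z (.inl (i, j)) : Fin n → Fin n → ℝ),
    (((fun i => Z (.inr (.inl (.inl i))) : Fin n → ℝ), (fun i => Z (.inr (.inl (.inr i))) : Fin n → ℝ)),
     ((fun i => Z (.inr (.inr (.inl i))) : Fin n → ℝ),
      (fun i => Z (.inr (.inr (.inr i))) : Fin n → ℝ)))))
    (gpi (II n)) ((noiseM n).prod (((gvec n).prod (gvec n)).prod ((gvec n).prod (gvec n)))) := by
  have h1 := measurePreserving_sumPiEquivProdPi (fun _ : II n => stdG)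
  have h2 := measurePreserving_sumPiEquivProdPi (fun _ : JJ n ⊕ JJ n => stdG)
  have h3 := measurePreserving_sumPiEquivProdPi (fun _ : JJ n => stdG)
  exact ((mp_curry n).prod ((h3.prod h3).comp h2)).comp h1

instance gvec_prob (n : ℕ) : IsProbabilityMeasure (gvec n) := by unfold gvec; infer_instance
instance noiseM_prob (n : ℕ) : IsProbabilityMeasure (noiseM n) := by unfold noiseM; infer_instance
instance prior_prob (n : ℕ) : IsProbabilityMeasure (prior PU PV n) := by unfold prior; infer_instance

include hU hV in
lemma mp_Tht : MeasurePreserving (Tht (S := S) (n := n))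
    ((Measure.pi (muJ (QS S PU) (QS S PV) n)).prod (gpi (II n))) (sampleP PU PV n) := by
  have := QS_prob hU
  have := QS_prob hV
  have h1 := (mp_uvx (n := n) hU hV).prod (mp_noise n)
  have h2 := (measurePreserving_prodAssoc (prior PU PV n) (noiseM n)
    (((gvec n).prod (gvec n)).prod ((gvec n).prod (gvec n)))).symm
  exact h2.comp h1

include hU hV in
lemma int_prior {f : (Fin n → ℝ) × (Fin n → ℝ) → ℝ} (hf : Continuous f) :
    ∫ uv, f uv ∂(prior PU PV n) = ∑ x, pJ (QS S PU) (QS S PV) n x * f (uvx x) := by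
  have := QS_prob hU
  have := QS_prob hV
  rw [← (mp_uvx (n := n) hU hV).map_eq, integral_map (mp_uvx (n := n) hU hV).measurable.aemeasurable
    hf.aestronglyMeasurable, integral_fintype (.of_finite)]
  rfl

lemma HamTot_cont (lam qu qv au av : ℝ) (ω : Om n) :
    Continuous fun uv : (Fin n → ℝ) × (Fin n → ℝ) => HamTot lam qu qv n au av ω uv.1 uv.2 := by
  unfold HamTot Ham
  fun_prop

lemma HamTot_contω (lam qu qv au av : ℝ) (u v : Fin n → ℝ) :
    Continuous fun ω : Om n => HamTot lam qu qv n au av ω u v := by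
  unfold HamTot Ham
  fun_prop

include hU hV in
lemma gibbs_eq (lam qu qv au av : ℝ) (ω : Om n) {f : (Fin n → ℝ) × (Fin n → ℝ) → ℝ}
    (hf : Continuous f) : gibbsTot PU PV lam qu qv n au av ω f
      = gav (pJ (QS S PU) (QS S PV) n) (fun x => HamTot lam qu qv n au av ω (uvx x).1 (uvx x).2)
        (fun x => f (uvx x)) := by
  have hc := HamTot_cont lam qu qv au av ω
  unfold gibbsTot gav
  rw [int_prior hU hV (f := fun uv => f uv * rexp (HamTot lam qu qv n au av ω uv.1 uv.2))
    (hf.mul hc.rexp), int_prior hU hV hc.rexp]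
  congr 1
  exact Finset.sum_congr rfl fun x _ => by ring

/-- The channel with the parameters of the model. -/
def hN (S : Finset ℝ) (lam qu qv : ℝ) (n : ℕ) (au av : ℝ) : XX S n → II n → ℝ :=
  hB (√(lam / n)) (√(lam * qu)) (√(lam * qv)) (√(sSeq n) * au) (√(sSeq n) * av)

lemma add_four {a b c d a' b1 b2 c' d' : ℝ} (h0 : a = a') (h1 : b = b1 + b2) (h2 : c = c')
    (h3 : d = d') : a + b + c + d = a' + (b1 + b2 + (c' + d')) := by
  subst h0 h1 h2 h3; ring

lemma HamTot_eq {lam qu qv : ℝ} (hlam : 0 ≤ lam) (hqu : 0 ≤ qu) (hqv : 0 ≤ qv) (au av : ℝ)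
    (x0 x : XX S n) (Z : II n → ℝ) :
    HamTot lam qu qv n au av (Tht (x0, Z)) (uvx x).1 (uvx x).2
      = Hy (hN S lam qu qv n au av) (Z + hN S lam qu qv n au av x0) x := by
  have e1 : √(lam / n) ^ 2 = lam / n := Real.sq_sqrt (by positivity)
  have e2 : √(lam * qu) ^ 2 = lam * qu := Real.sq_sqrt (by positivity)
  have e3 : √(lam * qv) ^ 2 = lam * qv := Real.sq_sqrt (by positivity)
  have e4 : √(sSeq n) ^ 2 = sSeq n := Real.sq_sqrt (by unfold sSeq; positivity)
  unfold HamTot Ham Hy hN hB hM Tht uvx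
  simp only [Pi.add_apply, Fintype.sum_sum_type, Sum.elim_inl, Sum.elim_inr, Fintype.sum_prod_type]
  set R := √(lam / n)
  set bu := √(lam * qu)
  set bv := √(lam * qv)
  set σ := √(sSeq n)
  have e5 : lam / (2 * n) = R ^ 2 / 2 := by rw [e1]; ring
  rw [e5, ← e1, ← e2, ← e3, ← e4]
  refine add_four ?_ ?_ ?_ ?_
  · exact Finset.sum_congr rfl fun i _ => Finset.sum_congr rfl fun j _ => by ring
  · rw [← Finset.sum_add_distrib]
    exact Finset.sum_congr rfl fun i _ => by ring
  · exact Finset.sum_congr rfl fun i _ => by ring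
  · exact Finset.sum_congr rfl fun i _ => by ring

include hU hV in
lemma Eov_gen {lam qu qv : ℝ} (hlam : 0 ≤ lam) (hqu : 0 ≤ qu) (hqv : 0 ≤ qv) (au av : ℝ)
    {f : (Fin n → ℝ) × (Fin n → ℝ) → (Fin n → ℝ) × (Fin n → ℝ) → ℝ}
    (hf : Continuous fun q : ((Fin n → ℝ) × (Fin n → ℝ)) × ((Fin n → ℝ) × (Fin n → ℝ)) =>
      f q.1 q.2) :
    ∫ ω, gibbsTot PU PV lam qu qv n au av ω
      (fun uv1 => gibbsTot PU PV lam qu qv n au av ω (fun uv2 => f uv1 uv2)) ∂(sampleP PU PV n)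
    = Ex (pJ (QS S PU) (QS S PV) n) (hN S lam qu qv n au av) (fun x0 Y =>
        gb (pJ (QS S PU) (QS S PV) n) (hN S lam qu qv n au av) Y (fun x => f (uvx x) (uvx x0))) := by
  have := QS_prob hU
  have := QS_prob hV
  have hp : IsW (pJ (QS S PU) (QS S PV) n) := pJ_isW _ _
  have hf1 : ∀ a, Continuous (f a) := fun a => hf.comp (by fun_prop : Continuous fun b => (a, b))
  have hf2 : ∀ b, Continuous (fun a => f a b) :=
    fun b => hf.comp (by fun_prop : Continuous fun a => (a, b))
  have hH : ∀ x : XX S n, Continuous fun ω : Om n =>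
    HamTot lam qu qv n au av ω (uvx x).1 (uvx x).2 := fun x => HamTot_contω _ _ _ _ _ _ _
  set p := pJ (QS S PU) (QS S PV) n with hpdef
  set h := hN S lam qu qv n au av with hh
  set H : Om n → XX S n → ℝ := fun ω x => HamTot lam qu qv n au av ω (uvx x).1 (uvx x).2 with hHdef
  have e1 : ∀ ω, gibbsTot PU PV lam qu qv n au av ω
      (fun uv1 => gibbsTot PU PV lam qu qv n au av ω (fun uv2 => f uv1 uv2))
      = gav p (H ω) (fun x => gav p (H ω) (fun y => f (uvx x) (uvx y))) := by
    intro ω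
    have e2 : ∀ uv1, gibbsTot PU PV lam qu qv n au av ω (fun uv2 => f uv1 uv2)
        = gav p (H ω) (fun y => f uv1 (uvx y)) := fun uv1 => gibbs_eq hU hV _ _ _ _ _ _ (hf1 uv1)
    simp only [e2]
    refine gibbs_eq hU hV _ _ _ _ _ _ (f := fun uv1 => gav p (H ω) (fun y => f uv1 (uvx y))) ?_
    exact gav_continuous (H := fun _ => H ω) (f := fun uv1 y => f uv1 (uvx y)) hp
      (fun x => continuous_const) (fun x => hf2 _)
  simp only [e1]
  have hc : Continuous fun ω => gav p (H ω) (fun x => gav p (H ω) (fun y => f (uvx x) (uvx y))) :=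
    gav_continuous (f := fun ω x => gav p (H ω) (fun y => f (uvx x) (uvx y))) hp hH (fun x =>
      gav_continuous (f := fun _ y => f (uvx x) (uvx y)) hp hH fun y => continuous_const)
  rw [← (mp_Tht (n := n) hU hV).map_eq, integral_map (mp_Tht (n := n) hU hV).measurable.aemeasurable
    hc.aestronglyMeasurable]
  have e3 : ∀ q : XX S n × (II n → ℝ), gav p (H (Tht q)) (fun x => gav p (H (Tht q))
      (fun y => f (uvx x) (uvx y)))
      = (fun (x0 : XX S n) (Y : II n → ℝ) => gb p h Y (fun y => gb p h Y
        (fun x => f (uvx x) (uvx y)))) q.1 (q.2 + h q.1) := by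
    rintro ⟨x0, Z⟩
    have : H (Tht (x0, Z)) = Hy h (Z + h x0) := by
      funext x
      exact HamTot_eq hlam hqu hqv au av x0 x Z
    rw [this]
    exact gb_swap h (Z + h x0) (fun x y => f (uvx x) (uvx y))
  simp only [e3]
  have N : Nice (fun (x0 : XX S n) (Y : II n → ℝ) => gb p h Y (fun x => f (uvx x) (uvx x0))) :=
    N2f h (fun x x0 => f (uvx x) (uvx x0))
  have N' := N.gb' hp h
  rw [nishimori hp N, Ex_eq_E2]
  refine (E2_eq_integral (muJ (QS S PU) (QS S PV) n) (Ψ := fun x0 Z => (fun (x0 : XX S n)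
    (Y : II n → ℝ) => gb p h Y (fun y => gb p h Y
        (fun x => f (uvx x) (uvx y)))) x0 (Z + h x0)) ?_).symm
  obtain ⟨C, hC⟩ := N'.2
  refine Integrable.of_bound (C := C) ?_ (ae_of_all _ fun q => hC q.1 _)
  exact (measurable_from_prod_countable_right fun x0 =>
    ((N'.1 x0).comp (by fun_prop : Continuous fun Z => Z + h x0)).measurable).aestronglyMeasurable

include hU hV in
lemma EovU_eq {lam qu qv : ℝ} (hlam : 0 ≤ lam) (hqu : 0 ≤ qu) (hqv : 0 ≤ qv) (au av : ℝ) :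
    EovU PU PV lam qu qv n au av = mU (QS S PU) (QS S PV) n (hN S lam qu qv n au av) :=
  Eov_gen hU hV hlam hqu hqv au av (f := fun a b => ovDot n a.1 b.1) (by unfold ovDot; fun_prop)

include hU hV in
lemma EovV_eq {lam qu qv : ℝ} (hlam : 0 ≤ lam) (hqu : 0 ≤ qu) (hqv : 0 ≤ qv) (au av : ℝ) :
    EovV PU PV lam qu qv n au av = mV (QS S PU) (QS S PV) n (hN S lam qu qv n au av) :=
  Eov_gen hU hV hlam hqu hqv au av (f := fun a b => ovDot n a.2 b.2) (by unfold ovDot; fun_prop)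
end ident

/-! ### Exchanging the roles of `u` and `v` -/

lemma mp_transpose (n : ℕ) : MeasurePreserving (fun Z : Fin n → Fin n → ℝ => fun i j => Z j i)
    (noiseM n) (noiseM n) := by
  have hm : Measurable (fun Z : Fin n × Fin n → ℝ => fun p : Fin n × Fin n => Z p.swap) := by
    fun_prop
  have h2 : MeasurePreserving (fun Z : Fin n × Fin n → ℝ => fun p : Fin n × Fin n => Z p.swap)
      (gpi (Fin n × Fin n)) (gpi (Fin n × Fin n)) := by
    refine ⟨hm, ?_⟩
    unfold gpi
    refine (Measure.pi_eq fun s hs => ?_).symm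
    rw [Measure.map_apply hm (MeasurableSet.univ_pi hs)]
    have : (fun Z : Fin n × Fin n → ℝ => fun p : Fin n × Fin n => Z p.swap) ⁻¹' (Set.univ.pi s)
        = Set.univ.pi fun p => s p.swap := by
      ext Z
      simp only [Set.mem_preimage, Set.mem_pi, Set.mem_univ, true_imp_iff]
      exact ⟨fun h p => by simpa using h p.swap, fun h p => by simpa using h p.swap⟩
    rw [this, Measure.pi_pi]
    exact (Equiv.prodComm (Fin n) (Fin n)).prod_comp fun p => stdG (s p)
  exact (mp_curry n).comp (h2.comp (mp_uncurry n))

/-- Exchange of `u` and `v` on the sample space. -/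
def sigO (n : ℕ) : Om n ≃ᵐ Om n where
  toFun ω := (((ω.1.1.2, ω.1.1.1), fun i j => ω.1.2 j i),
    ((ω.2.1.2, ω.2.1.1), (ω.2.2.2, ω.2.2.1)))
  invFun ω := (((ω.1.1.2, ω.1.1.1), fun i j => ω.1.2 j i),
    ((ω.2.1.2, ω.2.1.1), (ω.2.2.2, ω.2.2.1)))
  left_inv ω := rfl
  right_inv ω := rfl
  measurable_toFun := by
    simp only [Equiv.coe_fn_mk]
    fun_prop
  measurable_invFun := by
    simp only [Equiv.coe_fn_symm_mk]
    fun_prop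

section swap
variable {PU PV : Measure ℝ} [IsProbabilityMeasure PU] [IsProbabilityMeasure PV] {n : ℕ}

lemma mp_sigO : MeasurePreserving (sigO n) (sampleP PU PV n) (sampleP PV PU n) := by
  have h1 : MeasurePreserving Prod.swap (prior PU PV n) (prior PV PU n) :=
    Measure.measurePreserving_swap
  have h2 : MeasurePreserving Prod.swap ((gvec n).prod (gvec n)) ((gvec n).prod (gvec n)) :=
    Measure.measurePreserving_swap
  exact (h1.prod (mp_transpose n)).prod (h2.prod h2)

lemma HamTot_swap (lam qu qv au av : ℝ) (ω : Om n) (u v : Fin n → ℝ) :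
    HamTot lam qv qu n av au (sigO n ω) v u = HamTot lam qu qv n au av ω u v := by
  unfold HamTot Ham sigO
  simp only [MeasurableEquiv.coe_mk, Equiv.coe_fn_mk]
  rw [Finset.sum_comm]
  rw [add_right_comm]
  congr 1; congr 1; congr 1
  · exact Finset.sum_congr rfl fun i _ => Finset.sum_congr rfl fun j _ => by ring
  · exact Finset.sum_congr rfl fun i _ => by ring

lemma int_prior_swap (f : (Fin n → ℝ) × (Fin n → ℝ) → ℝ) :
    ∫ uv, f uv ∂(prior PU PV n) = ∫ uv, f uv.swap ∂(prior PV PU n) :=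
  (integral_prod_swap (μ := Measure.pi fun _ : Fin n => PU) (ν := Measure.pi fun _ : Fin n => PV)
    f).symm

lemma gibbs_swap (lam qu qv au av : ℝ) (ω : Om n) (f : (Fin n → ℝ) × (Fin n → ℝ) → ℝ) :
    gibbsTot PU PV lam qu qv n au av ω f
      = gibbsTot PV PU lam qv qu n av au (sigO n ω) (fun uv => f uv.swap) := by
  unfold gibbsTot
  rw [int_prior_swap (PU := PU), int_prior_swap (PU := PU)]
  simp only [HamTot_swap, Prod.fst_swap, Prod.snd_swap]

lemma EovV_swap (lam qu qv au av : ℝ) :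
    EovV PU PV lam qu qv n au av = EovU PV PU lam qv qu n av au := by
  unfold EovV EovU
  rw [← (mp_sigO (PU := PU) (PV := PV)).integral_comp']
  refine integral_congr_ae (ae_of_all _ fun ω => ?_)
  simp only []
  rw [gibbs_swap]
  congr 1
  funext uv
  rw [gibbs_swap]
  rfl

lemma EovU_swap (lam qu qv au av : ℝ) :
    EovU PU PV lam qu qv n au av = EovV PV PU lam qv qu n av au := (EovV_swap _ _ _ _ _).symm
end swap

/-! ### Conclusion -/

section concl
variable {S : Finset ℝ} {n : ℕ}

lemma hN_cont (lam qu qv : ℝ) (x : XX S n) (k : II n) :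
    Continuous fun t : ℝ × ℝ => hN S lam qu qv n t.1 t.2 x k := by
  unfold hN hB hM
  rcases k with k | (k | k) | (k | k) <;> simp <;> fun_prop

lemma vV_cont {P Q : Measure S} [IsProbabilityMeasure P] [IsProbabilityMeasure Q]
    (lam qu qv : ℝ) :
    Continuous fun t : ℝ × ℝ => vV P Q n (hN S lam qu qv n t.1 t.2) := by
  have hp : IsW (pJ P Q n) := pJ_isW P Q
  have hc := hN_cont (S := S) (n := n) lam qu qv
  simp_rw [vV_eq]
  refine Continuous.sub ?_ (Continuous.pow ?_ 2)
  · exact Ex_continuous (h := fun t : ℝ × ℝ => hN S lam qu qv n t.1 t.2) hp hc (NiceT.gb hp hc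
      (F := fun _ x0 x _ => OV x x0 ^ 2) fun x0 => NiceT.of_fun _)
  · exact Ex_continuous (h := fun t : ℝ × ℝ => hN S lam qu qv n t.1 t.2) hp hc (NiceT.gb hp hc
      (F := fun _ x0 x _ => OV x x0) fun x0 => NiceT.of_fun _)

/-- Rate. -/
def tn (n : ℕ) : ℝ := (n : ℝ) ^ (1 / 8 : ℝ)

/-- Exponential constant. -/
def EE (K lam : ℝ) : ℝ := exp (8 * K ^ 2 * (2 * lam * K ^ 2 + 4))

/-- Constant of the variance bound. -/
def CC (K lam qu qv : ℝ) : ℝ := K ^ 2 + K ^ 2 * (3 * √(CV K lam qu qv) + 48 * K ^ 2)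

/-- Final constant. -/
def MM (K lam qu qv : ℝ) : ℝ := 8 * K ^ 4 * (lam * (1 + EE K lam * CC K lam qu qv) + 4)

lemma tn_one (hn : 0 < n) : 1 ≤ tn n := by
  unfold tn
  exact Real.one_le_rpow (by exact_mod_cast hn) (by norm_num)

lemma tn_pow (n : ℕ) : tn n ^ 8 = n := by
  unfold tn
  rw [← Real.rpow_natCast, ← Real.rpow_mul (by positivity)]
  norm_num

lemma sSeq_tn (n : ℕ) : sSeq n = (tn n ^ 2)⁻¹ := by
  unfold tn sSeq
  rw [← Real.rpow_natCast, ← Real.rpow_mul (by positivity), ← Real.rpow_neg (by positivity)]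
  norm_num

lemma sqrt_young {x η : ℝ} (hx : 0 ≤ x) (hη : 0 < η) : √x ≤ η + x / η := by
  have h : x / η * η = x := by field_simp
  have h0 : 0 ≤ x / η := by positivity
  rw [Real.sqrt_le_left (by positivity)]
  nlinarith [sq_nonneg (η - x / η), sq_nonneg (x / η), sq_nonneg η]

lemma CV_nonneg {K lam qu qv : ℝ} (hK0 : 0 ≤ K) (hlam : 0 ≤ lam) (hqu : 0 ≤ qu) (hqv : 0 ≤ qv) :
    0 ≤ CV K lam qu qv := by
  unfold CV; positivity

lemma vV_int {P Q : Measure S} [IsProbabilityMeasure P] [IsProbabilityMeasure Q] {K : ℝ}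
    (hK0 : 0 ≤ K) (hK : ∀ s : S, |(s : ℝ)| ≤ K) (hn : 0 < n) {lam qu qv au : ℝ}
    (hlam : 0 ≤ lam) (hqu : 0 ≤ qu) (hqv : 0 ≤ qv) (hau : au ∈ Set.Icc (1 : ℝ) 2) :
    ∫ av in (1 : ℝ)..2, vV P Q n (hN S lam qu qv n au av) ≤ CC K lam qu qv / tn n := by
  have ht := tn_one hn
  have ht0 : 0 < tn n := by linarith
  have hs : sSeq n ≤ 1 := by rw [sSeq_tn]; exact inv_le_one_of_one_le₀ (one_le_pow₀ ht)
  have hs0 : 0 < sSeq n := by rw [sSeq_tn]; positivity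
  obtain ⟨h1, h2⟩ := hau
  have hc := conc_model (P := P) (Q := Q) hK0 hK hn (R := √(lam / n)) (bu := √(lam * qu))
    (bv := √(lam * qv)) (e := √(sSeq n) * au) (s := sSeq n) (δ := (tn n)⁻¹) hlam hqu hqv
    (Real.sq_sqrt (by positivity)) (Real.sq_sqrt (by positivity)) (Real.sq_sqrt (by positivity))
    (by rw [mul_pow, Real.sq_sqrt hs0.le]; nlinarith) hs0 hs (by positivity)
    (inv_le_one_of_one_le₀ ht)
  unfold hN
  refine hc.trans ?_
  have e1 : sSeq n * n = tn n ^ 6 := by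
    have h8 := tn_pow n
    rw [sSeq_tn, ← h8]; field_simp
  have e2 : √(CV K lam qu qv * n) = √(CV K lam qu qv) * tn n ^ 4 := by
    rw [Real.sqrt_mul (CV_nonneg hK0 hlam hqu hqv)]
    congr 1
    rw [Real.sqrt_eq_iff_mul_self_eq (by positivity) (by positivity), ← tn_pow n]; ring
  rw [e1, e2]
  have e3 : K ^ 2 / tn n ^ 6 ≤ K ^ 2 / tn n := by
    apply div_le_div_of_nonneg_left (by positivity) ht0
    exact le_self_pow₀ ht (by norm_num)
  refine (add_le_add_left e3 _).trans (le_of_eq ?_)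
  unfold CC
  field_simp

variable {PU PV : Measure ℝ} [IsProbabilityMeasure PU] [IsProbabilityMeasure PV]
  (hU : PU ((↑S : Set ℝ)ᶜ) = 0) (hV : PV ((↑S : Set ℝ)ᶜ) = 0)

include hU hV in
lemma key_bound {K : ℝ}
    (hK0 : 0 ≤ K) (hK : ∀ s : S, |(s : ℝ)| ≤ K) (hn : 0 < n) {lam qu qv : ℝ}
    (hlam : 0 ≤ lam) (hqu : 0 ≤ qu) (hqv : 0 ≤ qv) :
    ∃ g : ℝ × ℝ → ℝ, Continuous g ∧ (∀ au ∈ Set.Icc (1 : ℝ) 2, ∀ av ∈ Set.Icc (1 : ℝ) 2,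
      |EovU PU PV lam qu qv n au av
            - Fov PU (lam * EovV PU PV lam qu qv n au av + lam * qu)| ≤ g (au, av)) ∧
      ∀ au ∈ Set.Icc (1 : ℝ) 2, ∫ av in (1 : ℝ)..2, g (au, av) ≤ MM K lam qu qv * (√(tn n))⁻¹ := by
  have := QS_prob hU
  have := QS_prob hV
  have ht := tn_one hn
  have ht0 : 0 < tn n := by linarith
  have hst0 : 0 < √(tn n) := Real.sqrt_pos.2 ht0
  have hs : sSeq n ≤ 1 := by rw [sSeq_tn]; exact inv_le_one_of_one_le₀ (one_le_pow₀ ht)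
  have hs0 : 0 < sSeq n := by rw [sSeq_tn]; positivity
  have hst1 : 1 ≤ √(tn n) := Real.one_le_sqrt.2 ht
  have hsq : √(tn n) * √(tn n) = tn n := Real.mul_self_sqrt ht0.le
  have hss : sSeq n ≤ (√(tn n))⁻¹ := by
    rw [sSeq_tn]
    apply inv_anti₀ hst0
    nlinarith
  have hE : 0 < EE K lam := exp_pos _
  set η := (√(tn n))⁻¹ with hη
  have hη0 : 0 < η := by positivity
  set v : ℝ × ℝ → ℝ := fun t => vV (QS S PU) (QS S PV) n (hN S lam qu qv n t.1 t.2) with hv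
  have hvc : Continuous v := vV_cont lam qu qv
  refine ⟨fun t => 8 * K ^ 4 * (lam * (η + EE K lam * v t / η) + 4 * η), by fun_prop, ?_, ?_⟩
  · intro au hau av hav
    rw [EovU_eq hU hV hlam hqu hqv, EovV_eq hU hV hlam hqu hqv]
    have hm := mV_nonneg (P := QS S PU) (Q := QS S PV) (hN S lam qu qv n au av)
    rw [Fov_eq hU (by positivity)]
    have he : (√(sSeq n) * au) ^ 2 ≤ 4 * sSeq n := by
      rw [mul_pow, Real.sq_sqrt hs0.le]
      have h1 := hau.1
      have h2 := hau.2
      have h3 : au ^ 2 ≤ 4 := by nlinarith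
      nlinarith
    have hc := cav_avg (P := QS S PU) (Q := QS S PV) hK0 hK hn (R := √(lam / n)) (bu := √(lam * qu))
      (√(lam * qv)) (√(sSeq n) * av) (e := √(sSeq n) * au)
      (mul_pos (Real.sqrt_pos.2 hs0) (by linarith [hau.1])) hlam hqu
      (Real.sq_sqrt (by positivity)) (Real.sq_sqrt (by positivity))
    refine hc.trans ?_
    have hv0 : 0 ≤ v (au, av) := vV_nonneg _
    change 8 * K ^ 4 * (lam * √(_ * v (au, av)) + _) ≤ _
    refine mul_le_mul_of_nonneg_left (add_le_add (mul_le_mul_of_nonneg_left ?_ hlam)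
      (by linarith)) (by positivity)
    refine le_trans (Real.sqrt_le_sqrt ?_) (sqrt_young (by positivity) hη0)
    refine mul_le_mul_of_nonneg_right ?_ hv0
    unfold EE
    gcongr
    linarith
  · intro au hau
    have hvi := vV_int (P := QS S PU) (Q := QS S PV) hK0 hK hn hlam hqu hqv hau
    have hvc' : Continuous fun av : ℝ => v (au, av) := by fun_prop
    have hii : IntervalIntegrable (fun av : ℝ => v (au, av)) volume 1 2 :=
      hvc'.intervalIntegrable _ _
    have e : ∀ av : ℝ, 8 * K ^ 4 * (lam * (η + EE K lam * v (au, av) / η) + 4 * η)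
        = 8 * K ^ 4 * (lam * η + 4 * η) + (8 * K ^ 4 * lam * EE K lam / η) * v (au, av) := by
      intro av; ring
    simp_rw [e]
    rw [intervalIntegral.integral_add (by simp) (hii.const_mul _),
      intervalIntegral.integral_const, intervalIntegral.integral_const_mul]
    have h2 : (8 * K ^ 4 * lam * EE K lam / η) * ∫ av in (1 : ℝ)..2, v (au, av)
        ≤ (8 * K ^ 4 * lam * EE K lam / η) * (CC K lam qu qv / tn n) :=
      mul_le_mul_of_nonneg_left hvi (by positivity)
    have h3 : (8 * K ^ 4 * lam * EE K lam / η) * (CC K lam qu qv / tn n)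
        = 8 * K ^ 4 * lam * EE K lam * CC K lam qu qv * η := by
      rw [← hsq, hη]; field_simp
    rw [h3] at h2
    unfold MM
    norm_num
    linarith

lemma dbl_bound {D : ℝ → ℝ → ℝ} {g : ℝ × ℝ → ℝ} (hg : Continuous g)
    (h0 : ∀ a b, 0 ≤ D a b)
    (h : ∀ a ∈ Set.Icc (1 : ℝ) 2, ∀ b ∈ Set.Icc (1 : ℝ) 2, D a b ≤ g (a, b)) :
    ∫ a in (1 : ℝ)..2, ∫ b in (1 : ℝ)..2, D a b ≤ ∫ a in (1 : ℝ)..2, ∫ b in (1 : ℝ)..2, g (a, b) := by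
  have hgc : Continuous fun a : ℝ => ∫ b in (1 : ℝ)..2, g (a, b) :=
    intervalIntegral.continuous_parametric_intervalIntegral_of_continuous' (by exact hg) _ _
  have hin : ∀ a ∈ Set.Icc (1 : ℝ) 2, ∫ b in (1 : ℝ)..2, D a b ≤ ∫ b in (1 : ℝ)..2, g (a, b) := by
    intro a ha
    have hc : Continuous fun b : ℝ => g (a, b) := by fun_prop
    have := hc.intervalIntegrable (μ := volume) 1 2
    rw [intervalIntegral.integral_of_le one_le_two, intervalIntegral.integral_of_le one_le_two]
    refine integral_mono_of_nonneg (Eventually.of_forall fun b => h0 a b) this.1 ?_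
    filter_upwards [ae_restrict_mem measurableSet_Ioc] with b hb
    exact h a ha b ⟨hb.1.le, hb.2⟩
  have := hgc.intervalIntegrable (μ := volume) 1 2
  rw [intervalIntegral.integral_of_le one_le_two, intervalIntegral.integral_of_le one_le_two]
  refine integral_mono_of_nonneg (Eventually.of_forall fun a => ?_) this.1 ?_
  · exact intervalIntegral.integral_nonneg one_le_two fun b _ => h0 a b
  filter_upwards [ae_restrict_mem measurableSet_Ioc] with b hb
  exact hin b ⟨hb.1.le, hb.2⟩

lemma dbl_le {g : ℝ × ℝ → ℝ} {B : ℝ} (hg : Continuous g)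
    (h : ∀ a ∈ Set.Icc (1 : ℝ) 2, ∫ b in (1 : ℝ)..2, g (a, b) ≤ B) :
    ∫ a in (1 : ℝ)..2, ∫ b in (1 : ℝ)..2, g (a, b) ≤ B := by
  have hgc : Continuous fun a : ℝ => ∫ b in (1 : ℝ)..2, g (a, b) :=
    intervalIntegral.continuous_parametric_intervalIntegral_of_continuous' (by exact hg) _ _
  refine (intervalIntegral.integral_mono_on one_le_two (hgc.intervalIntegrable _ _)
    (g := fun _ => B) (by simp) h).trans ?_
  norm_num

lemma dbl_swap {g : ℝ × ℝ → ℝ} (hg : Continuous g) :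
    ∫ a in (1 : ℝ)..2, ∫ b in (1 : ℝ)..2, g (b, a) = ∫ a in (1 : ℝ)..2, ∫ b in (1 : ℝ)..2, g (a, b) := by
  simp_rw [intervalIntegral.integral_of_le (one_le_two (α := ℝ))]
  refine integral_integral_swap (f := fun a b => g (b, a)) ?_
  rw [Measure.prod_restrict]
  have hc : Continuous fun p : ℝ × ℝ => g (p.2, p.1) := by fun_prop
  exact (hc.continuousOn.integrableOn_compact (isCompact_Icc.prod isCompact_Icc)).mono_set
    (Set.prod_mono Set.Ioc_subset_Icc_self Set.Ioc_subset_Icc_self)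

lemma rate_tendsto (M : ℝ) : Tendsto (fun n : ℕ => M * (√(tn n))⁻¹) atTop (𝓝 0) := by
  have h1 : Tendsto (fun n : ℕ => tn n) atTop atTop :=
    (tendsto_rpow_atTop (by norm_num)).comp tendsto_natCast_atTop_atTop
  have h2 := (Real.tendsto_sqrt_atTop.comp h1).inv_tendsto_atTop
  simpa using h2.const_mul M

end concl

/-- **Asymptotic fixed point (state evolution) equations for the overlaps** in the
perturbed bipartite model with `s_n = n^{-1/4}` and `(a_u,a_v)` uniform on `[1,2]²`. -/
theorem state_evolution_fixed_point
    (K₀ : ℝ) (S : Finset ℝ) (hSK : ∀ x ∈ S, |x| ≤ K₀)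
    (PU PV : Measure ℝ) [IsProbabilityMeasure PU] [IsProbabilityMeasure PV]
    (hUS : PU ((↑S : Set ℝ)ᶜ) = 0) (hVS : PV ((↑S : Set ℝ)ᶜ) = 0)
    (hUvar : 0 < (∫ x, x ^ 2 ∂PU) - (∫ x, x ∂PU) ^ 2)
    (hVvar : 0 < (∫ x, x ^ 2 ∂PV) - (∫ x, x ∂PV) ^ 2)
    (lam : ℝ) (hlam : 0 < lam) (qu qv : ℝ) (hqu : 0 ≤ qu) (hqv : 0 ≤ qv) :
    Tendsto
      (fun n =>
        ∫ au in (1 : ℝ)..2, ∫ av in (1 : ℝ)..2,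
          |EovU PU PV lam qu qv n au av
            - Fov PU (lam * EovV PU PV lam qu qv n au av + lam * qu)|)
      atTop (𝓝 0)
    ∧ Tendsto
      (fun n =>
        ∫ au in (1 : ℝ)..2, ∫ av in (1 : ℝ)..2,
          |EovV PU PV lam qu qv n au av
            - Fov PV (lam * EovU PU PV lam qu qv n au av + lam * qv)|)
      atTop (𝓝 0) := by
  have hK : ∀ s : S, |(s : ℝ)| ≤ |K₀| := fun s => (hSK s s.2).trans (le_abs_self _)
  constructor
  · refine tendsto_of_tendsto_of_tendsto_of_le_of_le' tendsto_const_nhds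
      (rate_tendsto (MM |K₀| lam qu qv)) ?_ ?_
    · refine Eventually.of_forall fun n => ?_
      exact intervalIntegral.integral_nonneg one_le_two fun _ _ =>
        intervalIntegral.integral_nonneg one_le_two fun _ _ => abs_nonneg _
    · filter_upwards [eventually_gt_atTop 0] with n hn
      obtain ⟨g, hg, h1, h2⟩ := key_bound hUS hVS (abs_nonneg K₀) hK hn hlam.le hqu hqv
      exact (dbl_bound hg (fun _ _ => abs_nonneg _) h1).trans (dbl_le hg h2)
  · refine tendsto_of_tendsto_of_tendsto_of_le_of_le' tendsto_const_nhds
      (rate_tendsto (MM |K₀| lam qv qu)) ?_ ?_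
    · refine Eventually.of_forall fun n => ?_
      exact intervalIntegral.integral_nonneg one_le_two fun _ _ =>
        intervalIntegral.integral_nonneg one_le_two fun _ _ => abs_nonneg _
    · filter_upwards [eventually_gt_atTop 0] with n hn
      obtain ⟨g, hg, h1, h2⟩ := key_bound hVS hUS (abs_nonneg K₀) hK hn hlam.le hqv hqu
      have hg' : Continuous fun t : ℝ × ℝ => g (t.2, t.1) := by fun_prop
      refine (dbl_bound hg' (fun _ _ => abs_nonneg _) ?_).trans
        ((dbl_swap hg).le.trans (dbl_le hg h2))
      intro au hau av hav
      have h3 := h1 av hav au hau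
      rw [← EovV_swap lam qu qv au av, ← EovU_swap lam qu qv au av] at h3
      exact h3
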